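/- arXiv:1207.2475 — 2 statements merged into one kernel-verified Lean document; each statement's English description precedes it below -/
import Mathlib

section
/- Let {(m_n, d_n)} be a sequence of bi-degree-sequences with ∑_i m_{ni} = ∑_i d_{ni} =: l_n for all n, satisfying: the empirical joint in/out-degree distribution converges weakly to (γ, ξ) with E[γ] = E[ξ] = μ > 0, and the empirical first moments, covariance, and second moments converge to those of (γ, ξ) (all finite). Then the number of self-loops S_n and the number of (excess) multiple same-direction edges M_n in the directed configuration model satisfy (S_n, M_n) ⇒ (S, M), where S and M are independent Poisson random variables with means λ_1 = E[γξ]/μ and λ_2 = E[γ(γ-1)]E[ξ(ξ-1)]/(2μ²). -/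
open MeasureTheory Filter
open scoped Classical

/-- Probability of an event under the uniform distribution on pairings (permutations
of the `l` half-edges). -/
noncomputable def probUnif (l : ℕ) (s : Finset (Equiv.Perm (Fin l))) : ℝ :=
  (s.card : ℝ) / (Nat.factorial l)

/-- Number of self-loops of the multigraph obtained from the pairing `σ`. -/
def selfLoops (n l : ℕ) (vIn vOut : Fin l → Fin n) (σ : Equiv.Perm (Fin l)) : ℕ :=
  (Finset.univ.filter (fun s => vIn s = vOut (σ s))).card

/-- Number of directed edges from `u` to `v` in the multigraph obtained from `σ`. -/
def edgeCount (n l : ℕ) (vIn vOut : Fin l → Fin n) (σ : Equiv.Perm (Fin l))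
    (u v : Fin n) : ℕ :=
  (Finset.univ.filter (fun s => vOut (σ s) = u ∧ vIn s = v)).card

/-- Number of excess multiple edges: `k ≥ 2` parallel edges from `u` to `v ≠ u`
contribute `k - 1`. -/
def multiEdges (n l : ℕ) (vIn vOut : Fin l → Fin n) (σ : Equiv.Perm (Fin l)) : ℕ :=
  ∑ u, ∑ v, if u ≠ v then edgeCount n l vIn vOut σ u v - 1 else 0

/-- `P(Poisson(λ) = k)`. -/
noncomputable def poissonProb (lam : ℝ) (k : ℕ) : ℝ :=
  Real.exp (-lam) * lam ^ k / (Nat.factorial k)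

abbrev PEdge (l : ℕ) := Fin l × Fin l

def SubM {l : ℕ} (α : Finset (PEdge l)) (σ : Equiv.Perm (Fin l)) : Prop := ∀ e ∈ α, σ e.1 = e.2

def IsPM {l : ℕ} (β : Finset (PEdge l)) : Prop :=
  ∀ e ∈ β, ∀ f ∈ β, e.1 = f.1 ∨ e.2 = f.2 → e = f

def NTouch {l : ℕ} (α β : Finset (PEdge l)) : Prop :=
  ∀ e ∈ α, ∀ f ∈ β, e.1 ≠ f.1 ∧ e.2 ≠ f.2

noncomputable def IndM {l : ℕ} (α : Finset (PEdge l)) (σ : Equiv.Perm (Fin l)) : ℝ :=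
  if SubM α σ then 1 else 0

noncomputable def swT {l : ℕ} (e : PEdge l) (σ : Equiv.Perm (Fin l)) : Equiv.Perm (Fin l) :=
  Equiv.swap (σ e.1) e.2 * σ

lemma swT_eq {l : ℕ} (s t r : Fin l) (σ : Equiv.Perm (Fin l)) (h : σ r = t) :
    swT (s, t) σ = σ * Equiv.swap s r := by
  subst h
  simp only [swT]
  rw [Equiv.mul_swap_eq_swap_mul]

lemma indM_swap {l : ℕ} (β : Finset (PEdge l)) (s t r : Fin l)
    (hs : ∀ f ∈ β, f.1 ≠ s) (ht : ∀ f ∈ β, f.2 ≠ t) (τ : Equiv.Perm (Fin l)) (h : τ s = t) :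
    IndM β (τ * Equiv.swap s r) = if r ∈ β.image Prod.fst then 0 else IndM β τ := by
  unfold IndM
  split_ifs with h1 h2 h3 h4 h5
  · exfalso
    obtain ⟨e, he, rfl⟩ := Finset.mem_image.1 h2
    have := h1 e he
    simp at this
    exact ht e he (by rw [← this, h])
  · rfl
  · exfalso
    apply h3
    intro e he
    have := h1 e he
    rw [Equiv.Perm.mul_apply, Equiv.swap_apply_of_ne_of_ne (hs e he)] at this
    · exact this
    · rintro rfl; exact h2 (Finset.mem_image_of_mem _ he)
  · rfl
  · exfalso
    apply h1
    intro e he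
    have := h5 e he
    rw [Equiv.Perm.mul_apply, Equiv.swap_apply_of_ne_of_ne (hs e he)]
    · exact this
    · rintro rfl; exact h4 (Finset.mem_image_of_mem _ he)
  · rfl

lemma indM_insert {l : ℕ} (β : Finset (PEdge l)) (s t : Fin l) (τ : Equiv.Perm (Fin l)) :
    IndM (insert (s, t) β) τ = if τ s = t then IndM β τ else 0 := by
  unfold IndM SubM
  simp only [Finset.mem_insert, forall_eq_or_imp]
  by_cases h : τ s = t <;> simp [h]

lemma step_sum {l : ℕ} (β : Finset (PEdge l)) (hβ : IsPM β) (s t : Fin l)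
    (hs : ∀ f ∈ β, f.1 ≠ s) (ht : ∀ f ∈ β, f.2 ≠ t) (F : Equiv.Perm (Fin l) → ℝ) :
    ∑ σ, IndM β σ * F (swT (s, t) σ)
      = ((l - β.card : ℕ) : ℝ) * ∑ τ, IndM (insert (s, t) β) τ * F τ := by
  have h1 : ∀ σ : Equiv.Perm (Fin l), IndM β σ * F (swT (s, t) σ)
      = ∑ r, if σ r = t then IndM β σ * F (σ * Equiv.swap s r) else 0 := by
    intro σ
    rw [Finset.sum_eq_single (σ.symm t)]
    · simp [swT_eq s t (σ.symm t) σ (by simp)]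
    · intro r _ hr
      rw [if_neg]
      rintro rfl
      simp at hr
    · simp
  simp_rw [h1]
  rw [Finset.sum_comm]
  have h2 : ∀ r : Fin l, (∑ σ : Equiv.Perm (Fin l),
      if σ r = t then IndM β σ * F (σ * Equiv.swap s r) else 0)
      = if r ∈ β.image Prod.fst then 0 else ∑ τ, IndM (insert (s, t) β) τ * F τ := by
    intro r
    rw [← Equiv.sum_comp (Equiv.mulRight (Equiv.swap s r))]
    have : ∀ τ : Equiv.Perm (Fin l), (if (Equiv.mulRight (Equiv.swap s r)) τ r = t then
        IndM β ((Equiv.mulRight (Equiv.swap s r)) τ) *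
          F ((Equiv.mulRight (Equiv.swap s r)) τ * Equiv.swap s r) else 0)
        = if r ∈ β.image Prod.fst then 0 else IndM (insert (s, t) β) τ * F τ := by
      intro τ
      rw [indM_insert]
      simp only [Equiv.coe_mulRight, Equiv.Perm.mul_apply, Equiv.swap_apply_right,
        mul_assoc, Equiv.swap_mul_self, mul_one]
      by_cases h : τ s = t
      · simp only [h, if_true]
        rw [indM_swap β s t r hs ht τ h]
        split_ifs <;> simp
      · simp [h]
    simp_rw [this]
    split_ifs <;> simp
  simp_rw [h2]
  simp_rw [← ite_not (p := _ ∈ _)]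
  rw [← Finset.sum_filter, Finset.sum_const, nsmul_eq_mul]
  congr 2
  rw [← Finset.card_image_of_injOn (f := Prod.fst) (s := β)
    (fun e he f hf h => hβ e he f hf (Or.inl h))]
  rw [Finset.filter_notMem_eq_sdiff, Finset.card_sdiff_of_subset (Finset.subset_univ _)]
  simp

lemma subM_swT {l : ℕ} (α : Finset (PEdge l)) (e : PEdge l) (σ : Equiv.Perm (Fin l))
    (h : ∀ f ∈ α, f.1 ≠ e.1 ∧ f.2 ≠ e.2) (hα : SubM α σ) : SubM α (swT e σ) := by
  intro f hf
  have := hα f hf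
  simp only [swT, Equiv.Perm.mul_apply, this]
  apply Equiv.swap_apply_of_ne_of_ne
  · rw [← this]
    exact fun h' => (h f hf).1 (σ.injective h')
  · exact (h f hf).2

lemma exists_T {l : ℕ} (β : Finset (PEdge l)) : IsPM β → ∃ T : Equiv.Perm (Fin l) → Equiv.Perm (Fin l),
    (∀ F : Equiv.Perm (Fin l) → ℝ,
      ∑ σ, F (T σ) = (l.descFactorial β.card : ℝ) * ∑ σ, IndM β σ * F σ) ∧
    (∀ σ, SubM β (T σ)) ∧
    (∀ α σ, NTouch α β → SubM α σ → SubM α (T σ)) := by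
  induction β using Finset.induction_on with
  | empty =>
    intro _
    refine ⟨id, ?_, ?_, ?_⟩
    · intro F; simp [IndM, SubM]
    · intro σ; simp [SubM]
    · intro α σ _ h; exact h
  | insert e β he ih =>
    intro h
    have hβ : IsPM β := fun a ha b hb => h a (Finset.mem_insert_of_mem ha) b (Finset.mem_insert_of_mem hb)
    have hne : ∀ f ∈ β, f.1 ≠ e.1 ∧ f.2 ≠ e.2 := by
      intro f hf
      constructor
      · intro h'
        have := h f (Finset.mem_insert_of_mem hf) e (Finset.mem_insert_self _ _) (Or.inl h')
        subst this; exact he hf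
      · intro h'
        have := h f (Finset.mem_insert_of_mem hf) e (Finset.mem_insert_self _ _) (Or.inr h')
        subst this; exact he hf
    obtain ⟨T, h1, h2, h3⟩ := ih hβ
    refine ⟨fun σ => swT e (T σ), ?_, ?_, ?_⟩
    · intro F
      rw [h1 (fun σ => F (swT e σ))]
      obtain ⟨s, t⟩ := e
      rw [step_sum β hβ s t (fun f hf => (hne f hf).1) (fun f hf => (hne f hf).2)]
      rw [Finset.card_insert_of_notMem he, Nat.descFactorial_succ]
      push_cast
      ring
    · intro σ f hf
      rcases Finset.mem_insert.1 hf with rfl | hf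
      · simp [swT]
      · exact subM_swT β e (T σ) hne (h2 σ) f hf
    · intro α σ hα hs
      apply subM_swT
      · intro f hf
        exact hα f hf e (Finset.mem_insert_self _ _)
      · apply h3 _ _ _ hs
        intro a ha b hb
        exact hα a ha b (Finset.mem_insert_of_mem hb)

lemma isPM_card_le {l : ℕ} {β : Finset (PEdge l)} (h : IsPM β) : β.card ≤ l := by
  rw [← Finset.card_image_of_injOn (f := Prod.fst) (s := β)
    (fun e he f hf h' => h e he f hf (Or.inl h'))]
  simpa using Finset.card_le_univ (β.image Prod.fst)

noncomputable def Ex {l : ℕ} (f : Equiv.Perm (Fin l) → ℝ) : ℝ := (∑ σ, f σ) / (l.factorial : ℝ)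

lemma Ex_sum {l : ℕ} {ι : Type*} (s : Finset ι) (f : ι → Equiv.Perm (Fin l) → ℝ) :
    Ex (fun σ => ∑ i ∈ s, f i σ) = ∑ i ∈ s, Ex (f i) := by
  unfold Ex
  rw [Finset.sum_comm, Finset.sum_div]

lemma Ex_mono {l : ℕ} {f g : Equiv.Perm (Fin l) → ℝ} (h : ∀ σ, f σ ≤ g σ) : Ex f ≤ Ex g := by
  unfold Ex
  gcongr with σ
  exact h σ

lemma Ex_sub {l : ℕ} (f g : Equiv.Perm (Fin l) → ℝ) : Ex (fun σ => f σ - g σ) = Ex f - Ex g := by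
  unfold Ex
  rw [Finset.sum_sub_distrib, sub_div]

lemma Ex_add {l : ℕ} (f g : Equiv.Perm (Fin l) → ℝ) : Ex (fun σ => f σ + g σ) = Ex f + Ex g := by
  unfold Ex
  rw [Finset.sum_add_distrib, add_div]

lemma Ex_mul_left {l : ℕ} (c : ℝ) (f : Equiv.Perm (Fin l) → ℝ) :
    Ex (fun σ => c * f σ) = c * Ex f := by
  unfold Ex
  rw [← Finset.mul_sum, mul_div_assoc]

lemma Ex_abs {l : ℕ} (f : Equiv.Perm (Fin l) → ℝ) : |Ex f| ≤ Ex (fun σ => |f σ|) := by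
  unfold Ex
  rw [abs_div, Nat.abs_cast]
  gcongr
  exact Finset.abs_sum_le_sum_abs _ _

lemma Ex_nonneg {l : ℕ} {f : Equiv.Perm (Fin l) → ℝ} (h : ∀ σ, 0 ≤ f σ) : 0 ≤ Ex f := by
  unfold Ex
  have := Finset.sum_nonneg (s := Finset.univ) (fun σ _ => h σ)
  positivity

lemma Ex_one {l : ℕ} : Ex (fun _ : Equiv.Perm (Fin l) => (1:ℝ)) = 1 := by
  unfold Ex
  have : (l.factorial : ℝ) ≠ 0 := by positivity
  simp [Fintype.card_perm, this]

lemma descF_pos {l : ℕ} {β : Finset (PEdge l)} (h : IsPM β) :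
    (0:ℝ) < l.descFactorial β.card := by
  have := isPM_card_le h
  exact_mod_cast Nat.descFactorial_pos.2 this

lemma Ex_IndM {l : ℕ} {β : Finset (PEdge l)} (h : IsPM β) :
    Ex (IndM β) = 1 / (l.descFactorial β.card : ℝ) := by
  obtain ⟨T, h1, -, -⟩ := exists_T β h
  have := h1 (fun _ => 1)
  simp [Fintype.card_perm] at this
  have h2 := descF_pos h
  unfold Ex
  rw [this]
  rw [div_eq_div_iff (by rw [← this]; positivity) h2.ne']
  ring

lemma Ex_T {l : ℕ} {β : Finset (PEdge l)} (h : IsPM β) :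
    ∃ T : Equiv.Perm (Fin l) → Equiv.Perm (Fin l),
    (∀ F : Equiv.Perm (Fin l) → ℝ,
      Ex (fun σ => IndM β σ * F σ) = Ex (IndM β) * Ex (fun σ => F (T σ))) ∧
    (∀ σ, SubM β (T σ)) ∧
    (∀ α σ, NTouch α β → SubM α σ → SubM α (T σ)) := by
  obtain ⟨T, h1, h2, h3⟩ := exists_T β h
  refine ⟨T, ?_, h2, h3⟩
  intro F
  rw [Ex_IndM h]
  have := descF_pos h
  unfold Ex
  rw [h1]
  field_simp

noncomputable def XC {l : ℕ} (A : Finset (Finset (PEdge l))) (σ : Equiv.Perm (Fin l)) : ℕ :=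
  (A.filter (fun α => SubM α σ)).card

noncomputable def prAB {l : ℕ} (A B : Finset (Finset (PEdge l))) (a b : ℕ) : ℝ :=
  Ex (fun σ : Equiv.Perm (Fin l) => if XC A σ = a ∧ XC B σ = b then (1:ℝ) else 0)

noncomputable def errM {l : ℕ} (β α : Finset (PEdge l)) : ℝ :=
  if α = β then Ex (IndM β) * Ex (IndM β) else
  if NTouch α β then Ex (fun σ => IndM β σ * IndM α σ) - Ex (IndM β) * Ex (IndM α) else
  Ex (fun σ => IndM β σ * IndM α σ) + Ex (IndM β) * Ex (IndM α)

lemma IndM_nonneg {l : ℕ} (α : Finset (PEdge l)) (σ : Equiv.Perm (Fin l)) : 0 ≤ IndM α σ := by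
  unfold IndM; split_ifs <;> norm_num

lemma XC_eq_sum {l : ℕ} (A : Finset (Finset (PEdge l))) (σ : Equiv.Perm (Fin l)) :
    (XC A σ : ℝ) = ∑ α ∈ A, IndM α σ := by
  unfold XC IndM
  rw [Finset.sum_boole]

lemma stein {l : ℕ} (A B : Finset (Finset (PEdge l))) (hA : ∀ α ∈ A, IsPM α)
    (hAB : Disjoint A B) (a b : ℕ) :
    |((a + 1 : ℕ) : ℝ) * prAB A B (a + 1) b - (∑ β ∈ A, Ex (IndM β)) * prAB A B a b|
      ≤ ∑ β ∈ A, ∑ α ∈ A, errM β α + ∑ β ∈ A, ∑ α ∈ B, errM β α := by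
  have e1 : ((a + 1 : ℕ) : ℝ) * prAB A B (a + 1) b
      = ∑ β ∈ A, Ex (fun σ => IndM β σ * if XC A σ = a + 1 ∧ XC B σ = b then (1:ℝ) else 0) := by
    unfold prAB
    rw [← Ex_mul_left, ← Ex_sum]
    congr 1
    funext σ
    rw [← Finset.sum_mul, ← XC_eq_sum]
    split_ifs with h
    · rw [h.1]
    · simp
  rw [e1, Finset.sum_mul, ← Finset.sum_sub_distrib, ← Finset.sum_add_distrib]
  refine (Finset.abs_sum_le_sum_abs _ _).trans (Finset.sum_le_sum fun β hβ => ?_)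
  rw [← Finset.sum_union hAB]
  obtain ⟨T, h1, h2, h3⟩ := Ex_T (hA β hβ)
  rw [h1]
  unfold prAB
  rw [← mul_sub, ← Ex_sub, abs_mul]
  have hp : 0 ≤ Ex (IndM β) := Ex_nonneg (IndM_nonneg β)
  rw [abs_of_nonneg hp]
  have key : ∀ σ, |(if XC A (T σ) = a + 1 ∧ XC B (T σ) = b then (1:ℝ) else 0) -
      (if XC A σ = a ∧ XC B σ = b then (1:ℝ) else 0)| ≤
      ∑ α ∈ A ∪ B, if α = β then IndM β σ else |IndM α (T σ) - IndM α σ| := by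
    intro σ
    have hnn : ∀ α ∈ A ∪ B, 0 ≤ (if α = β then IndM β σ else |IndM α (T σ) - IndM α σ|) := by
      intro α _
      split_ifs
      · exact IndM_nonneg _ _
      · exact abs_nonneg _
    by_cases hbad : ∃ α ∈ A ∪ B, 1 ≤ (if α = β then IndM β σ else |IndM α (T σ) - IndM α σ|)
    · obtain ⟨α, hα, h⟩ := hbad
      refine le_trans ?_ (h.trans (Finset.single_le_sum hnn hα))
      split_ifs <;> simp
    · push Not at hbad
      refine le_trans (le_of_eq ?_) (Finset.sum_nonneg hnn)
      have hβσ : ¬ SubM β σ := by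
        have := hbad β (Finset.mem_union_left _ hβ)
        simp only [if_true] at this
        intro h
        simp [IndM, h] at this
      have hiff : ∀ α ∈ A ∪ B, α ≠ β → (SubM α (T σ) ↔ SubM α σ) := by
        intro α hα hne
        have := hbad α hα
        rw [if_neg hne] at this
        unfold IndM at this
        by_cases c1 : SubM α (T σ) <;> by_cases c2 : SubM α σ <;> simp [c1, c2] at this ⊢
      have hXA : XC A (T σ) = XC A σ + 1 := by
        unfold XC
        have : A.filter (fun α => SubM α (T σ)) = insert β (A.filter (fun α => SubM α σ)) := by
          ext α
          simp only [Finset.mem_filter, Finset.mem_insert]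
          by_cases hαβ : α = β
          · subst hαβ; simp [hβ, h2]
          · simp only [hαβ, false_or]
            constructor
            · rintro ⟨ha, hb⟩
              exact ⟨ha, (hiff α (Finset.mem_union_left _ ha) hαβ).1 hb⟩
            · rintro ⟨ha, hb⟩
              exact ⟨ha, (hiff α (Finset.mem_union_left _ ha) hαβ).2 hb⟩
        rw [this, Finset.card_insert_of_notMem]
        simp [hβσ]
      have hXB : XC B (T σ) = XC B σ := by
        unfold XC
        congr 1
        apply Finset.filter_congr
        intro α hα
        apply hiff α (Finset.mem_union_right _ hα)
        rintro rfl
        exact (Finset.disjoint_left.1 hAB hβ) hα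
      rw [hXA, hXB]
      simp
  refine le_trans (mul_le_mul_of_nonneg_left ((Ex_abs _).trans (Ex_mono key)) hp) ?_
  rw [Ex_sum, Finset.mul_sum]
  refine Finset.sum_le_sum fun α _ => ?_
  unfold errM
  split_ifs with c1 c2
  · exact le_rfl
  · rw [h1, ← mul_sub, ← Ex_sub]
    refine mul_le_mul_of_nonneg_left (Ex_mono fun σ => ?_) hp
    apply le_of_eq
    apply abs_of_nonneg
    unfold IndM
    have := h3 α σ c2
    by_cases c : SubM α σ
    · simp [c, this c]
    · simp [c]; split_ifs <;> norm_num
  · rw [h1, ← mul_add, ← Ex_add]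
    refine mul_le_mul_of_nonneg_left (Ex_mono fun σ => ?_) hp
    refine (abs_sub _ _).trans ?_
    rw [abs_of_nonneg (IndM_nonneg _ _), abs_of_nonneg (IndM_nonneg _ _)]

noncomputable def zM {l : ℕ} (β α : Finset (PEdge l)) : ℝ :=
  if α ≠ β ∧ ∃ e ∈ α, e ∈ β then Ex (fun σ => IndM β σ * IndM α σ) else 0

lemma indM_mul {l : ℕ} (α β : Finset (PEdge l)) (σ : Equiv.Perm (Fin l)) :
    IndM β σ * IndM α σ = IndM (β ∪ α) σ := by
  have : SubM (β ∪ α) σ ↔ SubM β σ ∧ SubM α σ := by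
    unfold SubM
    constructor
    · intro h
      exact ⟨fun e he => h e (Finset.mem_union_left _ he), fun e he => h e (Finset.mem_union_right _ he)⟩
    · rintro ⟨h1, h2⟩ e he
      rcases Finset.mem_union.1 he with he | he
      · exact h1 e he
      · exact h2 e he
  unfold IndM
  by_cases c1 : SubM β σ <;> by_cases c2 : SubM α σ <;> simp [this, c1, c2]

noncomputable def delt (l j k : ℕ) : ℝ :=
  1 / (l.descFactorial (j + k) : ℝ) - 1 / (l.descFactorial j * l.descFactorial k : ℝ)

lemma delt_nonneg (l j k : ℕ) (h : j + k ≤ l) : 0 ≤ delt l j k := by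
  unfold delt
  have h1 : (0:ℝ) < l.descFactorial (j + k) := by exact_mod_cast Nat.descFactorial_pos.2 h
  have h2 : (l.descFactorial (j + k) : ℝ) ≤ l.descFactorial j * l.descFactorial k := by
    have := Nat.descFactorial_mul_descFactorial (n := l) (k := j) (m := j + k) (by omega)
    rw [← this]
    simp only [Nat.add_sub_cancel_left]
    have h3 : (l - j).descFactorial k ≤ l.descFactorial k :=
      Nat.descFactorial_le _ (by omega)
    push_cast
    rw [mul_comm]
    have : ((l - j).descFactorial k : ℝ) ≤ l.descFactorial k := by exact_mod_cast h3
    gcongr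
  have := one_div_le_one_div_of_le h1 h2
  linarith

lemma errM_le {l j k : ℕ} (hl : j + k ≤ l) (hj : 1 ≤ j) (β α : Finset (PEdge l)) (hβ : IsPM β) (hα : IsPM α)
    (cβ : β.card = j) (cα : α.card = k) :
    errM β α ≤ delt l j k
      + (if NTouch α β then 0 else 1) * (1 / (l.descFactorial j * l.descFactorial k : ℝ))
      + zM β α := by
  have hd := delt_nonneg l j k hl
  have hz : 0 ≤ zM β α := by
    unfold zM
    split_ifs
    · exact Ex_nonneg fun σ => mul_nonneg (IndM_nonneg _ _) (IndM_nonneg _ _)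
    · exact le_rfl
  have hpp : Ex (IndM β) * Ex (IndM α) = 1 / (l.descFactorial j * l.descFactorial k : ℝ) := by
    rw [Ex_IndM hβ, Ex_IndM hα, cβ, cα]
    field_simp
  unfold errM
  split_ifs with c1 c4 c5
  · exfalso
    subst c1
    obtain ⟨e, he⟩ := Finset.card_pos.1 (by omega : 0 < α.card)
    exact (c4 e he e he).1 rfl
  · subst c1
    rw [hpp]; linarith
  · have hdisj : Disjoint β α := by
      rw [Finset.disjoint_left]
      intro e he he'
      exact (c5 e he' e he).1 rfl
    have hPM : IsPM (β ∪ α) := by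
      intro e he f hf h
      rcases Finset.mem_union.1 he with he | he <;> rcases Finset.mem_union.1 hf with hf | hf
      · exact hβ e he f hf h
      · have := c5 f hf e he
        rcases h with h | h
        · exact absurd h.symm this.1
        · exact absurd h.symm this.2
      · have := c5 e he f hf
        rcases h with h | h
        · exact absurd h this.1
        · exact absurd h this.2
      · exact hα e he f hf h
    simp_rw [indM_mul]
    rw [hpp]
    have : Ex (fun σ => IndM (β ∪ α) σ) = 1 / (l.descFactorial (j + k) : ℝ) := by
      rw [← cα, ← cβ, ← Finset.card_union_of_disjoint hdisj]
      exact Ex_IndM hPM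
    rw [this]
    unfold delt at *
    linarith
  · rw [hpp]
    have : Ex (fun σ => IndM β σ * IndM α σ) ≤ zM β α := by
      unfold zM
      by_cases c : ∃ e ∈ α, e ∈ β
      · rw [if_pos ⟨c1, c⟩]
      · rw [if_neg (fun h => c h.2)]
        unfold Ex
        rw [Finset.sum_eq_zero, zero_div]
        intro σ _
        unfold IndM
        by_cases c1 : SubM β σ <;> by_cases c2 : SubM α σ <;> simp [c1, c2]
        apply c5
        intro e he f hf
        have he' := c2 e he
        have hf' := c1 f hf
        constructor
        · intro h
          apply c
          refine ⟨e, he, ?_⟩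
          have : e = f := by
            ext1
            · exact h
            · rw [← he', ← hf', h]
          rwa [this]
        · intro h
          apply c
          refine ⟨e, he, ?_⟩
          have : e = f := by
            ext1
            · apply σ.injective
              rw [he', hf', h]
            · exact h
          rwa [this]
    linarith

lemma touch_card {l : ℕ} (B : Finset (Finset (PEdge l))) (D : ℕ)
    (h1 : ∀ s : Fin l, (B.filter (fun α => ∃ f ∈ α, f.1 = s)).card ≤ D)
    (h2 : ∀ t : Fin l, (B.filter (fun α => ∃ f ∈ α, f.2 = t)).card ≤ D)
    (β : Finset (PEdge l)) :
    (B.filter (fun α => ¬ NTouch α β)).card ≤ β.card * (2 * D) := by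
  have : B.filter (fun α => ¬ NTouch α β) ⊆ β.biUnion (fun e =>
      B.filter (fun α => ∃ f ∈ α, f.1 = e.1) ∪ B.filter (fun α => ∃ f ∈ α, f.2 = e.2)) := by
    intro α hα
    rw [Finset.mem_filter] at hα
    obtain ⟨hB, hn⟩ := hα
    unfold NTouch at hn
    push Not at hn
    obtain ⟨e, he, f, hf, h⟩ := hn
    rw [Finset.mem_biUnion]
    refine ⟨f, hf, ?_⟩
    rw [Finset.mem_union, Finset.mem_filter, Finset.mem_filter]
    by_cases c : e.1 = f.1
    · exact Or.inl ⟨hB, e, he, c⟩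
    · exact Or.inr ⟨hB, e, he, h c⟩
  refine (Finset.card_le_card this).trans (Finset.card_biUnion_le_card_mul _ _ _ ?_)
  intro e _
  refine (Finset.card_union_le _ _).trans ?_
  have := h1 e.1
  have := h2 e.2
  omega

lemma errSum_le {l j k : ℕ} (hl : j + k ≤ l) (hj : 1 ≤ j) (A B : Finset (Finset (PEdge l)))
    (hA : ∀ α ∈ A, IsPM α ∧ α.card = j) (hB : ∀ α ∈ B, IsPM α ∧ α.card = k) (D : ℕ)
    (h1 : ∀ s : Fin l, (B.filter (fun α => ∃ f ∈ α, f.1 = s)).card ≤ D)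
    (h2 : ∀ t : Fin l, (B.filter (fun α => ∃ f ∈ α, f.2 = t)).card ≤ D) :
    ∑ β ∈ A, ∑ α ∈ B, errM β α ≤ (A.card : ℝ) * B.card * delt l j k
      + 2 * j * D * A.card / (l.descFactorial j * l.descFactorial k : ℝ)
      + ∑ β ∈ A, ∑ α ∈ B, zM β α := by
  have : ∀ β ∈ A, ∑ α ∈ B, errM β α ≤ B.card * delt l j k
      + 2 * j * D / (l.descFactorial j * l.descFactorial k : ℝ) + ∑ α ∈ B, zM β α := by
    intro β hβ
    refine (Finset.sum_le_sum fun α hα => errM_le hl hj β α (hA β hβ).1 (hB α hα).1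
      (hA β hβ).2 (hB α hα).2).trans ?_
    rw [Finset.sum_add_distrib, Finset.sum_add_distrib, ← Finset.sum_mul]
    simp only [Finset.sum_const, nsmul_eq_mul]
    gcongr
    have h3 := touch_card B D h1 h2 β
    rw [(hA β hβ).2] at h3
    have h4 : (∑ α ∈ B, if NTouch α β then (0:ℝ) else 1)
        = ((B.filter (fun α => ¬ NTouch α β)).card : ℝ) := by
      simp_rw [← ite_not (p := NTouch _ _)]
      rw [Finset.sum_boole]
    rw [h4, mul_one_div]
    gcongr
    have : ((B.filter (fun α => ¬ NTouch α β)).card : ℝ) ≤ (j * (2 * D) : ℕ) := by exact_mod_cast h3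
    push_cast at this
    linarith
  refine (Finset.sum_le_sum this).trans (le_of_eq ?_)
  rw [Finset.sum_add_distrib, Finset.sum_add_distrib]
  simp only [Finset.sum_const, nsmul_eq_mul]
  ring

noncomputable def famA {n l : ℕ} (vIn vOut : Fin l → Fin n) : Finset (Finset (PEdge l)) :=
  (Finset.univ.filter (fun e : PEdge l => vIn e.1 = vOut e.2)).image (fun e => {e})

def QP {n l : ℕ} (vIn vOut : Fin l → Fin n) (q : PEdge l × PEdge l) : Prop :=
  q.1.1 ≠ q.2.1 ∧ q.1.2 ≠ q.2.2 ∧ vIn q.1.1 = vIn q.2.1 ∧ vOut q.1.2 = vOut q.2.2 ∧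
    vIn q.1.1 ≠ vOut q.1.2

noncomputable def famB {n l : ℕ} (vIn vOut : Fin l → Fin n) : Finset (Finset (PEdge l)) :=
  (Finset.univ.filter (QP vIn vOut)).image (fun q => {q.1, q.2})

lemma mem_famA {n l : ℕ} {vIn vOut : Fin l → Fin n} {α : Finset (PEdge l)} :
    α ∈ famA vIn vOut ↔ ∃ e : PEdge l, vIn e.1 = vOut e.2 ∧ {e} = α := by
  simp [famA]

lemma mem_famB {n l : ℕ} {vIn vOut : Fin l → Fin n} {α : Finset (PEdge l)} :
    α ∈ famB vIn vOut ↔ ∃ q : PEdge l × PEdge l, QP vIn vOut q ∧ {q.1, q.2} = α := by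
  simp only [famB, Finset.mem_image, Finset.mem_filter, Finset.mem_univ, true_and]

lemma QP_symm {n l : ℕ} {vIn vOut : Fin l → Fin n} {q : PEdge l × PEdge l} (h : QP vIn vOut q) :
    QP vIn vOut q.swap := by
  obtain ⟨h1, h2, h3, h4, h5⟩ := h
  refine ⟨h1.symm, h2.symm, h3.symm, h4.symm, ?_⟩
  simp only [Prod.fst_swap]
  rw [← h3, ← h4]; exact h5

/-- if `e ∈ α ∈ famB` we can choose the representation with `e` first -/
lemma famB_rep {n l : ℕ} {vIn vOut : Fin l → Fin n} {α : Finset (PEdge l)}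
    (h : α ∈ famB vIn vOut) {e : PEdge l} (he : e ∈ α) :
    ∃ f, QP vIn vOut (e, f) ∧ α = {e, f} := by
  obtain ⟨q, hq, rfl⟩ := mem_famB.1 h
  simp only [Finset.mem_insert, Finset.mem_singleton] at he
  rcases he with rfl | rfl
  · exact ⟨q.2, hq, rfl⟩
  · exact ⟨q.1, QP_symm hq, Finset.pair_comm _ _⟩

lemma famA_spec {n l : ℕ} {vIn vOut : Fin l → Fin n} :
    ∀ α ∈ famA vIn vOut, IsPM α ∧ α.card = 1 := by
  intro α hα
  obtain ⟨e, -, rfl⟩ := mem_famA.1 hα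
  refine ⟨?_, by simp⟩
  intro a ha b hb _
  simp at ha hb
  rw [ha, hb]

lemma famB_spec {n l : ℕ} {vIn vOut : Fin l → Fin n} :
    ∀ α ∈ famB vIn vOut, IsPM α ∧ α.card = 2 := by
  intro α hα
  obtain ⟨⟨e, f⟩, ⟨h1, h2, -, -⟩, rfl⟩ := mem_famB.1 hα
  simp only at h1 h2
  refine ⟨?_, ?_⟩
  · intro a ha b hb h
    simp only [Finset.mem_insert, Finset.mem_singleton] at ha hb
    rcases ha with rfl | rfl <;> rcases hb with rfl | rfl
    · rfl
    · rcases h with h | h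
      · exact absurd h h1
      · exact absurd h h2
    · rcases h with h | h
      · exact absurd h.symm h1
      · exact absurd h.symm h2
    · rfl
  · rw [Finset.card_pair]
    intro h
    exact h1 (congrArg Prod.fst h)

lemma famAB_disj {n l : ℕ} {vIn vOut : Fin l → Fin n} :
    Disjoint (famA vIn vOut) (famB vIn vOut) := by
  rw [Finset.disjoint_left]
  intro α h1 h2
  have := (famA_spec α h1).2
  have := (famB_spec α h2).2
  omega

lemma zM_AA {n l : ℕ} {vIn vOut : Fin l → Fin n} :
    ∑ β ∈ famA vIn vOut, ∑ α ∈ famA vIn vOut, zM β α = 0 := by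
  refine Finset.sum_eq_zero fun β hβ => Finset.sum_eq_zero fun α hα => ?_
  unfold zM
  rw [if_neg]
  rintro ⟨h1, e, h2, h3⟩
  obtain ⟨f, -, rfl⟩ := mem_famA.1 hβ
  obtain ⟨g, -, rfl⟩ := mem_famA.1 hα
  simp at h2 h3
  subst h2; subst h3
  exact h1 rfl

lemma AB_noshare {n l : ℕ} {vIn vOut : Fin l → Fin n} {α β : Finset (PEdge l)}
    (hβ : β ∈ famA vIn vOut) (hα : α ∈ famB vIn vOut) {e : PEdge l} (h1 : e ∈ α) (h2 : e ∈ β) :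
    False := by
  obtain ⟨f, hf, rfl⟩ := mem_famA.1 hβ
  simp at h2
  subst h2
  obtain ⟨g, hg, rfl⟩ := famB_rep hα h1
  exact hg.2.2.2.2 hf

lemma zM_AB {n l : ℕ} {vIn vOut : Fin l → Fin n} :
    ∑ β ∈ famA vIn vOut, ∑ α ∈ famB vIn vOut, zM β α = 0 := by
  refine Finset.sum_eq_zero fun β hβ => Finset.sum_eq_zero fun α hα => ?_
  unfold zM
  rw [if_neg]
  rintro ⟨h1, e, h2, h3⟩
  exact AB_noshare hβ hα h2 h3

lemma zM_BA {n l : ℕ} {vIn vOut : Fin l → Fin n} :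
    ∑ β ∈ famB vIn vOut, ∑ α ∈ famA vIn vOut, zM β α = 0 := by
  refine Finset.sum_eq_zero fun β hβ => Finset.sum_eq_zero fun α hα => ?_
  unfold zM
  rw [if_neg]
  rintro ⟨h1, e, h2, h3⟩
  exact AB_noshare hα hβ h3 h2

lemma XC_famA {n l : ℕ} (vIn vOut : Fin l → Fin n) (σ : Equiv.Perm (Fin l)) :
    XC (famA vIn vOut) σ = selfLoops n l vIn vOut σ := by
  unfold XC selfLoops
  rw [← Finset.card_image_of_injective (f := fun s => ({(s, σ s)} : Finset (PEdge l)))]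
  · congr 1
    ext α
    simp only [Finset.mem_filter, Finset.mem_image, mem_famA, Finset.mem_univ, true_and]
    constructor
    · rintro ⟨⟨e, he, rfl⟩, h⟩
      have := h e (by simp)
      refine ⟨e.1, by rw [this]; exact he, ?_⟩
      rw [this]
    · rintro ⟨s, hs, rfl⟩
      refine ⟨⟨(s, σ s), hs, rfl⟩, ?_⟩
      intro e he
      simp at he
      subst he; rfl
  · intro s t h
    simp at h
    exact h

def EUV {n l : ℕ} (vIn vOut : Fin l → Fin n) (σ : Equiv.Perm (Fin l)) (u v : Fin n) :
    Finset (Fin l) := Finset.univ.filter (fun s => vOut (σ s) = u ∧ vIn s = v)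

lemma XC_famB {n l : ℕ} (vIn vOut : Fin l → Fin n) (σ : Equiv.Perm (Fin l)) :
    XC (famB vIn vOut) σ = ∑ u, ∑ v, if u ≠ v then (EUV vIn vOut σ u v).card.choose 2 else 0 := by
  have h1 : (famB vIn vOut).filter (fun α => SubM α σ)
      = ((Finset.univ.filter (fun p : Fin n × Fin n => p.1 ≠ p.2)).biUnion
          (fun p => (EUV vIn vOut σ p.1 p.2).powersetCard 2)).image
          (fun P => P.image (fun s => ((s, σ s) : PEdge l))) := by
    ext α
    simp only [Finset.mem_filter, Finset.mem_image, mem_famB, Finset.mem_univ, true_and,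
      Finset.mem_biUnion]
    constructor
    · rintro ⟨⟨⟨⟨s1, t1⟩, ⟨s2, t2⟩⟩, ⟨h1, h2, h3, h4, h5⟩, rfl⟩, h⟩
      have e1 : σ s1 = t1 := h (s1, t1) (by simp)
      have e2 : σ s2 = t2 := h (s2, t2) (by simp)
      simp only at h1 h2 h3 h4 h5
      refine ⟨{s1, s2}, ⟨(vOut t1, vIn s1), h5.symm, ?_⟩, ?_⟩
      · rw [Finset.mem_powersetCard, Finset.card_pair h1]
        refine ⟨?_, rfl⟩
        intro x hx
        simp only [Finset.mem_insert, Finset.mem_singleton] at hx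
        simp only [EUV, Finset.mem_filter, Finset.mem_univ, true_and]
        rcases hx with rfl | rfl
        · rw [e1]; simp
        · rw [e2]; exact ⟨h4.symm, h3.symm⟩
      · simp [Finset.image_insert, e1, e2]
    · rintro ⟨P, ⟨⟨u, v⟩, huv, hP⟩, rfl⟩
      rw [Finset.mem_powersetCard] at hP
      obtain ⟨x, y, hxy, rfl⟩ := Finset.card_eq_two.1 hP.2
      have hx := hP.1 (show x ∈ _ by simp)
      have hy := hP.1 (show y ∈ _ by simp)
      simp only [EUV, Finset.mem_filter, Finset.mem_univ, true_and] at hx hy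
      refine ⟨⟨((x, σ x), (y, σ y)), ⟨hxy, fun h => hxy (σ.injective h), ?_, ?_, ?_⟩, ?_⟩, ?_⟩
      · simp [hx, hy]
      · simp [hx, hy]
      · simpa [hx, hy] using fun h => huv h.symm
      · simp [Finset.image_insert]
      · intro e he
        simp only [Finset.mem_image] at he
        obtain ⟨s, -, rfl⟩ := he
        rfl
  unfold XC
  rw [h1, Finset.card_image_of_injective, Finset.card_biUnion]
  · simp_rw [Finset.card_powersetCard]
    rw [Finset.sum_filter, Fintype.sum_prod_type]
  · intro p _ p' _ hne
    rw [Function.onFun, Finset.disjoint_left]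
    intro P hP hP'
    rw [Finset.mem_powersetCard] at hP hP'
    obtain ⟨x, hx⟩ := Finset.card_pos.1 (by omega : 0 < P.card)
    have h1 := hP.1 hx
    have h2 := hP'.1 hx
    simp only [EUV, Finset.mem_filter, Finset.mem_univ, true_and] at h1 h2
    apply hne
    ext1
    · rw [← h1.1, ← h2.1]
    · rw [← h1.2, ← h2.2]
  · apply Finset.image_injective
    intro s t h
    simp at h
    exact h

lemma multi_eq {n l : ℕ} (vIn vOut : Fin l → Fin n) (σ : Equiv.Perm (Fin l))
    (h : ∀ α ∈ famB vIn vOut, ∀ β ∈ famB vIn vOut, SubM α σ → SubM β σ → (∃ e ∈ α, e ∈ β) → α = β) :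
    multiEdges n l vIn vOut σ = XC (famB vIn vOut) σ := by
  rw [XC_famB]
  unfold multiEdges
  refine Finset.sum_congr rfl fun u _ => Finset.sum_congr rfl fun v _ => ?_
  by_cases huv : u = v
  · simp [huv]
  rw [if_pos huv, if_pos huv]
  have e1 : edgeCount n l vIn vOut σ u v = (EUV vIn vOut σ u v).card := rfl
  rw [e1]
  have h2 : (EUV vIn vOut σ u v).card ≤ 2 := by
    by_contra! hc
    obtain ⟨x, y, z, hx, hy, hz, hxy, hxz, hyz⟩ := Finset.two_lt_card_iff.1 hc
    simp only [EUV, Finset.mem_filter, Finset.mem_univ, true_and] at hx hy hz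
    have := h {(x, σ x), (y, σ y)} (mem_famB.2 ⟨((x, σ x), (y, σ y)),
        ⟨hxy, fun h => hxy (σ.injective h), by simp [hx, hy], by simp [hx, hy],
          by simpa [hx, hy] using fun h => huv h.symm⟩, rfl⟩)
      {(x, σ x), (z, σ z)} (mem_famB.2 ⟨((x, σ x), (z, σ z)),
        ⟨hxz, fun h => hxz (σ.injective h), by simp [hx, hz], by simp [hx, hz],
          by simpa [hx, hz] using fun h => huv h.symm⟩, rfl⟩)
      (by intro e he; simp at he; rcases he with rfl | rfl <;> rfl)
      (by intro e he; simp at he; rcases he with rfl | rfl <;> rfl)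
      ⟨(x, σ x), by simp, by simp⟩
    have hy' : (y, σ y) ∈ ({(x, σ x), (z, σ z)} : Finset (PEdge l)) := by rw [← this]; simp
    simp at hy'
    rcases hy' with h' | h'
    · exact hxy h'.symm
    · exact hyz h'
  interval_cases (EUV vIn vOut σ u v).card <;> simp

lemma probUnif_eq {l : ℕ} (p : Equiv.Perm (Fin l) → Prop) [DecidablePred p] :
    probUnif l (Finset.univ.filter p) = Ex (fun σ => if p σ then (1:ℝ) else 0) := by
  unfold probUnif Ex
  rw [Finset.sum_boole]

lemma prob_diff {n l : ℕ} (vIn vOut : Fin l → Fin n) (a b : ℕ) :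
    |probUnif l (Finset.univ.filter (fun σ : Equiv.Perm (Fin l) =>
              selfLoops n l vIn vOut σ = a ∧ multiEdges n l vIn vOut σ = b))
      - prAB (famA vIn vOut) (famB vIn vOut) a b|
     ≤ ∑ β ∈ famB vIn vOut, ∑ α ∈ famB vIn vOut, zM β α := by
  rw [probUnif_eq]
  unfold prAB zM
  rw [← Ex_sub]
  refine (Ex_abs _).trans ?_
  have e0 : ∑ β ∈ famB vIn vOut, ∑ α ∈ famB vIn vOut,
     (if α ≠ β ∧ ∃ e ∈ α, e ∈ β then Ex (fun σ => IndM β σ * IndM α σ) else 0)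
     = Ex (fun σ => ∑ β ∈ famB vIn vOut, ∑ α ∈ famB vIn vOut,
       if α ≠ β ∧ ∃ e ∈ α, e ∈ β then IndM β σ * IndM α σ else 0) := by
    rw [Ex_sum]
    refine Finset.sum_congr rfl fun β _ => ?_
    rw [Ex_sum]
    refine Finset.sum_congr rfl fun α _ => ?_
    split_ifs
    · rfl
    · simp [Ex]
  rw [e0]
  refine Ex_mono fun σ => ?_
  have hnn : ∀ β ∈ famB vIn vOut, ∀ α ∈ famB vIn vOut,
      0 ≤ if α ≠ β ∧ ∃ e ∈ α, e ∈ β then IndM β σ * IndM α σ else 0 := by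
    intro β _ α _
    split_ifs
    · exact mul_nonneg (IndM_nonneg _ _) (IndM_nonneg _ _)
    · exact le_rfl
  by_cases h : ∀ α ∈ famB vIn vOut, ∀ β ∈ famB vIn vOut,
      SubM α σ → SubM β σ → (∃ e ∈ α, e ∈ β) → α = β
  · rw [XC_famA, multi_eq vIn vOut σ h]
    simp only [sub_self, abs_zero]
    exact Finset.sum_nonneg fun β hβ => Finset.sum_nonneg fun α hα => hnn β hβ α hα
  · push Not at h
    obtain ⟨α, hα, β, hβ, h1, h2, h3, h4⟩ := h
    have : (1:ℝ) ≤ if α ≠ β ∧ ∃ e ∈ α, e ∈ β then IndM β σ * IndM α σ else 0 := by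
      rw [if_pos ⟨h4, h3⟩]
      simp [IndM, h1, h2]
    refine le_trans ?_ (this.trans ((Finset.single_le_sum (hnn β hβ) hα).trans
      (Finset.single_le_sum (f := fun β => ∑ α ∈ famB vIn vOut,
       if α ≠ β ∧ ∃ e ∈ α, e ∈ β then IndM β σ * IndM α σ else 0)
       (fun β hβ => Finset.sum_nonneg fun α hα => hnn β hβ α hα) hβ)))
    split_ifs <;> simp

lemma count_fg {n l : ℕ} (f g : Fin l → Fin n) (cf cg : Fin n → ℕ)
    (hf : ∀ v, (Finset.univ.filter (fun s => f s = v)).card = cf v)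
    (hg : ∀ v, (Finset.univ.filter (fun s => g s = v)).card = cg v) :
    (Finset.univ.filter (fun p : Fin l × Fin l => f p.1 = g p.2)).card = ∑ v, cf v * cg v := by
  rw [Finset.card_filter, Fintype.sum_prod_type]
  have h1 : ∀ x : Fin l, (∑ y, if f x = g y then 1 else 0) = cg (f x) := by
    intro x
    rw [← hg, Finset.card_filter]
    exact Finset.sum_congr rfl fun y _ => by simp [eq_comm]
  simp only
  simp_rw [h1]
  rw [← Finset.sum_fiberwise_of_maps_to (g := f) (t := Finset.univ) (fun _ _ => Finset.mem_univ _)]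
  refine Finset.sum_congr rfl fun v _ => ?_
  rw [← hf v, ← smul_eq_mul, ← Finset.sum_const]
  refine Finset.sum_congr rfl fun x hx => ?_
  rw [(Finset.mem_filter.1 hx).2]

lemma count_ne {n l : ℕ} (f : Fin l → Fin n) (cf : Fin n → ℕ)
    (hf : ∀ v, (Finset.univ.filter (fun s => f s = v)).card = cf v) :
    (Finset.univ.filter (fun p : Fin l × Fin l => p.1 ≠ p.2 ∧ f p.1 = f p.2)).card + l
      = ∑ v, cf v ^ 2 := by
  have h := count_fg f f cf cf hf hf
  simp_rw [pow_two]
  rw [← h]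
  rw [← Finset.card_filter_add_card_filter_not (s := Finset.univ.filter (fun p : Fin l × Fin l => f p.1 = f p.2))
    (fun p => p.1 ≠ p.2)]
  congr 1
  · rw [Finset.filter_filter]
    congr 1
    ext p; simp [and_comm]
  · rw [Finset.filter_filter]
    have : (Finset.univ.filter (fun p : Fin l × Fin l => f p.1 = f p.2 ∧ ¬ p.1 ≠ p.2))
        = Finset.univ.image (fun s : Fin l => (s, s)) := by
      ext ⟨x, y⟩
      simp
      rintro rfl; rfl
    rw [this, Finset.card_image_of_injective]
    · simp
    · intro a b h; simp at h; exact h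

section deg
variable {n l : ℕ} {vIn vOut : Fin l → Fin n} {m d : Fin n → ℕ}

lemma card_famA
    (hvIn : ∀ v : Fin n, (Finset.univ.filter (fun s => vIn s = v)).card = m v)
    (hvOut : ∀ v : Fin n, (Finset.univ.filter (fun s => vOut s = v)).card = d v) :
    (famA vIn vOut).card = ∑ v, m v * d v := by
  unfold famA
  rw [Finset.card_image_of_injective _ Finset.singleton_injective]
  exact count_fg vIn vOut m d hvIn hvOut

lemma touchA1
    (hvOut : ∀ v : Fin n, (Finset.univ.filter (fun s => vOut s = v)).card = d v)
    (D : ℕ) (hd : ∀ v, d v ≤ D) (s : Fin l) :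
    ((famA vIn vOut).filter (fun α => ∃ f ∈ α, f.1 = s)).card ≤ D := by
  have : (famA vIn vOut).filter (fun α => ∃ f ∈ α, f.1 = s) ⊆
      (Finset.univ.filter (fun t => vOut t = vIn s)).image (fun t => {((s, t) : PEdge l)}) := by
    intro α hα
    obtain ⟨h1, f, hf, rfl⟩ := Finset.mem_filter.1 hα
    obtain ⟨e, he, rfl⟩ := mem_famA.1 h1
    simp at hf
    subst hf
    rw [Finset.mem_image]
    exact ⟨f.2, by simp [he], rfl⟩
  refine (Finset.card_le_card this).trans (Finset.card_image_le.trans ?_)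
  rw [hvOut]
  exact hd _

lemma touchA2
    (hvIn : ∀ v : Fin n, (Finset.univ.filter (fun s => vIn s = v)).card = m v)
    (D : ℕ) (hm : ∀ v, m v ≤ D) (t : Fin l) :
    ((famA vIn vOut).filter (fun α => ∃ f ∈ α, f.2 = t)).card ≤ D := by
  have : (famA vIn vOut).filter (fun α => ∃ f ∈ α, f.2 = t) ⊆
      (Finset.univ.filter (fun s => vIn s = vOut t)).image (fun s => {((s, t) : PEdge l)}) := by
    intro α hα
    obtain ⟨h1, f, hf, rfl⟩ := Finset.mem_filter.1 hα
    obtain ⟨e, he, rfl⟩ := mem_famA.1 h1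
    simp at hf
    subst hf
    rw [Finset.mem_image]
    exact ⟨f.1, by simp [he], rfl⟩
  refine (Finset.card_le_card this).trans (Finset.card_image_le.trans ?_)
  rw [hvIn]
  exact hm _

lemma touchB1
    (hvIn : ∀ v : Fin n, (Finset.univ.filter (fun s => vIn s = v)).card = m v)
    (hvOut : ∀ v : Fin n, (Finset.univ.filter (fun s => vOut s = v)).card = d v)
    (D : ℕ) (hm : ∀ v, m v ≤ D) (s : Fin l) :
    ((famB vIn vOut).filter (fun α => ∃ f ∈ α, f.1 = s)).card ≤ D * ∑ v, d v ^ 2 := by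
  have : (famB vIn vOut).filter (fun α => ∃ f ∈ α, f.1 = s) ⊆
      ((Finset.univ.filter (fun s' => vIn s' = vIn s)) ×ˢ
        (Finset.univ.filter (fun p : Fin l × Fin l => vOut p.1 = vOut p.2))).image
        (fun q => {((s, q.2.1) : PEdge l), ((q.1, q.2.2) : PEdge l)}) := by
    intro α hα
    obtain ⟨h1, f, hf, rfl⟩ := Finset.mem_filter.1 hα
    obtain ⟨g, ⟨_, _, h3, h4, _⟩, rfl⟩ := famB_rep h1 hf
    rw [Finset.mem_image]
    refine ⟨(g.1, (f.2, g.2)), ?_, rfl⟩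
    simp only at h3 h4
    simp [h3, h4]
  refine (Finset.card_le_card this).trans (Finset.card_image_le.trans ?_)
  rw [Finset.card_product, hvIn, count_fg vOut vOut d d hvOut hvOut]
  simp_rw [pow_two]
  exact Nat.mul_le_mul_right _ (hm _)

lemma touchB2
    (hvIn : ∀ v : Fin n, (Finset.univ.filter (fun s => vIn s = v)).card = m v)
    (hvOut : ∀ v : Fin n, (Finset.univ.filter (fun s => vOut s = v)).card = d v)
    (D : ℕ) (hd : ∀ v, d v ≤ D) (t : Fin l) :
    ((famB vIn vOut).filter (fun α => ∃ f ∈ α, f.2 = t)).card ≤ D * ∑ v, m v ^ 2 := by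
  have : (famB vIn vOut).filter (fun α => ∃ f ∈ α, f.2 = t) ⊆
      ((Finset.univ.filter (fun t' => vOut t' = vOut t)) ×ˢ
        (Finset.univ.filter (fun p : Fin l × Fin l => vIn p.1 = vIn p.2))).image
        (fun q => {((q.2.1, t) : PEdge l), ((q.2.2, q.1) : PEdge l)}) := by
    intro α hα
    obtain ⟨h1, f, hf, rfl⟩ := Finset.mem_filter.1 hα
    obtain ⟨g, ⟨_, _, h3, h4, _⟩, rfl⟩ := famB_rep h1 hf
    rw [Finset.mem_image]
    refine ⟨(g.2, (f.1, g.1)), ?_, rfl⟩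
    simp only at h3 h4
    simp [h3, h4]
  refine (Finset.card_le_card this).trans (Finset.card_image_le.trans ?_)
  rw [Finset.card_product, hvOut, count_fg vIn vIn m m hvIn hvIn]
  simp_rw [pow_two]
  exact Nat.mul_le_mul_right _ (hd _)

lemma edgeB
    (hvIn : ∀ v : Fin n, (Finset.univ.filter (fun s => vIn s = v)).card = m v)
    (hvOut : ∀ v : Fin n, (Finset.univ.filter (fun s => vOut s = v)).card = d v)
    (D : ℕ) (hm : ∀ v, m v ≤ D) (hd : ∀ v, d v ≤ D) (e : PEdge l) :
    ((famB vIn vOut).filter (fun α => e ∈ α)).card ≤ D * D := by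
  have : (famB vIn vOut).filter (fun α => e ∈ α) ⊆
      ((Finset.univ.filter (fun s' => vIn s' = vIn e.1)) ×ˢ
        (Finset.univ.filter (fun t' => vOut t' = vOut e.2))).image
        (fun q => {e, (q : PEdge l)}) := by
    intro α hα
    obtain ⟨h1, hf⟩ := Finset.mem_filter.1 hα
    obtain ⟨g, ⟨_, _, h3, h4, _⟩, rfl⟩ := famB_rep h1 hf
    rw [Finset.mem_image]
    refine ⟨g, ?_, rfl⟩
    simp only at h3 h4
    simp [h3, h4]
  refine (Finset.card_le_card this).trans (Finset.card_image_le.trans ?_)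
  rw [Finset.card_product, hvIn, hvOut]
  exact Nat.mul_le_mul (hm _) (hd _)

lemma zM_BB
    (hvIn : ∀ v : Fin n, (Finset.univ.filter (fun s => vIn s = v)).card = m v)
    (hvOut : ∀ v : Fin n, (Finset.univ.filter (fun s => vOut s = v)).card = d v)
    (D : ℕ) (hm : ∀ v, m v ≤ D) (hd : ∀ v, d v ≤ D) :
    ∑ β ∈ famB vIn vOut, ∑ α ∈ famB vIn vOut, zM β α
      ≤ (famB vIn vOut).card * (2 * (D * D : ℕ)) * (1 / (l.descFactorial 3 : ℝ)) := by
  have h1 : ∀ β ∈ famB vIn vOut, ∀ α ∈ famB vIn vOut,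
      zM β α ≤ if ∃ e ∈ β, e ∈ α then 1 / (l.descFactorial 3 : ℝ) else 0 := by
    intro β hβ α hα
    unfold zM
    by_cases h : α ≠ β ∧ ∃ e ∈ α, e ∈ β
    · rw [if_pos h]
      obtain ⟨hne, e, he, he'⟩ := h
      rw [if_pos ⟨e, he', he⟩]
      simp_rw [indM_mul]
      by_cases hPM : IsPM (β ∪ α)
      · have := Ex_IndM hPM
        have hc : (β ∪ α).card = 3 := by
          obtain ⟨f, hf, rfl⟩ := famB_rep hα he
          obtain ⟨g, hg, rfl⟩ := famB_rep hβ he'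
          have h1 : e ≠ f := fun h => hf.1 (congrArg Prod.fst h)
          have h2 : e ≠ g := fun h => hg.1 (congrArg Prod.fst h)
          have h3 : g ≠ f := by rintro rfl; exact hne rfl
          have : ({e, g} ∪ {e, f} : Finset (PEdge l)) = {e, g, f} := by
            ext x; simp
          rw [this]
          exact Finset.card_eq_three.2 ⟨e, g, f, h2, h1, h3, rfl⟩
        rw [hc] at this
        exact this.le
      · have : ∀ σ, IndM (β ∪ α) σ = 0 := by
          intro σ
          unfold IndM
          rw [if_neg]
          intro hs
          apply hPM
          intro a ha b hb hab
          have h1 := hs a ha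
          have h2 := hs b hb
          rcases hab with hab | hab
          · ext1
            · exact hab
            · rw [← h1, ← h2, hab]
          · ext1
            · apply σ.injective; rw [h1, h2, hab]
            · exact hab
        simp only [this, Ex, Finset.sum_const_zero, zero_div]
        positivity
    · rw [if_neg h]
      split_ifs <;> positivity
  refine (Finset.sum_le_sum fun β hβ => Finset.sum_le_sum fun α hα => h1 β hβ α hα).trans ?_
  have h2 : ∀ β ∈ famB vIn vOut, (∑ α ∈ famB vIn vOut,
      if ∃ e ∈ β, e ∈ α then 1 / (l.descFactorial 3 : ℝ) else 0)
      ≤ (2 * (D * D : ℕ)) * (1 / (l.descFactorial 3 : ℝ)) := by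
    intro β hβ
    rw [← Finset.sum_filter, Finset.sum_const, nsmul_eq_mul]
    gcongr
    have h3 : (famB vIn vOut).filter (fun α => ∃ e ∈ β, e ∈ α) ⊆
        β.biUnion (fun e => (famB vIn vOut).filter (fun α => e ∈ α)) := by
      intro α hα
      obtain ⟨h1, e, h2, h3⟩ := Finset.mem_filter.1 hα
      rw [Finset.mem_biUnion]
      exact ⟨e, h2, Finset.mem_filter.2 ⟨h1, h3⟩⟩
    have h4 := (Finset.card_le_card h3).trans (Finset.card_biUnion_le_card_mul _ _ (D * D)
      (fun e _ => edgeB hvIn hvOut D hm hd e))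
    rw [(famB_spec β hβ).2] at h4
    exact_mod_cast h4
  refine (Finset.sum_le_sum h2).trans ?_
  rw [Finset.sum_const, nsmul_eq_mul, ← mul_assoc]

lemma card_famB_two : 2 * (famB vIn vOut).card
    = (Finset.univ.filter (QP vIn vOut)).card := by
  have h := Finset.card_eq_sum_card_image (fun q : PEdge l × PEdge l => ({q.1, q.2} : Finset (PEdge l)))
    (Finset.univ.filter (QP vIn vOut))
  rw [h]
  change _ = ∑ α ∈ famB vIn vOut, _
  rw [Finset.sum_const_nat (m := 2)]
  · ring
  intro α hα
  obtain ⟨q, hq, rfl⟩ := mem_famB.1 hα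
  have hne : q.1 ≠ q.2 := fun h => hq.1 (congrArg Prod.fst h)
  rw [Finset.card_eq_two]
  refine ⟨q, q.swap, ?_, ?_⟩
  · intro h
    exact hne (congrArg Prod.fst h)
  · ext r
    simp only [Finset.mem_filter, Finset.mem_univ, true_and, Finset.mem_insert, Finset.mem_singleton]
    constructor
    · rintro ⟨hr, h⟩
      have h1 : r.1 ∈ ({q.1, q.2} : Finset (PEdge l)) := by rw [← h]; simp
      have h2 : r.2 ∈ ({q.1, q.2} : Finset (PEdge l)) := by rw [← h]; simp
      have hner : r.1 ≠ r.2 := fun h => hr.1 (congrArg Prod.fst h)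
      simp only [Finset.mem_insert, Finset.mem_singleton] at h1 h2
      rcases h1 with h1 | h1 <;> rcases h2 with h2 | h2
      · exact absurd (h1.trans h2.symm) hner
      · left; ext1 <;> assumption
      · right; ext1 <;> assumption
      · exact absurd (h1.trans h2.symm) hner
    · rintro (rfl | rfl)
      · exact ⟨hq, rfl⟩
      · exact ⟨QP_symm hq, Finset.pair_comm _ _⟩

lemma card_famB_count
    (hvIn : ∀ v : Fin n, (Finset.univ.filter (fun s => vIn s = v)).card = m v)
    (hvOut : ∀ v : Fin n, (Finset.univ.filter (fun s => vOut s = v)).card = d v)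
    (D : ℕ) (hm : ∀ v, m v ≤ D) (hd : ∀ v, d v ≤ D) :
    ∃ x y z : ℕ, x + l = ∑ v, m v ^ 2 ∧ y + l = ∑ v, d v ^ 2 ∧
      2 * (famB vIn vOut).card + z = x * y ∧ z ≤ (∑ v, m v * d v) * (D * D) := by
  refine ⟨_, _, (Finset.univ.filter (fun q : PEdge l × PEdge l =>
    q.1.1 ≠ q.2.1 ∧ q.1.2 ≠ q.2.2 ∧ vIn q.1.1 = vIn q.2.1 ∧ vOut q.1.2 = vOut q.2.2 ∧
    vIn q.1.1 = vOut q.1.2)).card, count_ne vIn m hvIn, count_ne vOut d hvOut, ?_, ?_⟩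
  · rw [card_famB_two, ← Finset.card_product, add_comm]
    have e1 : ∀ S : Finset ((Fin l × Fin l) × (Fin l × Fin l)),
        S.card = (S.image (Equiv.prodProdProdComm (Fin l) (Fin l) (Fin l) (Fin l))).card := by
      intro S
      rw [Finset.card_image_of_injective _ (Equiv.injective _)]
    rw [e1 (_ ×ˢ _), ← Finset.card_union_of_disjoint]
    · congr 1
      ext ⟨⟨s1, t1⟩, ⟨s2, t2⟩⟩
      simp only [Finset.mem_union, Finset.mem_filter, Finset.mem_univ, true_and, Finset.mem_image,
        Finset.mem_product, QP, Prod.exists, Equiv.prodProdProdComm_apply, Prod.mk.injEq]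
      constructor
      · intro h
        exact ⟨s1, s2, t1, t2, by tauto, by simp⟩
      · rintro ⟨a, b, c, e, h, ⟨rfl, rfl⟩, ⟨rfl, rfl⟩⟩
        tauto
    · rw [Finset.disjoint_left]
      intro q h1 h2
      simp only [Finset.mem_filter, Finset.mem_univ, true_and, QP] at h1 h2
      tauto
  · have : (Finset.univ.filter (fun q : PEdge l × PEdge l =>
      q.1.1 ≠ q.2.1 ∧ q.1.2 ≠ q.2.2 ∧ vIn q.1.1 = vIn q.2.1 ∧ vOut q.1.2 = vOut q.2.2 ∧
      vIn q.1.1 = vOut q.1.2)) ⊆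
      (Finset.univ.filter (fun e : PEdge l => vIn e.1 = vOut e.2)).biUnion (fun e =>
      ((Finset.univ.filter (fun s' => vIn s' = vIn e.1)) ×ˢ
        (Finset.univ.filter (fun t' => vOut t' = vOut e.2))).image
        (fun q => (e, q))) := by
      intro q hq
      simp only [Finset.mem_filter, Finset.mem_univ, true_and] at hq
      simp only [Finset.mem_biUnion, Finset.mem_filter, Finset.mem_univ, true_and, Finset.mem_image,
        Finset.mem_product]
      exact ⟨q.1, hq.2.2.2.2, q.2, ⟨hq.2.2.1.symm, hq.2.2.2.1.symm⟩, rfl⟩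
    refine (Finset.card_le_card this).trans ?_
    rw [← count_fg vIn vOut m d hvIn hvOut]
    apply Finset.card_biUnion_le_card_mul
    intro e _
    refine Finset.card_image_le.trans ?_
    rw [Finset.card_product, hvIn, hvOut]
    exact Nat.mul_le_mul (hm _) (hd _)

end deg

lemma maxdeg {Ω : Type*} [MeasurableSpace Ω] (P : Measure Ω) [IsProbabilityMeasure P]
    (γ ξ : Ω → ℕ) (hγ : Measurable γ) (hξ : Measurable ξ)
    (hintγ2 : Integrable (fun ω => (γ ω : ℝ) ^ 2) P)
    (m d : (n : ℕ) → Fin n → ℕ)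
    (hjoint : ∀ i j : ℕ,
      Tendsto (fun n => ((Finset.univ.filter (fun k : Fin n => m n k = i ∧ d n k = j)).card : ℝ) / n)
        atTop (nhds (P {ω | γ ω = i ∧ ξ ω = j}).toReal))
    (hm2 : Tendsto (fun n => (∑ k, (m n k : ℝ) ^ 2) / n) atTop
      (nhds (∫ ω, (γ ω : ℝ) ^ 2 ∂P))) (ε : ℝ) (hε : 0 < ε) :
    ∀ᶠ n in atTop, ∀ v, (m n v : ℝ) ^ 2 ≤ ε * n := by
  have hms : ∀ i j : ℕ, MeasurableSet {ω | γ ω = i ∧ ξ ω = j} := fun i j =>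
    (hγ (measurableSet_singleton i)).inter (hξ (measurableSet_singleton j))
  let f : ℕ → Ω → ℝ := fun K ω => if γ ω < K ∧ ξ ω < K then (γ ω : ℝ) ^ 2 else 0
  have hfs : ∀ K, f K = fun ω => ∑ i ∈ Finset.range K, ∑ j ∈ Finset.range K,
      Set.indicator {ω | γ ω = i ∧ ξ ω = j} (fun _ => (i : ℝ) ^ 2) ω := by
    intro K
    funext ω
    simp only [f, Set.indicator_apply, Set.mem_ofPred_eq]
    have : ∀ i j : ℕ, (if γ ω = i ∧ ξ ω = j then (i : ℝ) ^ 2 else 0)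
        = if i = γ ω then (if j = ξ ω then (i : ℝ) ^ 2 else 0) else 0 := by
      intro i j
      by_cases h1 : i = γ ω <;> by_cases h2 : j = ξ ω <;> simp [h1, h2, eq_comm]
      all_goals intro h; simp_all
    simp_rw [this]
    simp only [Finset.sum_ite_irrel, Finset.sum_const_zero, Finset.sum_ite_eq', Finset.mem_range]
    by_cases h1 : γ ω < K <;> by_cases h2 : ξ ω < K <;> simp [h1, h2]
  have hfi : ∀ K, ∫ ω, f K ω ∂P = ∑ i ∈ Finset.range K, ∑ j ∈ Finset.range K,
      (i : ℝ) ^ 2 * (P {ω | γ ω = i ∧ ξ ω = j}).toReal := by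
    intro K
    rw [hfs, integral_finsetSum]
    · refine Finset.sum_congr rfl fun i _ => ?_
      rw [integral_finsetSum]
      · refine Finset.sum_congr rfl fun j _ => ?_
        rw [integral_indicator_const _ (hms i j)]
        simp [Measure.real, mul_comm]
      · intro j _
        exact (integrable_const _).indicator (hms i j)
    · intro i _
      exact integrable_finsetSum _ fun j _ => (integrable_const _).indicator (hms i j)
  have hfm : ∀ K, AEStronglyMeasurable (f K) P := by
    intro K
    rw [hfs]
    refine Measurable.aestronglyMeasurable ?_
    refine Finset.measurable_fun_sum _ fun i _ => Finset.measurable_fun_sum _ fun j _ => ?_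
    exact measurable_const.indicator (hms i j)
  have hlim : Tendsto (fun K => ∫ ω, f K ω ∂P) atTop (nhds (∫ ω, (γ ω : ℝ) ^ 2 ∂P)) := by
    apply tendsto_integral_of_dominated_convergence (fun ω => (γ ω : ℝ) ^ 2) hfm hintγ2
    · intro K
      refine Eventually.of_forall fun ω => ?_
      simp only [f]
      split_ifs
      · simp
      · simp
    · refine Eventually.of_forall fun ω => ?_
      apply tendsto_const_nhds.congr'
      filter_upwards [eventually_gt_atTop (γ ω), eventually_gt_atTop (ξ ω)] with K h1 h2
      simp [f, h1, h2]
  have h1 : ∃ K, ∫ ω, (γ ω : ℝ) ^ 2 ∂P - ∫ ω, f K ω ∂P < ε := by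
    have : ∀ᶠ K in atTop, ∫ ω, (γ ω : ℝ) ^ 2 ∂P - ε < ∫ ω, f K ω ∂P :=
      hlim.eventually (lt_mem_nhds (by linarith))
    obtain ⟨K, hK⟩ := this.exists
    exact ⟨K, by linarith⟩
  obtain ⟨K, hK⟩ := h1
  have h2 : Tendsto (fun n => (∑ v : Fin n, if m n v < K ∧ d n v < K then (m n v : ℝ) ^ 2 else 0) / n)
      atTop (nhds (∫ ω, f K ω ∂P)) := by
    rw [hfi]
    have : ∀ n : ℕ, (∑ v : Fin n, if m n v < K ∧ d n v < K then (m n v : ℝ) ^ 2 else 0) / (n : ℝ)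
        = ∑ i ∈ Finset.range K, ∑ j ∈ Finset.range K, (i : ℝ) ^ 2 *
         (((Finset.univ.filter (fun k : Fin n => m n k = i ∧ d n k = j)).card : ℝ) / n) := by
      intro n
      simp_rw [← mul_div_assoc, ← Finset.sum_div]
      congr 1
      simp_rw [Finset.card_filter]
      push_cast
      simp_rw [Finset.mul_sum]
      symm
      refine ((Finset.sum_congr rfl fun i _ => Finset.sum_comm).trans Finset.sum_comm).trans ?_
      refine Finset.sum_congr rfl fun v _ => ?_
      have : ∀ i j : ℕ, (i : ℝ) ^ 2 * (if m n v = i ∧ d n v = j then 1 else 0)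
          = if i = m n v then (if j = d n v then (i : ℝ) ^ 2 else 0) else 0 := by
        intro i j
        by_cases h1 : i = m n v <;> by_cases h2 : j = d n v <;> simp [h1, h2, eq_comm]
        all_goals intro h; simp_all
      simp_rw [this]
      simp only [Finset.sum_ite_irrel, Finset.sum_const_zero, Finset.sum_ite_eq', Finset.mem_range]
      by_cases h1 : m n v < K <;> by_cases h2 : d n v < K <;> simp [h1, h2]
    simp_rw [this]
    exact tendsto_finsetSum _ fun i _ => tendsto_finsetSum _ fun j _ => (hjoint i j).const_mul _
  have h3 := (hm2.sub h2).eventually (gt_mem_nhds hK)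
  have h4 : ∀ᶠ n : ℕ in atTop, (K : ℝ) ^ 2 / ε ≤ n :=
    tendsto_natCast_atTop_atTop.eventually_ge_atTop _
  filter_upwards [h3, h4, eventually_gt_atTop 0] with n h3 h4 hn v
  have hn' : (0:ℝ) < n := by exact_mod_cast hn
  rw [← sub_div, div_lt_iff₀ hn', ← Finset.sum_sub_distrib] at h3
  rw [div_le_iff₀ hε] at h4
  by_cases hv : m n v < K ∧ d n v < K
  · have : (m n v : ℝ) ≤ K := by exact_mod_cast hv.1.le
    have : (m n v : ℝ) ^ 2 ≤ K ^ 2 := by gcongr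
    linarith
  · refine le_trans ?_ h3.le
    have := Finset.single_le_sum (f := fun v => (m n v : ℝ) ^ 2 -
      if m n v < K ∧ d n v < K then (m n v : ℝ) ^ 2 else 0) (s := Finset.univ) ?_ (Finset.mem_univ v)
    · simpa [hv] using this
    · intro w _
      split_ifs
      · simp
      · simp

lemma poisson_lim (p : ℕ → ℕ → ℕ → ℝ) (L1 L2 : ℕ → ℝ) (x y : ℝ)
    (hL1 : Tendsto L1 atTop (nhds x)) (hL2 : Tendsto L2 atTop (nhds y))
    (hp : ∀ n a b, 0 ≤ p n a b)
    (h1 : ∀ a b, Tendsto (fun n => ((a + 1 : ℕ) : ℝ) * p n (a + 1) b - L1 n * p n a b) atTop (nhds 0))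
    (h2 : ∀ a b, Tendsto (fun n => ((b + 1 : ℕ) : ℝ) * p n a (b + 1) - L2 n * p n a b) atTop (nhds 0))
    (hle : ∀ n K, ∑ a ∈ Finset.range K, ∑ b ∈ Finset.range K, p n a b ≤ 1)
    (hge : ∀ n K, 1 - (L1 n + L2 n) / ((K + 1 : ℕ) : ℝ)
      ≤ ∑ a ∈ Finset.range (K + 1), ∑ b ∈ Finset.range (K + 1), p n a b) (a b : ℕ) :
    Tendsto (fun n => p n a b) atTop (nhds (poissonProb x a * poissonProb y b)) := by
  have hp1 : ∀ n a b, p n a b ≤ 1 := by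
    intro n a b
    refine le_trans ?_ (hle n (a + b + 1))
    have e1 : p n a b ≤ ∑ b' ∈ Finset.range (a + b + 1), p n a b' :=
      Finset.single_le_sum (f := fun b' => p n a b') (fun b' _ => hp n a b')
        (Finset.mem_range.2 (by omega))
    refine e1.trans ?_
    exact Finset.single_le_sum (f := fun a' => ∑ b' ∈ Finset.range (a + b + 1), p n a' b')
      (fun a' _ => Finset.sum_nonneg fun b' _ => hp n a' b') (Finset.mem_range.2 (by omega))
  have step : ∀ (f g q L : ℕ → ℝ) (z c : ℝ) (k : ℕ), Tendsto L atTop (nhds z) →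
      (∀ n, 0 ≤ g n) → (∀ n, g n ≤ 1) →
      Tendsto (fun n => ((k + 1 : ℕ) : ℝ) * f n - L n * g n) atTop (nhds 0) →
      Tendsto (fun n => g n - c * q n) atTop (nhds 0) →
      Tendsto (fun n => f n - (z / ((k + 1 : ℕ) : ℝ) * c) * q n) atTop (nhds 0) := by
    intro f g q L z c k hL hg0 hg1 hf hg
    have e1 : Tendsto (fun n => (L n - z) * g n) atTop (nhds 0) := by
      have : Tendsto (fun n => |L n - z|) atTop (nhds 0) := by
        have := (hL.sub_const z).abs
        simpa using this
      apply squeeze_zero_norm _ this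
      intro n
      rw [norm_mul, Real.norm_eq_abs, Real.norm_eq_abs, abs_of_nonneg (hg0 n)]
      exact mul_le_of_le_one_right (abs_nonneg _) (hg1 n)
    have e2 := (((hf.add e1).add (hg.const_mul z))).const_mul (1 / ((k + 1 : ℕ) : ℝ))
    simp only [mul_zero, add_zero] at e2
    refine e2.congr fun n => ?_
    have : ((k + 1 : ℕ) : ℝ) ≠ 0 := by positivity
    field_simp
    ring
  let c : ℕ → ℕ → ℝ := fun a b => (x ^ a / a.factorial) * (y ^ b / b.factorial)
  have hrow : ∀ b, Tendsto (fun n => p n 0 b - c 0 b * p n 0 0) atTop (nhds 0) := by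
    intro b
    induction b with
    | zero => simp [c]
    | succ b ih =>
      have := step _ _ _ L2 y _ b hL2 (fun n => hp n 0 b) (fun n => hp1 n 0 b) (h2 0 b) ih
      refine this.congr fun n => ?_
      congr 2
      simp only [c, Nat.factorial_succ]
      have h1 : ((b + 1 : ℕ) : ℝ) ≠ 0 := by positivity
      have h2 : (b.factorial : ℝ) ≠ 0 := by positivity
      push_cast at h1 ⊢
      field_simp
      ring
  have hall : ∀ a b, Tendsto (fun n => p n a b - c a b * p n 0 0) atTop (nhds 0) := by
    intro a b
    induction a with
    | zero => exact hrow b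
    | succ a ih =>
      have := step _ _ _ L1 x _ a hL1 (fun n => hp n a b) (fun n => hp1 n a b) (h1 a b) ih
      refine this.congr fun n => ?_
      congr 2
      simp only [c, Nat.factorial_succ]
      have h1 : ((a + 1 : ℕ) : ℝ) ≠ 0 := by positivity
      have h2 : (a.factorial : ℝ) ≠ 0 := by positivity
      push_cast at h1 ⊢
      field_simp
      ring
  have hS : Tendsto (fun K => ∑ a ∈ Finset.range (K + 1), ∑ b ∈ Finset.range (K + 1), c a b) atTop
      (nhds (Real.exp x * Real.exp y)) := by
    have e : ∀ z : ℝ, Tendsto (fun K => ∑ a ∈ Finset.range (K + 1), z ^ a / a.factorial) atTop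
        (nhds (Real.exp z)) := by
      intro z
      have h := (NormedSpace.expSeries_div_hasSum_exp z).tendsto_sum_nat
      rw [← Real.exp_eq_exp_ℝ] at h
      exact h.comp (tendsto_add_atTop_nat 1)
    refine ((e x).mul (e y)).congr fun K => ?_
    rw [Finset.sum_mul_sum]
  have hK : Tendsto (fun K : ℕ => (x + y + 1) / ((K + 1 : ℕ) : ℝ)) atTop (nhds 0) :=
    (tendsto_const_div_atTop_nhds_zero_nat (x + y + 1)).comp (tendsto_add_atTop_nat 1)
  have hq : Tendsto (fun n => (Real.exp x * Real.exp y) * p n 0 0) atTop (nhds 1) := by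
    rw [Metric.tendsto_atTop']
    intro ε hε
    have hev : ∀ᶠ K : ℕ in atTop, (x + y + 1) / ((K + 1 : ℕ) : ℝ) < ε / 4 :=
      hK.eventually (gt_mem_nhds (by linarith))
    have hev2 := Metric.tendsto_nhds.1 hS (ε / 4) (by linarith)
    obtain ⟨K, hK1, hK2⟩ := (hev.and hev2).exists
    have hsum : Tendsto (fun n => ∑ a ∈ Finset.range (K + 1), ∑ b ∈ Finset.range (K + 1),
        (p n a b - c a b * p n 0 0)) atTop (nhds 0) := by
      have := tendsto_finsetSum (Finset.range (K + 1)) (fun a _ =>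
        tendsto_finsetSum (Finset.range (K + 1)) fun b _ => hall a b)
      simpa using this
    have e1 := Metric.tendsto_nhds.1 hsum (ε / 4) (by linarith)
    have e2 : ∀ᶠ n in atTop, L1 n + L2 n < x + y + 1 :=
      (hL1.add hL2).eventually (gt_mem_nhds (by linarith))
    obtain ⟨N, hN⟩ := eventually_atTop.1 (e1.and e2)
    refine ⟨N, fun n hn => ?_⟩
    obtain ⟨e1, e2⟩ := hN n hn.le
    have e3 := hge n K
    have e4 := hle n (K + 1)
    simp only [Finset.sum_sub_distrib, ← Finset.sum_mul] at e1
    rw [Real.dist_eq] at e1 hK2 ⊢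
    set SP := ∑ a ∈ Finset.range (K + 1), ∑ b ∈ Finset.range (K + 1), p n a b
    set S := ∑ a ∈ Finset.range (K + 1), ∑ b ∈ Finset.range (K + 1), c a b
    have e5 : (L1 n + L2 n) / ((K + 1 : ℕ) : ℝ) ≤ (x + y + 1) / ((K + 1 : ℕ) : ℝ) := by
      gcongr
    have q0 := hp n 0 0
    have q1 := hp1 n 0 0
    have e6 : |(S - Real.exp x * Real.exp y) * p n 0 0| < ε / 4 := by
      rw [abs_mul, abs_of_nonneg q0]
      exact (mul_le_of_le_one_right (abs_nonneg _) q1).trans_lt hK2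
    rw [sub_zero] at e1
    rw [abs_lt] at *
    constructor <;> nlinarith [e6.1, e6.2, e1.1, e1.2]
  have hq2 : Tendsto (fun n => p n 0 0) atTop (nhds (Real.exp (-x) * Real.exp (-y))) := by
    have := hq.const_mul (Real.exp (-x) * Real.exp (-y))
    rw [mul_one] at this
    refine this.congr fun n => ?_
    rw [← mul_assoc]
    have : Real.exp (-x) * Real.exp (-y) * (Real.exp x * Real.exp y) = 1 := by
      rw [← Real.exp_add, ← Real.exp_add, ← Real.exp_add, ← Real.exp_zero]
      congr 1; ring
    rw [this, one_mul]
  have := (hall a b).add (hq2.const_mul (c a b))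
  simp only [sub_add_cancel, zero_add] at this
  convert this using 2
  simp only [poissonProb, c]
  ring

lemma desc_ratio (l : ℕ → ℕ) (hl : Tendsto l atTop atTop) (j : ℕ) :
    Tendsto (fun n => (l n : ℝ) ^ j / ((l n).descFactorial j : ℝ)) atTop (nhds 1) := by
  have h := (isEquivalent_descFactorial j)
  have h1 : Tendsto (fun n : ℕ => ((n.descFactorial j : ℝ)) / (n : ℝ) ^ j) atTop (nhds 1) := by
    have := (Asymptotics.isEquivalent_iff_tendsto_one ?_).1 h
    · exact this
    · filter_upwards [eventually_gt_atTop 0] with n hn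
      have : (0:ℝ) < n := by exact_mod_cast hn
      positivity
  have h2 := (h1.inv₀ one_ne_zero).comp hl
  rw [inv_one] at h2
  refine h2.congr fun n => ?_
  simp

lemma err_lim (l : ℕ → ℕ) (hl : Tendsto l atTop atTop) (j k : ℕ) (NA NB D : ℕ → ℝ) (x y : ℝ)
    (hA : Tendsto (fun n => NA n / (l n : ℝ) ^ j) atTop (nhds x))
    (hB : Tendsto (fun n => NB n / (l n : ℝ) ^ k) atTop (nhds y))
    (hD : Tendsto (fun n => D n / (l n : ℝ) ^ k) atTop (nhds 0)) :
    Tendsto (fun n => NA n * NB n * delt (l n) j k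
      + 2 * j * D n * NA n / ((l n).descFactorial j * (l n).descFactorial k : ℝ)) atTop (nhds 0) := by
  have hj := desc_ratio l hl j
  have hk := desc_ratio l hl k
  have hjk := desc_ratio l hl (j + k)
  have e1 := ((hA.mul hB).mul (hjk.sub (hj.mul hk))).add
    (((hD.mul hA).mul (hj.mul hk)).const_mul (2 * j : ℝ))
  simp only [mul_one, sub_self, mul_zero, zero_mul, add_zero] at e1
  refine e1.congr' ?_
  filter_upwards [hl.eventually_ge_atTop (j + k + 1)] with n hn
  have h0 : (0:ℝ) < l n := by exact_mod_cast (by omega : 0 < l n)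
  have h1 : (0:ℝ) < (l n).descFactorial j := by exact_mod_cast Nat.descFactorial_pos.2 (by omega)
  have h2 : (0:ℝ) < (l n).descFactorial k := by exact_mod_cast Nat.descFactorial_pos.2 (by omega)
  have h3 : (0:ℝ) < (l n).descFactorial (j + k) := by
    exact_mod_cast Nat.descFactorial_pos.2 (by omega)
  unfold delt
  rw [pow_add]
  field_simp

lemma prAB_swap {l : ℕ} (A B : Finset (Finset (PEdge l))) (a b : ℕ) :
    prAB A B a b = prAB B A b a := by
  unfold prAB
  simp_rw [and_comm]

lemma prAB_nonneg {l : ℕ} (A B : Finset (Finset (PEdge l))) (a b : ℕ) : 0 ≤ prAB A B a b :=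
  Ex_nonneg fun σ => by split_ifs <;> norm_num

lemma prAB_sum {l : ℕ} (A B : Finset (Finset (PEdge l))) (K : ℕ) :
    ∑ a ∈ Finset.range K, ∑ b ∈ Finset.range K, prAB A B a b
      = Ex (fun σ => if XC A σ < K ∧ XC B σ < K then (1:ℝ) else 0) := by
  unfold prAB
  simp_rw [← Ex_sum]
  congr 1
  funext σ
  have : ∀ i j : ℕ, (if XC A σ = i ∧ XC B σ = j then (1:ℝ) else 0)
      = if i = XC A σ then (if j = XC B σ then (1:ℝ) else 0) else 0 := by
    intro i j
    by_cases h1 : i = XC A σ <;> by_cases h2 : j = XC B σ <;> simp [h1, h2, eq_comm]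
    all_goals intro h; simp_all
  simp_rw [this]
  simp only [Finset.sum_ite_irrel, Finset.sum_const_zero, Finset.sum_ite_eq', Finset.mem_range]
  by_cases h1 : XC A σ < K <;> by_cases h2 : XC B σ < K <;> simp [h1, h2]

lemma prAB_le {l : ℕ} (A B : Finset (Finset (PEdge l))) (K : ℕ) :
    ∑ a ∈ Finset.range K, ∑ b ∈ Finset.range K, prAB A B a b ≤ 1 := by
  rw [prAB_sum]
  refine (Ex_mono (g := fun _ => 1) fun σ => ?_).trans_eq Ex_one
  split_ifs <;> norm_num

lemma prAB_ge {l : ℕ} (A B : Finset (Finset (PEdge l))) (K : ℕ) :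
    1 - (∑ β ∈ A, Ex (IndM β) + ∑ β ∈ B, Ex (IndM β)) / ((K + 1 : ℕ) : ℝ) ≤
    ∑ a ∈ Finset.range (K + 1), ∑ b ∈ Finset.range (K + 1), prAB A B a b := by
  have key : Ex (fun σ => 1 - (((K + 1 : ℕ) : ℝ))⁻¹ * (∑ β ∈ A, IndM β σ + ∑ β ∈ B, IndM β σ))
      ≤ Ex (fun σ : Equiv.Perm (Fin l) => if XC A σ < K + 1 ∧ XC B σ < K + 1 then (1:ℝ) else 0) := by
    refine Ex_mono fun σ => ?_
    rw [← XC_eq_sum, ← XC_eq_sum]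
    have hK : (0:ℝ) < ((K + 1 : ℕ) : ℝ) := by positivity
    split_ifs with h
    · have : 0 ≤ (((K + 1 : ℕ) : ℝ))⁻¹ * ((XC A σ : ℝ) + XC B σ) := by positivity
      linarith
    · rw [← div_eq_inv_mul, sub_nonpos, le_div_iff₀ hK, one_mul]
      have : K + 1 ≤ XC A σ + XC B σ := by
        by_contra! hc
        apply h
        omega
      exact_mod_cast this
  rw [Ex_sub, Ex_one, Ex_mul_left, Ex_add, Ex_sum, Ex_sum, ← div_eq_inv_mul] at key
  rw [prAB_sum]
  exact key

lemma sum_Ex_card {l j : ℕ} (A : Finset (Finset (PEdge l))) (hA : ∀ α ∈ A, IsPM α ∧ α.card = j) :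
    ∑ β ∈ A, Ex (IndM β) = A.card / (l.descFactorial j : ℝ) := by
  rw [Finset.sum_congr rfl (fun β hβ => by rw [Ex_IndM (hA β hβ).1, (hA β hβ).2])]
  rw [Finset.sum_const, nsmul_eq_mul, mul_one_div]

lemma main_lim
    (m d : (n : ℕ) → Fin n → ℕ) (l : ℕ → ℕ) (hl : Tendsto l atTop atTop)
    (vIn vOut : (n : ℕ) → Fin (l n) → Fin n)
    (hvIn : ∀ n (v : Fin n), (Finset.univ.filter (fun s => vIn n s = v)).card = m n v)
    (hvOut : ∀ n (v : Fin n), (Finset.univ.filter (fun s => vOut n s = v)).card = d n v)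
    (D : ℕ → ℕ) (hmD : ∀ n v, m n v ≤ D n) (hdD : ∀ n v, d n v ≤ D n)
    (x M2 D2 : ℝ)
    (hD : Tendsto (fun n => (D n : ℝ) ^ 2 / l n) atTop (nhds 0))
    (hcov : Tendsto (fun n => (∑ k, (m n k : ℝ) * (d n k : ℝ)) / l n) atTop (nhds x))
    (hm2 : Tendsto (fun n => (∑ k, (m n k : ℝ) ^ 2) / l n) atTop (nhds M2))
    (hd2 : Tendsto (fun n => (∑ k, (d n k : ℝ) ^ 2) / l n) atTop (nhds D2)) (a b : ℕ) :
    Tendsto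
        (fun n =>
          probUnif (l n)
            (Finset.univ.filter (fun σ : Equiv.Perm (Fin (l n)) =>
              selfLoops n (l n) (vIn n) (vOut n) σ = a
                ∧ multiEdges n (l n) (vIn n) (vOut n) σ = b)))
        atTop
        (nhds (poissonProb x a * poissonProb ((M2 - 1) * (D2 - 1) / 2) b)) := by
  have hl0 : ∀ᶠ n in atTop, (0:ℝ) < l n := by
    filter_upwards [hl.eventually_gt_atTop 0] with n hn
    exact_mod_cast hn
  have hD1 : Tendsto (fun n => (D n : ℝ) / l n) atTop (nhds 0) := by
    refine squeeze_zero (fun n => by positivity) (fun n => ?_) hD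
    gcongr
    have : D n ≤ D n ^ 2 := Nat.le_self_pow (by norm_num) _
    exact_mod_cast this
  have hNA : Tendsto (fun n => ((famA (vIn n) (vOut n)).card : ℝ) / (l n : ℝ) ^ 1) atTop (nhds x) := by
    refine hcov.congr fun n => ?_
    rw [card_famA (hvIn n) (hvOut n), pow_one]
    push_cast
    rfl
  have hNB : Tendsto (fun n => ((famB (vIn n) (vOut n)).card : ℝ) / (l n : ℝ) ^ 2) atTop
      (nhds ((M2 - 1) * (D2 - 1) / 2)) := by
    choose X Y Z hX hY hZ hZ' using fun n =>
      card_famB_count (hvIn n) (hvOut n) (D n) (hmD n) (hdD n)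
    have eX : Tendsto (fun n => (X n : ℝ) / l n) atTop (nhds (M2 - 1)) := by
      refine (hm2.sub_const 1).congr' ?_
      filter_upwards [hl0] with n hn
      have : (∑ k, (m n k : ℝ) ^ 2) = X n + l n := by exact_mod_cast (hX n).symm
      rw [this]; field_simp; ring
    have eY : Tendsto (fun n => (Y n : ℝ) / l n) atTop (nhds (D2 - 1)) := by
      refine (hd2.sub_const 1).congr' ?_
      filter_upwards [hl0] with n hn
      have : (∑ k, (d n k : ℝ) ^ 2) = Y n + l n := by exact_mod_cast (hY n).symm
      rw [this]; field_simp; ring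
    have eZ : Tendsto (fun n => (Z n : ℝ) / (l n : ℝ) ^ 2) atTop (nhds 0) := by
      have := hcov.mul hD
      rw [mul_zero] at this
      refine squeeze_zero (fun n => by positivity) (fun n => ?_) this
      rw [div_mul_div_comm, ← pow_two]
      gcongr
      have : (Z n : ℝ) ≤ ((∑ v, m n v * d n v) * (D n * D n) : ℕ) := by exact_mod_cast hZ' n
      push_cast at this
      rw [pow_two]
      exact this
    have := ((eX.mul eY).sub eZ).div_const 2
    rw [sub_zero] at this
    refine this.congr fun n => ?_
    have h2 : 2 * ((famB (vIn n) (vOut n)).card : ℝ) + Z n = X n * Y n := by exact_mod_cast hZ n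
    rw [div_mul_div_comm, ← pow_two, ← h2]
    ring
  have hDB : Tendsto (fun n => ((D n * (∑ v, m n v ^ 2 + ∑ v, d n v ^ 2) : ℕ) : ℝ) / (l n : ℝ) ^ 2) atTop
      (nhds 0) := by
    have := hD1.mul (hm2.add hd2)
    rw [zero_mul] at this
    refine this.congr fun n => ?_
    push_cast
    rw [← add_div, div_mul_div_comm, ← pow_two]
  have hDA : Tendsto (fun n => (D n : ℝ) / (l n : ℝ) ^ 1) atTop (nhds 0) := by simpa using hD1
  have hz : Tendsto (fun n => ∑ β ∈ famB (vIn n) (vOut n), ∑ α ∈ famB (vIn n) (vOut n), zM β α)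
      atTop (nhds 0) := by
    have e := (((hNB.mul hD).mul (desc_ratio l hl 3)).const_mul 2)
    simp only [mul_zero, zero_mul] at e
    refine squeeze_zero' (Eventually.of_forall fun n => ?_) ?_ e
    · refine Finset.sum_nonneg fun β _ => Finset.sum_nonneg fun α _ => ?_
      unfold zM
      split_ifs
      · exact Ex_nonneg fun σ => mul_nonneg (IndM_nonneg _ _) (IndM_nonneg _ _)
      · exact le_rfl
    · filter_upwards [hl0] with n hn
      refine (zM_BB (hvIn n) (hvOut n) (D n) (hmD n) (hdD n)).trans (le_of_eq ?_)
      push_cast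
      field_simp
  have tA1 := fun n => touchA1 (vIn := vIn n) (hvOut n) (D n) (hdD n)
  have tA2 := fun n => touchA2 (vOut := vOut n) (hvIn n) (D n) (hmD n)
  have tB1 : ∀ n (s : Fin (l n)), ((famB (vIn n) (vOut n)).filter (fun α => ∃ f ∈ α, f.1 = s)).card
      ≤ D n * (∑ v, m n v ^ 2 + ∑ v, d n v ^ 2) := fun n s =>
    (touchB1 (hvIn n) (hvOut n) (D n) (hmD n) s).trans (Nat.mul_le_mul_left _ (by omega))
  have tB2 : ∀ n (s : Fin (l n)), ((famB (vIn n) (vOut n)).filter (fun α => ∃ f ∈ α, f.2 = s)).card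
      ≤ D n * (∑ v, m n v ^ 2 + ∑ v, d n v ^ 2) := fun n s =>
    (touchB2 (hvIn n) (hvOut n) (D n) (hdD n) s).trans (Nat.mul_le_mul_left _ (by omega))
  have hl4 := hl.eventually_ge_atTop 4
  have hAA := err_lim l hl 1 1 _ _ _ x x hNA hNA hDA
  have hAB := err_lim l hl 1 2 _ _ _ x _ hNA hNB hDB
  have hBA := err_lim l hl 2 1 _ _ _ _ x hNB hNA hDA
  have hBB := err_lim l hl 2 2 _ _ _ _ _ hNB hNB hDB
  have hL1 : Tendsto (fun n => ∑ β ∈ famA (vIn n) (vOut n), Ex (IndM β)) atTop (nhds x) := by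
    have := hNA.mul (desc_ratio l hl 1)
    rw [mul_one] at this
    refine this.congr' ?_
    filter_upwards [hl0] with n hn
    rw [sum_Ex_card _ famA_spec]
    field_simp
  have hL2 : Tendsto (fun n => ∑ β ∈ famB (vIn n) (vOut n), Ex (IndM β)) atTop
      (nhds ((M2 - 1) * (D2 - 1) / 2)) := by
    have := hNB.mul (desc_ratio l hl 2)
    rw [mul_one] at this
    refine this.congr' ?_
    filter_upwards [hl0] with n hn
    rw [sum_Ex_card _ famB_spec]
    field_simp
  have hpr : Tendsto (fun n => prAB (famA (vIn n) (vOut n)) (famB (vIn n) (vOut n)) a b) atTop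
      (nhds (poissonProb x a * poissonProb ((M2 - 1) * (D2 - 1) / 2) b)) := by
    refine poisson_lim (fun n a b => prAB (famA (vIn n) (vOut n)) (famB (vIn n) (vOut n)) a b)
      _ _ x _ hL1 hL2 (fun n a b => prAB_nonneg _ _ _ _) ?_ ?_ (fun n K => prAB_le _ _ _)
      (fun n K => prAB_ge _ _ _) a b
    · intro a b
      have e := hAA.add hAB
      rw [add_zero] at e
      apply squeeze_zero_norm' _ e
      filter_upwards [hl4] with n hn
      rw [Real.norm_eq_abs]
      refine (stein _ _ (fun α hα => (famA_spec α hα).1) famAB_disj a b).trans ?_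
      have e1 := errSum_le (by omega : 1 + 1 ≤ l n) le_rfl (famA (vIn n) (vOut n)) (famA (vIn n) (vOut n)) famA_spec famA_spec (D n) (tA1 n) (tA2 n)
      have e2 := errSum_le (by omega : 1 + 2 ≤ l n) le_rfl (famA (vIn n) (vOut n)) (famB (vIn n) (vOut n)) famA_spec famB_spec _ (tB1 n) (tB2 n)
      rw [zM_AA, add_zero] at e1
      rw [zM_AB, add_zero] at e2
      exact add_le_add e1 e2
    · intro a b
      have e := (hBB.add hz).add hBA
      simp only [add_zero] at e
      apply squeeze_zero_norm' _ e
      filter_upwards [hl4] with n hn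
      rw [Real.norm_eq_abs, prAB_swap _ _ a (b + 1), prAB_swap _ _ a b]
      refine (stein _ _ (fun α hα => (famB_spec α hα).1) famAB_disj.symm b a).trans ?_
      have e1 := errSum_le (by omega : 2 + 2 ≤ l n) (by norm_num) (famB (vIn n) (vOut n)) (famB (vIn n) (vOut n)) famB_spec famB_spec _ (tB1 n) (tB2 n)
      have e2 := errSum_le (by omega : 2 + 1 ≤ l n) (by norm_num) (famB (vIn n) (vOut n)) (famA (vIn n) (vOut n)) famB_spec famA_spec _ (tA1 n) (tA2 n)
      rw [zM_BA, add_zero] at e2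
      exact add_le_add e1 e2
  have hdiff : Tendsto (fun n => probUnif (l n)
      (Finset.univ.filter (fun σ : Equiv.Perm (Fin (l n)) =>
        selfLoops n (l n) (vIn n) (vOut n) σ = a
          ∧ multiEdges n (l n) (vIn n) (vOut n) σ = b))
      - prAB (famA (vIn n) (vOut n)) (famB (vIn n) (vOut n)) a b) atTop (nhds 0) :=
    squeeze_zero_norm (fun n => by
      rw [Real.norm_eq_abs]; exact prob_diff (vIn n) (vOut n) a b) hz
  have := hdiff.add hpr
  simpa using this

/-- Poisson limit of self-loops and multiple edges in the directed configuration model: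
under weak convergence of the empirical in/out-degree distribution to `(γ, ξ)` with
`E[γ] = E[ξ] = μ > 0` together with convergence of first moments, covariance and
second moments, `(S_n, M_n)` converges in distribution to a pair of independent
Poisson random variables with means `λ₁ = E[γξ]/μ` and
`λ₂ = E[γ(γ-1)] E[ξ(ξ-1)] / (2μ²)`. -/
theorem stmt11
    {Ω : Type*} [MeasurableSpace Ω] (P : Measure Ω) [IsProbabilityMeasure P]
    (γ ξ : Ω → ℕ) (hγ : Measurable γ) (hξ : Measurable ξ)
    (μ : ℝ) (hμ : 0 < μ)
    (hintγ : Integrable (fun ω => (γ ω : ℝ)) P)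
    (hintξ : Integrable (fun ω => (ξ ω : ℝ)) P)
    (hintγ2 : Integrable (fun ω => (γ ω : ℝ) ^ 2) P)
    (hintξ2 : Integrable (fun ω => (ξ ω : ℝ) ^ 2) P)
    (hintprod : Integrable (fun ω => (γ ω : ℝ) * (ξ ω : ℝ)) P)
    (hEγ : ∫ ω, (γ ω : ℝ) ∂P = μ) (hEξ : ∫ ω, (ξ ω : ℝ) ∂P = μ)
    (m d : (n : ℕ) → Fin n → ℕ) (l : ℕ → ℕ)
    (hm : ∀ n, ∑ i, m n i = l n) (hd : ∀ n, ∑ i, d n i = l n)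
    (vIn vOut : (n : ℕ) → Fin (l n) → Fin n)
    (hvIn : ∀ n (v : Fin n), (Finset.univ.filter (fun s => vIn n s = v)).card = m n v)
    (hvOut : ∀ n (v : Fin n), (Finset.univ.filter (fun s => vOut n s = v)).card = d n v)
    (hjoint : ∀ i j : ℕ,
      Tendsto (fun n => ((Finset.univ.filter (fun k : Fin n => m n k = i ∧ d n k = j)).card : ℝ) / n)
        atTop (nhds (P {ω | γ ω = i ∧ ξ ω = j}).toReal))
    (hm1 : Tendsto (fun n => (∑ k, (m n k : ℝ)) / n) atTop (nhds μ))
    (hd1 : Tendsto (fun n => (∑ k, (d n k : ℝ)) / n) atTop (nhds μ))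
    (hcov : Tendsto (fun n => (∑ k, (m n k : ℝ) * (d n k : ℝ)) / n) atTop
      (nhds (∫ ω, (γ ω : ℝ) * (ξ ω : ℝ) ∂P)))
    (hm2 : Tendsto (fun n => (∑ k, (m n k : ℝ) ^ 2) / n) atTop
      (nhds (∫ ω, (γ ω : ℝ) ^ 2 ∂P)))
    (hd2 : Tendsto (fun n => (∑ k, (d n k : ℝ) ^ 2) / n) atTop
      (nhds (∫ ω, (ξ ω : ℝ) ^ 2 ∂P))) :
    ∀ a b : ℕ,
      Tendsto
        (fun n =>
          probUnif (l n)
            (Finset.univ.filter (fun σ : Equiv.Perm (Fin (l n)) =>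
              selfLoops n (l n) (vIn n) (vOut n) σ = a
                ∧ multiEdges n (l n) (vIn n) (vOut n) σ = b)))
        atTop
        (nhds
          (poissonProb ((∫ ω, (γ ω : ℝ) * (ξ ω : ℝ) ∂P) / μ) a
            * poissonProb
                ((∫ ω, (γ ω : ℝ) * ((γ ω : ℝ) - 1) ∂P)
                  * (∫ ω, (ξ ω : ℝ) * ((ξ ω : ℝ) - 1) ∂P) / (2 * μ ^ 2)) b)) := by
  intro a b
  have hmn : ∀ n, (∑ k, (m n k : ℝ)) = l n := fun n => by exact_mod_cast hm n
  simp_rw [hmn] at hm1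
  have hlR : Tendsto (fun n => (l n : ℝ)) atTop atTop := by
    refine (hm1.pos_mul_atTop hμ tendsto_natCast_atTop_atTop).congr' ?_
    filter_upwards [eventually_gt_atTop 0] with n hn
    have : (n : ℝ) ≠ 0 := by exact_mod_cast hn.ne'
    field_simp
  have hl : Tendsto l atTop atTop := tendsto_natCast_atTop_iff.1 hlR
  have hinv : Tendsto (fun n : ℕ => (n : ℝ) / l n) atTop (nhds (1 / μ)) := by
    have := hm1.inv₀ hμ.ne'
    rw [one_div]
    refine this.congr fun n => ?_
    rw [inv_div]
  have conv : ∀ (f : ℕ → ℝ) (c : ℝ), Tendsto (fun n => f n / n) atTop (nhds c) →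
      Tendsto (fun n => f n / l n) atTop (nhds (c / μ)) := by
    intro f c hf
    have := hf.mul hinv
    rw [mul_one_div] at this
    refine this.congr' ?_
    filter_upwards [eventually_gt_atTop 0] with n hn
    have : (n : ℝ) ≠ 0 := by exact_mod_cast hn.ne'
    field_simp
  let D : ℕ → ℕ := fun n => Finset.univ.sup (fun v => max (m n v) (d n v))
  have hmD : ∀ n v, m n v ≤ D n := fun n v =>
    (le_max_left _ _).trans (Finset.le_sup (f := fun v => max (m n v) (d n v)) (Finset.mem_univ v))
  have hdD : ∀ n v, d n v ≤ D n := fun n v =>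
    (le_max_right _ _).trans (Finset.le_sup (f := fun v => max (m n v) (d n v)) (Finset.mem_univ v))
  have hjoint' : ∀ i j : ℕ,
      Tendsto (fun n => ((Finset.univ.filter (fun k : Fin n => d n k = i ∧ m n k = j)).card : ℝ) / n)
        atTop (nhds (P {ω | ξ ω = i ∧ γ ω = j}).toReal) := by
    intro i j
    have e1 : {ω | ξ ω = i ∧ γ ω = j} = {ω | γ ω = j ∧ ξ ω = i} := by
      ext ω; exact and_comm
    rw [e1]
    refine (hjoint j i).congr fun n => ?_
    rw [Finset.filter_congr (fun k _ => and_comm)]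
  have hDn : Tendsto (fun n => (D n : ℝ) ^ 2 / n) atTop (nhds 0) := by
    rw [Metric.tendsto_nhds]
    intro ε hε
    filter_upwards [maxdeg P γ ξ hγ hξ hintγ2 m d hjoint hm2 (ε / 2) (by linarith),
      maxdeg P ξ γ hξ hγ hintξ2 d m hjoint' hd2 (ε / 2) (by linarith),
      eventually_gt_atTop 0] with n h1 h2 hn
    have hn' : (0:ℝ) < n := by exact_mod_cast hn
    have hne : (Finset.univ : Finset (Fin n)).Nonempty := ⟨⟨0, hn⟩, Finset.mem_univ _⟩
    obtain ⟨v, -, hv⟩ := Finset.exists_mem_eq_sup _ hne (fun v => max (m n v) (d n v))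
    have hv' : D n = max (m n v) (d n v) := hv
    have : (D n : ℝ) ^ 2 ≤ ε / 2 * n := by
      rw [hv']
      rcases max_choice (m n v) (d n v) with h | h <;> rw [h]
      · exact h1 v
      · exact h2 v
    rw [Real.dist_eq, sub_zero, abs_of_nonneg (by positivity), div_lt_iff₀ hn']
    nlinarith
  have hD := conv _ _ hDn
  rw [zero_div] at hD
  have main := main_lim m d l hl vIn vOut hvIn hvOut D hmD hdD _ _ _ hD (conv _ _ hcov)
    (conv _ _ hm2) (conv _ _ hd2) a b
  have i1 : ∫ ω, (γ ω : ℝ) * ((γ ω : ℝ) - 1) ∂P = ∫ ω, (γ ω : ℝ) ^ 2 ∂P - μ := by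
    rw [← hEγ, ← integral_sub hintγ2 hintγ]
    congr 1; funext ω; ring
  have i2 : ∫ ω, (ξ ω : ℝ) * ((ξ ω : ℝ) - 1) ∂P = ∫ ω, (ξ ω : ℝ) ^ 2 ∂P - μ := by
    rw [← hEξ, ← integral_sub hintξ2 hintξ]
    congr 1; funext ω; ring
  rw [i1, i2]
  convert main using 4
  field_simp
end

section
/- Under the regularity conditions (weak convergence of empirical in/out-degree distribution to (γ, ξ) with E[γ] = E[ξ] = μ > 0, and convergence of first moments, covariance, and second moments), the probability that the directed configuration model produces a simple graph from (m_n, d_n) converges to e^{-λ_1 - λ_2} > 0 as n → ∞, where λ_1 = E[γξ]/μ and λ_2 = E[γ(γ-1)]E[ξ(ξ-1)]/(2μ²). -/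
open MeasureTheory Filter
open scoped Classical

/-! ### Part 1: permutations extending a partial matching -/

namespace DCM

/-- permutations extending a set of cells -/
noncomputable def ext {L : ℕ} (D : Finset (Fin L × Fin L)) : Finset (Equiv.Perm (Fin L)) :=
  Finset.univ.filter (fun σ => ∀ c ∈ D, σ c.1 = c.2)

lemma mem_ext {L : ℕ} {D : Finset (Fin L × Fin L)} {σ : Equiv.Perm (Fin L)} :
    σ ∈ ext D ↔ ∀ c ∈ D, σ c.1 = c.2 := by
  simp [ext]

lemma ext_step {L : ℕ} (D : Finset (Fin L × Fin L)) (s t : Fin L)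
    (hs : ∀ c ∈ D, c.1 ≠ s) (ht : ∀ c ∈ D, c.2 ≠ t)
    (g : Fin L → Equiv.Perm (Fin L) → ℝ) :
    ∑ r ∈ Finset.univ.filter (fun r => ∀ c ∈ D, c.1 ≠ r),
      ∑ σ ∈ ext (insert (s, t) D), g r (σ * Equiv.swap s r)
    = ∑ σ ∈ ext D, g (σ⁻¹ t) σ := by
  rw [← Finset.sum_product']
  refine Finset.sum_bij' (fun p _ => p.2 * Equiv.swap s p.1)
    (fun σ _ => (σ⁻¹ t, σ * Equiv.swap s (σ⁻¹ t))) ?_ ?_ ?_ ?_ ?_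
  · rintro ⟨r, σ⟩ h
    simp only [Finset.mem_product, Finset.mem_filter, Finset.mem_univ, true_and, mem_ext,
      Finset.forall_mem_insert] at h ⊢
    intro c hc
    rw [Equiv.Perm.mul_apply, Equiv.swap_apply_of_ne_of_ne (hs c hc) (h.1 c hc)]
    exact h.2.2 c hc
  · intro σ h
    simp only [Finset.mem_product, Finset.mem_filter, Finset.mem_univ, true_and, mem_ext,
      Finset.forall_mem_insert] at h ⊢
    have h1 : ∀ c ∈ D, c.1 ≠ σ⁻¹ t := by
      intro c hc h2
      apply ht c hc
      rw [← h c hc, h2]; simp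
    refine ⟨h1, by simp, fun c hc => ?_⟩
    rw [Equiv.Perm.mul_apply, Equiv.swap_apply_of_ne_of_ne (hs c hc) (h1 c hc)]
    exact h c hc
  · rintro ⟨r, σ⟩ h
    simp only [Finset.mem_product, Finset.mem_filter, Finset.mem_univ, true_and, mem_ext,
      Finset.forall_mem_insert] at h
    have : σ⁻¹ t = s := by rw [← h.2.1]; simp
    have h3 : (σ * Equiv.swap s r)⁻¹ t = r := by
      rw [mul_inv_rev, Equiv.Perm.mul_apply, this]; simp
    simp only [h3, mul_assoc, Equiv.swap_mul_self, mul_one]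
  · intro σ h
    simp [mul_assoc]
  · rintro ⟨r, σ⟩ h
    simp only [Finset.mem_product, Finset.mem_filter, Finset.mem_univ, true_and, mem_ext,
      Finset.forall_mem_insert] at h
    have : σ⁻¹ t = s := by rw [← h.2.1]; simp
    have h3 : (σ * Equiv.swap s r)⁻¹ t = r := by
      rw [mul_inv_rev, Equiv.Perm.mul_apply, this]; simp
    simp only [h3]

lemma card_free {L : ℕ} (D : Finset (Fin L × Fin L)) (h : Set.InjOn Prod.fst (D : Set (Fin L × Fin L))) :
    (Finset.univ.filter (fun r : Fin L => ∀ c ∈ D, c.1 ≠ r)).card = L - D.card := by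
  have : (Finset.univ.filter (fun r : Fin L => ∀ c ∈ D, c.1 ≠ r)) = (D.image Prod.fst)ᶜ := by
    ext r
    simp only [Finset.mem_filter, Finset.mem_univ, true_and, Finset.mem_compl, Finset.mem_image,
      not_exists, not_and]
  rw [this, Finset.card_compl, Finset.card_image_of_injOn h, Fintype.card_fin]

lemma card_le_L {L : ℕ} (D : Finset (Fin L × Fin L)) (h : Set.InjOn Prod.fst (D : Set (Fin L × Fin L))) :
    D.card ≤ L := by
  rw [← Finset.card_image_of_injOn h]
  simpa using Finset.card_le_univ (D.image Prod.fst)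

lemma card_ext {L : ℕ} (D : Finset (Fin L × Fin L))
    (h1 : Set.InjOn Prod.fst (D : Set (Fin L × Fin L)))
    (h2 : Set.InjOn Prod.snd (D : Set (Fin L × Fin L))) :
    (ext D).card = (L - D.card).factorial := by
  induction D using Finset.induction_on with
  | empty => simp [ext, Fintype.card_perm]
  | insert a D ha ih =>
    obtain ⟨s, t⟩ := a
    have h1' := h1.mono (Finset.coe_subset.2 (Finset.subset_insert _ D))
    have h2' := h2.mono (Finset.coe_subset.2 (Finset.subset_insert _ D))
    have ih := ih h1' h2'
    have hs : ∀ c ∈ D, c.1 ≠ s := by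
      intro c hc e
      have := h1 (by simp [hc] : c ∈ ((insert (s, t) D : Finset _) : Set (Fin L × Fin L))) (by simp : (s,t) ∈ ((insert (s, t) D : Finset _) : Set (Fin L × Fin L))) e
      exact ha (this ▸ hc)
    have ht : ∀ c ∈ D, c.2 ≠ t := by
      intro c hc e
      have := h2 (by simp [hc] : c ∈ ((insert (s, t) D : Finset _) : Set (Fin L × Fin L))) (by simp : (s,t) ∈ ((insert (s, t) D : Finset _) : Set (Fin L × Fin L))) e
      exact ha (this ▸ hc)
    have key := ext_step D s t hs ht (fun _ _ => 1)
    simp only [Finset.sum_const, nsmul_eq_mul, mul_one, card_free D h1', ih] at key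
    have hle := card_le_L _ h1
    rw [Finset.card_insert_of_notMem ha] at hle ⊢
    have e : L - D.card = (L - (D.card + 1)) + 1 := by omega
    rw [e, Nat.factorial_succ] at key
    have key' : (L - (D.card + 1) + 1) * (ext (insert (s,t) D)).card = (L - (D.card + 1) + 1) * (L - (D.card + 1)).factorial := by
      exact_mod_cast key
    exact Nat.eq_of_mul_eq_mul_left (by omega) key'

lemma card_ext_le {L : ℕ} (D : Finset (Fin L × Fin L))
    (h1 : Set.InjOn Prod.fst (D : Set (Fin L × Fin L))) :
    (ext D).card ≤ (L - D.card).factorial := by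
  by_cases h2 : Set.InjOn Prod.snd (D : Set (Fin L × Fin L))
  · exact (card_ext D h1 h2).le
  · have : ext D = ∅ := by
      rw [Finset.eq_empty_iff_forall_notMem]
      intro σ hσ
      apply h2
      intro c hc c' hc' e
      rw [mem_ext] at hσ
      apply h1 hc hc'
      apply σ.injective
      rw [hσ c hc, hσ c' hc', e]
    simp [this]

lemma fact_bound {L a b : ℕ} (hL : 6 ≤ L) (ha : a ≤ 2) (hb : b ≤ 2) :
    (L - (a + b)).factorial * L.factorial ≤ 4 * ((L - a).factorial * (L - b).factorial) := by
  obtain ⟨k, rfl⟩ := Nat.exists_eq_add_of_le' hL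
  have e6 : (k+6).factorial = (k+6)*((k+5)*((k+4)*((k+3)*(k+2).factorial))) := by
    simp [Nat.factorial_succ]
  have e5 : (k+5).factorial = ((k+5)*((k+4)*((k+3)*(k+2).factorial))) := by
    simp [Nat.factorial_succ]
  have e4 : (k+4).factorial = (((k+4)*((k+3)*(k+2).factorial))) := by
    simp [Nat.factorial_succ]
  have e3 : (k+3).factorial = ((((k+3)*(k+2).factorial))) := by
    simp [Nat.factorial_succ]
  obtain ⟨f, e2⟩ : ∃ f, (k+2).factorial = f := ⟨_, rfl⟩
  rw [e2] at e3 e4 e5 e6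
  have p (i : ℕ) : 0 ≤ k ^ i * f ^ 2 := Nat.zero_le _
  have p0 := p 0
  have p1 := p 1
  have p2 := p 2
  have p3 := p 3
  have p4 := p 4
  have p5 := p 5
  have p6 := p 6
  interval_cases a <;> interval_cases b <;>
    simp only [Nat.reduceAdd, show k + 6 - 1 = k + 5 by omega, show k + 6 - 2 = k + 4 by omega,
      show k + 6 - 3 = k + 3 by omega, show k + 6 - 4 = k + 2 by omega, e6, e5, e4, e3, e2, Nat.sub_zero] <;>
    nlinarith

end DCM
/-! ### Part 2: abstract Poisson approximation -/

namespace DCM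

/-- probability that `k` given cells are all present -/
noncomputable def q (L k : ℕ) : ℝ := ((L - k).factorial : ℝ) / (L.factorial : ℝ)

/-- number of features of the family `T` present in `σ` -/
noncomputable def cnt {L : ℕ} {ι : Type*} (cells : ι → Finset (Fin L × Fin L)) (T : Finset ι)
    (σ : Equiv.Perm (Fin L)) : ℕ := (T.filter (fun i => σ ∈ ext (cells i))).card

structure Good {L : ℕ} {ι : Type*} (cells : ι → Finset (Fin L × Fin L)) (T : Finset ι)
    (C : ℝ) : Prop where
  hL : 6 ≤ L
  row : ∀ i ∈ T, Set.InjOn Prod.fst (cells i : Set (Fin L × Fin L))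
  col : ∀ i ∈ T, Set.InjOn Prod.snd (cells i : Set (Fin L × Fin L))
  card1 : ∀ i ∈ T, (cells i).card = 1 ∨ (cells i).card = 2
  tot : ∑ i ∈ T, q L (cells i).card ≤ C
  hrow : ∀ s, ∑ i ∈ T.filter (fun i => ∃ c ∈ cells i, c.1 = s), q L (cells i).card ≤ C / L
  hcol : ∀ t, ∑ i ∈ T.filter (fun i => ∃ c ∈ cells i, c.2 = t), q L (cells i).card ≤ C / L

lemma q_nonneg (L k : ℕ) : 0 ≤ q L k := by unfold q; positivity

lemma cnt_eq_sum {L : ℕ} {ι : Type*} (cells : ι → Finset (Fin L × Fin L)) (T : Finset ι)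
    (σ : Equiv.Perm (Fin L)) :
    (cnt cells T σ : ℝ) = ∑ i ∈ T, if σ ∈ ext (cells i) then (1 : ℝ) else 0 := by
  simp [cnt]

lemma sum_cnt {L : ℕ} {ι : Type*} (cells : ι → Finset (Fin L × Fin L)) (T : Finset ι)
    (A : Finset (Equiv.Perm (Fin L))) :
    ∑ σ ∈ A, (cnt cells T σ : ℝ) = ∑ i ∈ T, ((A.filter (fun σ => σ ∈ ext (cells i))).card : ℝ) := by
  simp_rw [cnt_eq_sum]
  rw [Finset.sum_comm]
  refine Finset.sum_congr rfl fun i _ => ?_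
  rw [← Finset.sum_filter]
  simp only [Finset.sum_const, nsmul_eq_mul, mul_one]

lemma cnt_split {L : ℕ} {ι : Type*} (cells : ι → Finset (Fin L × Fin L)) (T : Finset ι)
    (p : ι → Prop) [DecidablePred p] (σ : Equiv.Perm (Fin L)) :
    cnt cells T σ = cnt cells (T.filter p) σ + cnt cells (T.filter (fun i => ¬ p i)) σ := by
  unfold cnt
  rw [Finset.filter_comm, Finset.filter_comm (fun i => ¬ p i),
    Finset.card_filter_add_card_filter_not]

lemma sum_cnt_univ {L : ℕ} {ι : Type*} (cells : ι → Finset (Fin L × Fin L)) (T : Finset ι)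
    (row : ∀ i ∈ T, Set.InjOn Prod.fst (cells i : Set (Fin L × Fin L)))
    (col : ∀ i ∈ T, Set.InjOn Prod.snd (cells i : Set (Fin L × Fin L))) :
    ∑ σ, (cnt cells T σ : ℝ) = L.factorial * ∑ i ∈ T, q L (cells i).card := by
  rw [sum_cnt, Finset.mul_sum]
  refine Finset.sum_congr rfl fun i hi => ?_
  rw [Finset.filter_univ_mem, card_ext _ (row i hi) (col i hi), q]
  field_simp

lemma sum_cnt_ext {L : ℕ} {ι : Type*} {cells : ι → Finset (Fin L × Fin L)} {T : Finset ι}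
    {C : ℝ} (hG : Good cells T C) (U : Finset ι) (hU : U ⊆ T) (D : Finset (Fin L × Fin L))
    (hD : Set.InjOn Prod.fst (D : Set (Fin L × Fin L))) (hD2 : D.card ≤ 2)
    (hdis : ∀ i ∈ U, ∀ c ∈ cells i, ∀ c' ∈ D, c.1 ≠ c'.1) :
    ∑ σ ∈ ext D, (cnt cells U σ : ℝ) ≤ 4 * (L - D.card).factorial * ∑ i ∈ U, q L (cells i).card := by
  rw [sum_cnt, Finset.mul_sum]
  refine Finset.sum_le_sum fun i hi => ?_
  have h1 : (ext D).filter (fun σ => σ ∈ ext (cells i)) = ext (D ∪ cells i) := by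
    ext σ
    simp only [Finset.mem_filter, mem_ext, Finset.mem_union, or_imp, forall_and]
  have hdj : Disjoint D (cells i) := by
    rw [Finset.disjoint_left]
    intro c hc hc'
    exact hdis i hi c hc' c hc rfl
  have hinj : Set.InjOn Prod.fst ((D ∪ cells i : Finset _) : Set (Fin L × Fin L)) := by
    rw [Finset.coe_union, Set.injOn_union (by exact_mod_cast hdj)]
    exact ⟨hD, hG.row i (hU hi), fun c hc c' hc' => (hdis i hi c' hc' c hc).symm⟩
  have h2 := card_ext_le _ hinj
  rw [Finset.card_union_of_disjoint hdj] at h2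
  rw [h1]
  have h3 : (cells i).card ≤ 2 := by rcases hG.card1 i (hU hi) with h | h <;> omega
  have h4 := fact_bound hG.hL hD2 h3
  have hpos : (0 : ℝ) < L.factorial := by positivity
  unfold q
  rw [mul_div_assoc', le_div_iff₀ hpos]
  calc ((ext (D ∪ cells i)).card : ℝ) * L.factorial
      ≤ ((L - (D.card + (cells i).card)).factorial : ℝ) * L.factorial := by gcongr
    _ ≤ 4 * ((L - D.card).factorial * (L - (cells i).card).factorial) := by exact_mod_cast h4
    _ = _ := by ring

lemma pow_diff {z : ℝ} (h0 : 0 ≤ z) (h1 : z ≤ 1) (a b : ℕ) : |z ^ a - z ^ b| ≤ |(a : ℝ) - b| := by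
  by_cases h : a = b
  · simp [h]
  have h2 : (1 : ℝ) ≤ |(a : ℝ) - b| := by
    have : (1 : ℤ) ≤ |(a : ℤ) - b| := by
      apply Int.one_le_abs; omega
    exact_mod_cast this
  refine le_trans ?_ h2
  have := pow_nonneg h0 a
  have := pow_nonneg h0 b
  have := pow_le_one₀ h0 h1 (n := a)
  have := pow_le_one₀ h0 h1 (n := b)
  rw [abs_le]; constructor <;> linarith

lemma cnt_swap {L : ℕ} {ι : Type*} (cells : ι → Finset (Fin L × Fin L)) (U : Finset ι)
    (s r : Fin L) (hs : ∀ i ∈ U, ∀ c ∈ cells i, c.1 ≠ s) (σ : Equiv.Perm (Fin L)) :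
    |(cnt cells U σ : ℝ) - cnt cells U (σ * Equiv.swap s r)| ≤
      cnt cells (U.filter (fun i => ∃ c ∈ cells i, c.1 = r)) σ +
      cnt cells (U.filter (fun i => ∃ c ∈ cells i, c.1 = r)) (σ * Equiv.swap s r) := by
  rw [cnt_split cells U (fun i => ∃ c ∈ cells i, c.1 = r) σ,
    cnt_split cells U (fun i => ∃ c ∈ cells i, c.1 = r) (σ * Equiv.swap s r)]
  have : cnt cells (U.filter (fun i => ¬ ∃ c ∈ cells i, c.1 = r)) σ =
      cnt cells (U.filter (fun i => ¬ ∃ c ∈ cells i, c.1 = r)) (σ * Equiv.swap s r) := by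
    unfold cnt
    congr 1
    apply Finset.filter_congr
    intro i hi
    simp only [Finset.mem_filter, not_exists, not_and] at hi
    simp only [mem_ext]
    refine forall₂_congr fun c hc => ?_
    rw [Equiv.Perm.mul_apply, Equiv.swap_apply_of_ne_of_ne (hs i hi.1 c hc) (hi.2 c hc)]
  rw [this]
  push_cast
  generalize (cnt cells (U.filter (fun i => ∃ c ∈ cells i, c.1 = r)) σ) = x
  generalize (cnt cells (U.filter (fun i => ∃ c ∈ cells i, c.1 = r)) (σ * Equiv.swap s r)) = y
  have hx : (0 : ℝ) ≤ x := by positivity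
  have hy : (0 : ℝ) ≤ y := by positivity
  rw [abs_le]; constructor <;> linarith

lemma sum_rows_cnt {L : ℕ} {ι : Type*} (cells : ι → Finset (Fin L × Fin L)) (U : Finset ι)
    (hU : ∀ i ∈ U, (cells i).card ≤ 2) (A : Finset (Fin L)) (σ : Equiv.Perm (Fin L)) :
    ∑ r ∈ A, (cnt cells (U.filter (fun i => ∃ c ∈ cells i, c.1 = r)) σ : ℝ)
      ≤ 2 * cnt cells U σ := by
  simp_rw [cnt_eq_sum, Finset.sum_filter]
  rw [Finset.sum_comm, Finset.mul_sum]
  refine Finset.sum_le_sum fun i hi => ?_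
  split_ifs with h
  · rw [← Finset.sum_filter]
    simp only [Finset.sum_const, nsmul_eq_mul, mul_one]
    have : A.filter (fun r => ∃ c ∈ cells i, c.1 = r) ⊆ (cells i).image Prod.fst := by
      intro r; simp
    have h2 := (Finset.card_le_card this).trans (Finset.card_image_le.trans (hU i hi))
    exact_mod_cast h2
  · simp

/-- conditional expectation -/
noncomputable def avg {L : ℕ} (D : Finset (Fin L × Fin L)) (h : Equiv.Perm (Fin L) → ℝ) : ℝ :=
  (∑ σ ∈ ext D, h σ) / (L - D.card).factorial

lemma step_bound {L : ℕ} {ι : Type*} {cells : ι → Finset (Fin L × Fin L)} {T : Finset ι}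
    {C : ℝ} (hG : Good cells T C) (U : Finset ι) (hU : U ⊆ T) (D : Finset (Fin L × Fin L))
    (hD : Set.InjOn Prod.fst (D : Set (Fin L × Fin L))) (hD1 : D.card ≤ 1)
    (s t : Fin L) (hs : ∀ c ∈ D, c.1 ≠ s) (ht : ∀ c ∈ D, c.2 ≠ t)
    (hdis : ∀ i ∈ U, ∀ c ∈ cells i, ∀ c' ∈ D, c.1 ≠ c'.1)
    (hdis' : ∀ i ∈ U, ∀ c ∈ cells i, c.1 ≠ s) {z : ℝ} (h0 : 0 ≤ z) (h1 : z ≤ 1) :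
    |avg D (fun σ => z ^ cnt cells U σ) - avg (insert (s, t) D) (fun σ => z ^ cnt cells U σ)|
      ≤ 20 * C / L := by
  set h : Equiv.Perm (Fin L) → ℝ := fun σ => z ^ cnt cells U σ with hh
  set D' := insert (s, t) D with hD'
  have hst : (s, t) ∉ D := fun hc => hs _ hc rfl
  have hcard : D'.card = D.card + 1 := Finset.card_insert_of_notMem hst
  have hL := hG.hL
  have hD'inj : Set.InjOn Prod.fst (D' : Set (Fin L × Fin L)) := by
    rw [hD', Finset.coe_insert, Set.injOn_insert (by exact_mod_cast hst)]
    refine ⟨hD, ?_⟩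
    rintro ⟨c, hc, e⟩
    exact hs c hc e
  set A := Finset.univ.filter (fun r : Fin L => ∀ c ∈ D, c.1 ≠ r) with hA
  have hAc : (A.card : ℝ) = (L : ℝ) - D.card := by
    rw [hA, card_free D hD, Nat.cast_sub (by omega)]
  have id1 := ext_step D s t hs ht (fun _ σ => h σ)
  have id2 := ext_step D s t hs ht
    (fun r σ => (cnt cells (U.filter (fun i => ∃ c ∈ cells i, c.1 = r)) σ : ℝ))
  rw [← hD', ← hA] at id1 id2
  have main : |∑ σ ∈ ext D, h σ - ((L : ℝ) - D.card) * ∑ σ ∈ ext D', h σ| ≤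
      ∑ σ ∈ ext D', 2 * (cnt cells U σ : ℝ) +
      ∑ σ ∈ ext D, (cnt cells (U.filter (fun i => ∃ c ∈ cells i, c.2 = t)) σ : ℝ) := by
    have e2 : ((L : ℝ) - D.card) * ∑ σ ∈ ext D', h σ = ∑ r ∈ A, ∑ σ ∈ ext D', h σ := by
      rw [Finset.sum_const, nsmul_eq_mul, hAc]
    rw [← id1, e2, ← Finset.sum_sub_distrib]
    have e3 : ∀ r, (∑ σ ∈ ext D', h (σ * Equiv.swap s r) - ∑ σ ∈ ext D', h σ) =
        ∑ σ ∈ ext D', (h (σ * Equiv.swap s r) - h σ) := fun r => by rw [Finset.sum_sub_distrib]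
    simp only [e3]
    calc |∑ r ∈ A, ∑ σ ∈ ext D', (h (σ * Equiv.swap s r) - h σ)|
        ≤ ∑ r ∈ A, ∑ σ ∈ ext D', |h (σ * Equiv.swap s r) - h σ| := by
          refine (Finset.abs_sum_le_sum_abs _ _).trans ?_
          exact Finset.sum_le_sum fun r _ => Finset.abs_sum_le_sum_abs _ _
      _ ≤ ∑ r ∈ A, ∑ σ ∈ ext D',
          ((cnt cells (U.filter (fun i => ∃ c ∈ cells i, c.1 = r)) σ : ℝ) +
          cnt cells (U.filter (fun i => ∃ c ∈ cells i, c.1 = r)) (σ * Equiv.swap s r)) := by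
          refine Finset.sum_le_sum fun r _ => Finset.sum_le_sum fun σ _ => ?_
          rw [abs_sub_comm]
          exact (pow_diff h0 h1 _ _).trans (cnt_swap cells U s r hdis' σ)
      _ = ∑ σ ∈ ext D', ∑ r ∈ A, (cnt cells (U.filter (fun i => ∃ c ∈ cells i, c.1 = r)) σ : ℝ) +
          ∑ σ ∈ ext D, (cnt cells (U.filter (fun i => ∃ c ∈ cells i, c.1 = σ⁻¹ t)) σ : ℝ) := by
          simp_rw [Finset.sum_add_distrib]
          rw [id2, Finset.sum_comm]
      _ ≤ _ := by
          gcongr with σ hσ σ hσ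
          · refine sum_rows_cnt cells U (fun i hi => ?_) A σ
            rcases hG.card1 i (hU hi) with h | h <;> omega
          · unfold cnt
            apply Finset.card_le_card
            intro i
            simp only [Finset.mem_filter, mem_ext]
            rintro ⟨⟨hi, c, hc, e⟩, h⟩
            refine ⟨⟨hi, c, hc, ?_⟩, h⟩
            rw [← h c hc, e]; simp
  have b1 := sum_cnt_ext hG U hU D' hD'inj (by omega) (by
    intro i hi c hc c' hc'
    rw [hD', Finset.mem_insert] at hc'
    rcases hc' with rfl | hc'
    · exact hdis' i hi c hc
    · exact hdis i hi c hc c' hc')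
  have b2 := sum_cnt_ext hG (U.filter (fun i => ∃ c ∈ cells i, c.2 = t))
    ((Finset.filter_subset _ _).trans hU) D hD (by omega) (by
    intro i hi
    exact hdis i (Finset.mem_filter.1 hi).1)
  have c1 : ∑ i ∈ U, q L (cells i).card ≤ C :=
    (Finset.sum_le_sum_of_subset_of_nonneg hU (fun _ _ _ => q_nonneg _ _)).trans hG.tot
  have c2 : ∑ i ∈ U.filter (fun i => ∃ c ∈ cells i, c.2 = t), q L (cells i).card ≤ C / L :=
    (Finset.sum_le_sum_of_subset_of_nonneg (Finset.filter_subset_filter _ hU)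
      (fun _ _ _ => q_nonneg _ _)).trans (hG.hcol t)
  have hC : 0 ≤ C := (Finset.sum_nonneg (fun _ _ => q_nonneg _ _)).trans hG.tot
  have hfac : ((L - D.card).factorial : ℝ) = ((L : ℝ) - D.card) * (L - D'.card).factorial := by
    rw [hcard, ← Nat.cast_sub (by omega : D.card ≤ L), ← Nat.cast_mul]
    congr 1
    rw [show L - D.card = (L - (D.card + 1)) + 1 by omega, Nat.factorial_succ]
  unfold avg
  set f : ℝ := ((L - D'.card).factorial : ℝ) with hf
  have hfpos : 0 < f := by rw [hf]; positivity
  have hdcard : (D.card : ℝ) ≤ 1 := by exact_mod_cast hD1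
  have hLr : (6 : ℝ) ≤ L := by exact_mod_cast hL
  set x : ℝ := (L : ℝ) - D.card with hx
  have hxpos : 0 < x := by linarith
  have hx2 : (L : ℝ) ≤ 2 * x := by linarith
  have hLpos : (0:ℝ) < L := by linarith
  rw [hfac] at b2 ⊢
  rw [show (∑ σ ∈ ext D, h σ) / (x * f) - (∑ σ ∈ ext D', h σ) / f =
    (∑ σ ∈ ext D, h σ - x * ∑ σ ∈ ext D', h σ) / (x * f) by field_simp]
  rw [abs_div, abs_of_pos (by positivity : 0 < x * f), div_le_iff₀ (by positivity)]
  refine main.trans ?_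
  rw [← Finset.mul_sum]
  have b1' : ∑ σ ∈ ext D', (cnt cells U σ : ℝ) ≤ 4 * f * C :=
    b1.trans (by gcongr)
  have b2' : ∑ σ ∈ ext D, (cnt cells (U.filter (fun i => ∃ c ∈ cells i, c.2 = t)) σ : ℝ)
      ≤ 4 * (x * f) * (C / L) := b2.trans (by gcongr)
  have : 8 * f * C ≤ 16 * (x * f) * (C / L) := by
    rw [mul_div_assoc', le_div_iff₀ hLpos]
    have : 0 ≤ f * C := by positivity
    nlinarith
  calc _ ≤ 2 * (4 * f * C) + 4 * (x * f) * (C / L) := by gcongr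
    _ ≤ 16 * (x * f) * (C / L) + 4 * (x * f) * (C / L) := by linarith
    _ = _ := by ring

end DCM
namespace DCM

/-- features of `T` whose rows avoid those of the feature `i` -/
noncomputable def away {L : ℕ} {ι : Type*} (cells : ι → Finset (Fin L × Fin L)) (T : Finset ι)
    (i : ι) : Finset ι := T.filter (fun j => ¬ ∃ c ∈ cells j, ∃ c' ∈ cells i, c.1 = c'.1)

/-- number of present features other than `i` that share a row with `i` -/
noncomputable def clash {L : ℕ} {ι : Type*} (cells : ι → Finset (Fin L × Fin L)) (T : Finset ι)
    (i : ι) (σ : Equiv.Perm (Fin L)) : ℕ :=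
  (T.filter (fun j => j ≠ i ∧ σ ∈ ext (cells j) ∧ ∃ c ∈ cells j, ∃ c' ∈ cells i, c.1 = c'.1)).card

lemma away_disj {L : ℕ} {ι : Type*} {cells : ι → Finset (Fin L × Fin L)} {T : Finset ι} {i j : ι}
    (h : j ∈ away cells T i) : ∀ c ∈ cells j, ∀ c' ∈ cells i, c.1 ≠ c'.1 := by
  intro c hc c' hc' e
  exact (Finset.mem_filter.1 h).2 ⟨c, hc, c', hc', e⟩

lemma away_sub {L : ℕ} {ι : Type*} (cells : ι → Finset (Fin L × Fin L)) (T : Finset ι) (i : ι) :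
    away cells T i ⊆ T := Finset.filter_subset _ _

lemma chain {L : ℕ} {ι : Type*} {cells : ι → Finset (Fin L × Fin L)} {T : Finset ι}
    {C : ℝ} (hG : Good cells T C) (i : ι) (hi : i ∈ T) {z : ℝ} (h0 : 0 ≤ z) (h1 : z ≤ 1) :
    |avg ∅ (fun σ => z ^ cnt cells (away cells T i) σ) -
      avg (cells i) (fun σ => z ^ cnt cells (away cells T i) σ)| ≤ 40 * C / L := by
  have hC : 0 ≤ C := (Finset.sum_nonneg (fun _ _ => q_nonneg _ _)).trans hG.tot
  have hle : 20 * C / L ≤ 40 * C / L := by gcongr; norm_num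
  have hrow := hG.row i hi
  have hcol := hG.col i hi
  have haway : ∀ j ∈ away cells T i, ∀ c ∈ cells j, ∀ c' ∈ cells i, c.1 ≠ c'.1 :=
    fun j hj => away_disj hj
  rcases hG.card1 i hi with h | h
  · obtain ⟨⟨s, t⟩, hc⟩ := Finset.card_eq_one.1 h
    have := step_bound hG (away cells T i) (away_sub _ _ _) ∅ (by simp) (by simp) s t (by simp)
      (by simp) (by simp) (fun j hj c hcj => haway j hj c hcj (s, t) (by simp [hc])) h0 h1
    rw [hc]
    exact this.trans hle
  · obtain ⟨⟨s, t⟩, ⟨s', t'⟩, hne, hc⟩ := Finset.card_eq_two.1 h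
    have hss : s' ≠ s := by
      intro e
      exact hne (hrow (by simp [hc]) (by simp [hc]) e.symm)
    have htt : t' ≠ t := by
      intro e
      exact hne (hcol (by simp [hc]) (by simp [hc]) e.symm)
    have a1 := step_bound hG (away cells T i) (away_sub _ _ _) ∅ (by simp) (by simp) s' t' (by simp)
      (by simp) (by simp) (fun j hj c hcj => haway j hj c hcj (s', t') (by simp [hc])) h0 h1
    have a2 := step_bound hG (away cells T i) (away_sub _ _ _) {(s', t')} (by simp) (by simp) s t
      (by simpa using hss) (by simpa using htt)
      (fun j hj c hcj c' hc' => haway j hj c hcj c' (by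
        rw [Finset.mem_singleton] at hc'; simp [hc, hc']))
      (fun j hj c hcj => haway j hj c hcj (s, t) (by simp [hc])) h0 h1
    rw [hc]
    refine (abs_sub_le _ _ _).trans ((add_le_add a1 a2).trans ?_)
    apply le_of_eq; ring

lemma cnt_clash {L : ℕ} {ι : Type*} {cells : ι → Finset (Fin L × Fin L)} {T : Finset ι}
    {C : ℝ} (hG : Good cells T C) (i : ι) (hi : i ∈ T) (σ : Equiv.Perm (Fin L))
    (hσ : σ ∈ ext (cells i)) :
    cnt cells T σ - 1 = cnt cells (away cells T i) σ + clash cells T i σ := by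
  rw [cnt_split cells T (fun j => ∃ c ∈ cells j, ∃ c' ∈ cells i, c.1 = c'.1) σ]
  have : cnt cells (T.filter (fun j => ∃ c ∈ cells j, ∃ c' ∈ cells i, c.1 = c'.1)) σ =
      clash cells T i σ + 1 := by
    unfold cnt clash
    rw [← Finset.card_insert_of_notMem (a := i) (by simp)]
    congr 1
    ext j
    simp only [Finset.mem_filter, Finset.mem_insert]
    constructor
    · rintro ⟨⟨a, b⟩, c⟩
      by_cases h : j = i
      · exact Or.inl h
      · exact Or.inr ⟨a, h, c, b⟩
    · rintro (rfl | ⟨a, h, c, b⟩)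
      · have : (cells j).Nonempty := by
          rw [← Finset.card_pos]; rcases hG.card1 j hi with h | h <;> omega
        obtain ⟨c, hc⟩ := this
        exact ⟨⟨hi, c, hc, c, hc, rfl⟩, hσ⟩
      · exact ⟨⟨a, b⟩, c⟩
  rw [this]
  unfold away
  omega

lemma sum_away {L : ℕ} {ι : Type*} {cells : ι → Finset (Fin L × Fin L)} {T : Finset ι}
    {C : ℝ} (hG : Good cells T C) (i : ι) (hi : i ∈ T) {z : ℝ} (h0 : 0 ≤ z) (h1 : z ≤ 1) :
    |avg ∅ (fun σ => z ^ cnt cells (away cells T i) σ) - avg ∅ (fun σ => z ^ cnt cells T σ)|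
      ≤ 2 * C / L := by
  unfold avg
  simp only [Finset.card_empty, Nat.sub_zero]
  have hext : ext (∅ : Finset (Fin L × Fin L)) = Finset.univ := by simp [ext]
  rw [hext, ← sub_div, abs_div, abs_of_pos (by positivity : (0 : ℝ) < L.factorial),
    div_le_iff₀ (by positivity), ← Finset.sum_sub_distrib]
  set V := T.filter (fun j => ∃ c ∈ cells j, ∃ c' ∈ cells i, c.1 = c'.1) with hV
  have hVT : V ⊆ T := Finset.filter_subset _ _
  calc _ ≤ ∑ σ, (cnt cells V σ : ℝ) := by
        refine (Finset.abs_sum_le_sum_abs _ _).trans (Finset.sum_le_sum fun σ _ => ?_)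
        refine (pow_diff h0 h1 _ _).trans ?_
        have := cnt_split cells T (fun j => ∃ c ∈ cells j, ∃ c' ∈ cells i, c.1 = c'.1) σ
        rw [this, ← hV, away]
        push_cast
        rw [abs_le]
        have : (0:ℝ) ≤ cnt cells V σ := by positivity
        constructor <;> linarith
    _ = L.factorial * ∑ j ∈ V, q L (cells j).card :=
        sum_cnt_univ _ _ (fun j hj => hG.row j (hVT hj)) (fun j hj => hG.col j (hVT hj))
    _ ≤ L.factorial * (2 * C / L) := by
        gcongr
        have hC : 0 ≤ C := (Finset.sum_nonneg (fun _ _ => q_nonneg _ _)).trans hG.tot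
        calc ∑ j ∈ V, q L (cells j).card
            ≤ ∑ c' ∈ cells i, ∑ j ∈ T.filter (fun j => ∃ c ∈ cells j, c.1 = c'.1),
                q L (cells j).card := by
              simp_rw [hV, Finset.sum_filter]
              rw [Finset.sum_comm]
              refine Finset.sum_le_sum fun j _ => ?_
              have hnn : ∀ c' ∈ cells i,
                  0 ≤ if (∃ c ∈ cells j, c.1 = c'.1) then q L (cells j).card else 0 := by
                intro c' _; split_ifs; exacts [q_nonneg _ _, le_rfl]
              split_ifs with hj
              · obtain ⟨c, hc, c', hc', e⟩ := hj
                refine le_trans ?_ (Finset.single_le_sum hnn hc')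
                rw [if_pos ⟨c, hc, e⟩]
              · exact Finset.sum_nonneg hnn
          _ ≤ ∑ c' ∈ cells i, C / L := Finset.sum_le_sum fun c' _ => hG.hrow _
          _ = (cells i).card * (C / L) := by simp
          _ ≤ 2 * (C / L) := by
              gcongr
              have : (cells i).card ≤ 2 := by rcases hG.card1 i hi with h | h <;> omega
              exact_mod_cast this
          _ = _ := by ring
    _ = _ := by ring

lemma per_feature {L : ℕ} {ι : Type*} {cells : ι → Finset (Fin L × Fin L)} {T : Finset ι}
    {C : ℝ} (hG : Good cells T C) (i : ι) (hi : i ∈ T) {z : ℝ} (h0 : 0 ≤ z) (h1 : z ≤ 1) :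
    |(∑ σ ∈ ext (cells i), z ^ (cnt cells T σ - 1)) / L.factorial
      - q L (cells i).card * avg ∅ (fun σ => z ^ cnt cells T σ)| ≤
    (∑ σ ∈ ext (cells i), (clash cells T i σ : ℝ)) / L.factorial
      + q L (cells i).card * (42 * C / L) := by
  have hL : (0 : ℝ) < L.factorial := by positivity
  have e1 : (∑ σ ∈ ext (cells i), z ^ cnt cells (away cells T i) σ) / L.factorial =
      q L (cells i).card * avg (cells i) (fun σ => z ^ cnt cells (away cells T i) σ) := by
    unfold q avg; field_simp
  have s1 : |(∑ σ ∈ ext (cells i), z ^ (cnt cells T σ - 1)) / L.factorial -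
      (∑ σ ∈ ext (cells i), z ^ cnt cells (away cells T i) σ) / L.factorial| ≤
      (∑ σ ∈ ext (cells i), (clash cells T i σ : ℝ)) / L.factorial := by
    rw [← sub_div, abs_div, abs_of_pos hL, ← Finset.sum_sub_distrib]
    gcongr
    refine (Finset.abs_sum_le_sum_abs _ _).trans (Finset.sum_le_sum fun σ hσ => ?_)
    refine (pow_diff h0 h1 _ _).trans ?_
    rw [cnt_clash hG i hi σ hσ]
    push_cast
    simp
  have s2 := chain hG i hi h0 h1
  have s3 := sum_away hG i hi h0 h1
  have s4 : |avg (cells i) (fun σ => z ^ cnt cells (away cells T i) σ) -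
      avg ∅ (fun σ => z ^ cnt cells T σ)| ≤ 42 * C / L := by
    rw [abs_sub_comm] at s2
    refine (abs_sub_le _ _ _).trans ((add_le_add s2 s3).trans (le_of_eq ?_))
    ring
  refine (abs_sub_le _ _ _).trans (add_le_add s1 ?_)
  rw [e1, ← mul_sub, abs_mul, abs_of_nonneg (q_nonneg _ _)]
  exact mul_le_mul_of_nonneg_left s4 (q_nonneg _ _)

theorem poisson_abs {L : ℕ} {ι : Type*} {cells : ι → Finset (Fin L × Fin L)} {T : Finset ι}
    {C : ℝ} (hG : Good cells T C)
    (hcl : ∑ i ∈ T, ∑ σ ∈ ext (cells i), (clash cells T i σ : ℝ) ≤ L.factorial * (C / L)) :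
    |((Finset.univ.filter (fun σ => cnt cells T σ = 0)).card : ℝ) / L.factorial
      - Real.exp (-(∑ i ∈ T, q L (cells i).card))| ≤ (C + 42 * C ^ 2) / L := by
  set lam := ∑ i ∈ T, q L (cells i).card with hlam
  have hlam0 : 0 ≤ lam := Finset.sum_nonneg (fun _ _ => q_nonneg _ _)
  have hC : 0 ≤ C := hlam0.trans hG.tot
  have hfac : (0 : ℝ) < L.factorial := by positivity
  have hext : ext (∅ : Finset (Fin L × Fin L)) = Finset.univ := by simp [ext]
  set F : ℝ → ℝ := fun z => (∑ σ, z ^ cnt cells T σ) / L.factorial with hF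
  set F' : ℝ → ℝ := fun z => (∑ σ, (cnt cells T σ : ℝ) * z ^ (cnt cells T σ - 1)) / L.factorial with hF'
  have hFavg : ∀ z, avg ∅ (fun σ => z ^ cnt cells T σ) = F z := by
    intro z; simp [avg, hF, hext]
  have hder : ∀ z, HasDerivAt F (F' z) z := by
    intro z
    refine HasDerivAt.div_const ?_ _
    refine HasDerivAt.fun_sum fun σ _ => ?_
    exact hasDerivAt_pow _ _
  have hbound : ∀ z, 0 ≤ z → z ≤ 1 → |F' z - lam * F z| ≤ (C + 42 * C ^ 2) / L := by
    intro z h0 h1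
    have e1 : F' z = ∑ i ∈ T, (∑ σ ∈ ext (cells i), z ^ (cnt cells T σ - 1)) / L.factorial := by
      rw [hF', ← Finset.sum_div]
      simp only
      congr 1
      simp_rw [cnt_eq_sum, Finset.sum_mul]
      rw [Finset.sum_comm]
      refine Finset.sum_congr rfl fun i _ => ?_
      simp [← Finset.sum_filter]
    rw [e1, hlam, Finset.sum_mul, ← Finset.sum_sub_distrib]
    calc _ ≤ ∑ i ∈ T, ((∑ σ ∈ ext (cells i), (clash cells T i σ : ℝ)) / L.factorial
              + q L (cells i).card * (42 * C / L)) := by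
          refine (Finset.abs_sum_le_sum_abs _ _).trans (Finset.sum_le_sum fun i hi => ?_)
          rw [← hFavg]
          exact per_feature hG i hi h0 h1
      _ = (∑ i ∈ T, ∑ σ ∈ ext (cells i), (clash cells T i σ : ℝ)) / L.factorial
            + lam * (42 * C / L) := by
          rw [Finset.sum_add_distrib, ← Finset.sum_div, ← Finset.sum_mul]
      _ ≤ (L.factorial * (C / L)) / L.factorial + C * (42 * C / L) := by
          gcongr
          exact hG.tot
      _ = _ := by field_simp
  have hder2 : ∀ z, HasDerivAt (fun z => Real.exp (-(lam * z)) * F z)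
      (Real.exp (-(lam * z)) * (F' z - lam * F z)) z := by
    intro z
    have h1 : HasDerivAt (fun z => -(lam * z)) (-lam) z := by
      have h2 := ((hasDerivAt_id' z).const_mul lam).fun_neg
      rwa [mul_one] at h2
    have h3 := h1.exp.fun_mul (hder z)
    have e : Real.exp (-(lam * z)) * (F' z - lam * F z) =
      Real.exp (-(lam * z)) * -lam * F z + Real.exp (-(lam * z)) * F' z := by ring
    rw [e]
    exact h3
  have key := norm_image_sub_le_of_norm_deriv_le_segment_01'
    (f := fun z => Real.exp (-(lam * z)) * F z)
    (f' := fun z => Real.exp (-(lam * z)) * (F' z - lam * F z)) (C := (C + 42 * C ^ 2) / L)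
    (fun z _ => (hder2 z).hasDerivWithinAt) (by
      intro z hz
      rw [Real.norm_eq_abs, abs_mul, abs_of_pos (Real.exp_pos _)]
      have hexp : Real.exp (-(lam * z)) ≤ 1 := by
        rw [Real.exp_le_one_iff]
        have := mul_nonneg hlam0 hz.1
        linarith
      have hb := hbound z hz.1 hz.2.le
      calc _ ≤ 1 * |F' z - lam * F z| := by gcongr
        _ ≤ _ := by linarith)
  have f1 : F 1 = 1 := by
    simp [hF, Fintype.card_perm, hfac.ne']
  have f0 : F 0 = ((Finset.univ.filter (fun σ => cnt cells T σ = 0)).card : ℝ) / L.factorial := by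
    simp only [hF]
    congr 1
    simp_rw [zero_pow_eq]
    simp
  simp only [mul_one, mul_zero, neg_zero, Real.exp_zero, one_mul, f1, f0] at key
  rw [Real.norm_eq_abs, abs_sub_comm] at key
  exact key

end DCM
/-! ### Part 3: the family of loops and parallel pairs -/

namespace DCM

lemma card_ext_le' {L : ℕ} (D : Finset (Fin L × Fin L)) :
    (ext D).card ≤ (L - D.card).factorial := by
  by_cases h1 : Set.InjOn Prod.fst (D : Set (Fin L × Fin L))
  · exact card_ext_le D h1
  · have : ext D = ∅ := by
      rw [Finset.eq_empty_iff_forall_notMem]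
      intro σ hσ
      apply h1
      intro c hc c' hc' e
      rw [mem_ext] at hσ
      refine Prod.ext e ?_
      rw [← hσ c hc, ← hσ c' hc', e]
    simp [this]

lemma q_one {L : ℕ} (hL : 6 ≤ L) : q L 1 = 1 / L := by
  unfold q
  obtain ⟨k, rfl⟩ := Nat.exists_eq_add_of_le' hL
  rw [show k + 6 - 1 = k + 5 by omega, Nat.factorial_succ (k + 5)]
  push_cast
  field_simp
  ring

lemma q_two {L : ℕ} (hL : 6 ≤ L) : q L 2 = 1 / (L * (L - 1)) := by
  unfold q
  obtain ⟨k, rfl⟩ := Nat.exists_eq_add_of_le' hL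
  rw [show k + 6 - 2 = k + 4 by omega, Nat.factorial_succ (k + 5), Nat.factorial_succ (k + 4)]
  push_cast
  rw [show (k : ℝ) + 6 - 1 = k + 5 by ring]
  field_simp
  ring_nf

lemma q_add {L a b : ℕ} (hL : 6 ≤ L) (ha : a ≤ 2) (hb : b ≤ 2) :
    q L (a + b) ≤ 4 * q L a * q L b := by
  have := fact_bound hL ha hb
  have hpos : (0 : ℝ) < L.factorial := by positivity
  have h2 : ((L - (a + b)).factorial : ℝ) * L.factorial ≤
      4 * ((L - a).factorial * (L - b).factorial) := by exact_mod_cast this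
  unfold q
  rw [div_le_iff₀ hpos, ← sub_nonneg]
  rw [← sub_nonneg] at h2
  have e : 4 * (((L - a).factorial : ℝ) / L.factorial) * ((L - b).factorial / L.factorial) * L.factorial
      - (L - (a + b)).factorial = (4 * ((L - a).factorial * (L - b).factorial)
      - (L - (a + b)).factorial * L.factorial) / L.factorial := by
    field_simp
  rw [e]
  positivity

/-- cells of a feature -/
def fcells {L : ℕ} : (Fin L × Fin L) ⊕ ((Fin L × Fin L) × (Fin L × Fin L)) →
    Finset (Fin L × Fin L)
  | Sum.inl c => {c}
  | Sum.inr p => {p.1, p.2}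

noncomputable def famR {L : ℕ} (R : Fin L → Fin L → Prop) : Finset (Fin L × Fin L) :=
  Finset.univ.filter (fun c => R c.1 c.2)

noncomputable def famP {L : ℕ} (I O : Fin L → Fin L → Prop) :
    Finset ((Fin L × Fin L) × (Fin L × Fin L)) :=
  Finset.univ.filter (fun p => p.1.1 < p.2.1 ∧ I p.1.1 p.2.1 ∧ O p.1.2 p.2.2)

noncomputable def fam {L : ℕ} (R I O : Fin L → Fin L → Prop) :
    Finset ((Fin L × Fin L) ⊕ ((Fin L × Fin L) × (Fin L × Fin L))) :=
  (famR R).disjSum (famP I O)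

lemma fam_row {L : ℕ} (R I O : Fin L → Fin L → Prop) :
    ∀ i ∈ fam R I O, Set.InjOn Prod.fst (fcells i : Set (Fin L × Fin L)) := by
  intro i hi
  rcases i with c | p
  · simp [fcells]
  · simp only [fam, Finset.inr_mem_disjSum, famP, Finset.mem_filter] at hi
    have := hi.2.1.ne
    simp only [fcells, Finset.coe_insert, Finset.coe_singleton]
    rw [Set.injOn_pair]
    intro h; exact absurd h this

lemma fam_col {L : ℕ} (R I O : Fin L → Fin L → Prop) (hO : ∀ t, ¬ O t t) :
    ∀ i ∈ fam R I O, Set.InjOn Prod.snd (fcells i : Set (Fin L × Fin L)) := by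
  intro i hi
  rcases i with c | p
  · simp [fcells]
  · simp only [fam, Finset.inr_mem_disjSum, famP, Finset.mem_filter] at hi
    have := hi.2.2.2
    simp only [fcells, Finset.coe_insert, Finset.coe_singleton]
    rw [Set.injOn_pair]
    intro h; rw [h] at this; exact absurd this (hO _)

lemma fcells_inr_card {L : ℕ} {I O : Fin L → Fin L → Prop} {p} (hp : p ∈ famP I O) :
    (fcells (Sum.inr p : (Fin L × Fin L) ⊕ ((Fin L × Fin L) × (Fin L × Fin L)))).card = 2 := by
  simp only [famP, Finset.mem_filter] at hp
  apply Finset.card_pair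
  intro h
  exact hp.2.1.ne (congrArg Prod.fst h)

lemma fcells_inl_card {L : ℕ} (c : Fin L × Fin L) :
    (fcells (Sum.inl c : (Fin L × Fin L) ⊕ ((Fin L × Fin L) × (Fin L × Fin L)))).card = 1 := by
  simp [fcells]

lemma sum_fam {L : ℕ} (R I O : Fin L → Fin L → Prop)
    (f : (Fin L × Fin L) ⊕ ((Fin L × Fin L) × (Fin L × Fin L)) → ℝ) :
    ∑ i ∈ fam R I O, f i = ∑ c ∈ famR R, f (Sum.inl c) + ∑ p ∈ famP I O, f (Sum.inr p) := by
  rw [fam, Finset.sum_disjSum]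

lemma sum_fam_q {L : ℕ} (R I O : Fin L → Fin L → Prop)
    (S : (Fin L × Fin L) ⊕ ((Fin L × Fin L) × (Fin L × Fin L)) → Prop) [DecidablePred S] :
    ∑ i ∈ (fam R I O).filter S, q L (fcells i).card =
      ((famR R).filter (fun c => S (Sum.inl c))).card * q L 1 +
      ((famP I O).filter (fun p => S (Sum.inr p))).card * q L 2 := by
  rw [Finset.sum_filter, sum_fam, ← Finset.sum_filter, ← Finset.sum_filter]
  congr 1
  · simp [fcells_inl_card]
  · rw [← nsmul_eq_mul, ← Finset.sum_const]
    refine Finset.sum_congr rfl fun p hp => ?_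
    rw [fcells_inr_card (Finset.mem_filter.1 hp).1]

lemma card_famP {L : ℕ} (I O : Fin L → Fin L → Prop) (hI : ∀ t, ¬ I t t)
    (hIs : ∀ s t, I s t → I t s) :
    2 * (famP I O).card = (Finset.univ.filter (fun c : Fin L × Fin L => I c.1 c.2)).card *
      (Finset.univ.filter (fun c : Fin L × Fin L => O c.1 c.2)).card := by
  have h1 : (famP I O).card = (Finset.univ.filter (fun c : Fin L × Fin L => c.1 < c.2 ∧ I c.1 c.2)).card *
      (Finset.univ.filter (fun c : Fin L × Fin L => O c.1 c.2)).card := by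
    rw [← Finset.card_product]
    refine Finset.card_bij' (fun p _ => ((p.1.1, p.2.1), (p.1.2, p.2.2)))
      (fun p _ => ((p.1.1, p.2.1), (p.1.2, p.2.2))) ?_ ?_ ?_ ?_
    · intro p; simp [famP]; tauto
    · intro p; simp [famP]; tauto
    · intro p; simp
    · intro p; simp
  have h2 : (Finset.univ.filter (fun c : Fin L × Fin L => I c.1 c.2)).card =
      (Finset.univ.filter (fun c : Fin L × Fin L => c.1 < c.2 ∧ I c.1 c.2)).card +
      (Finset.univ.filter (fun c : Fin L × Fin L => c.2 < c.1 ∧ I c.1 c.2)).card := by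
    rw [← Finset.card_union_of_disjoint]
    · congr 1
      ext c
      simp only [Finset.mem_filter, Finset.mem_univ, true_and, Finset.mem_union]
      constructor
      · intro h
        rcases lt_trichotomy c.1 c.2 with h' | h' | h'
        · exact Or.inl ⟨h', h⟩
        · rw [h'] at h; exact absurd h (hI _)
        · exact Or.inr ⟨h', h⟩
      · tauto
    · rw [Finset.disjoint_left]
      intro c
      simp only [Finset.mem_filter, Finset.mem_univ, true_and]
      intro h h'
      exact absurd h.1 (not_lt.2 h'.1.le)
  have h3 : (Finset.univ.filter (fun c : Fin L × Fin L => c.2 < c.1 ∧ I c.1 c.2)).card =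
      (Finset.univ.filter (fun c : Fin L × Fin L => c.1 < c.2 ∧ I c.1 c.2)).card := by
    refine Finset.card_bij' (fun p _ => p.swap) (fun p _ => p.swap) ?_ ?_ ?_ ?_
    · intro p
      simp only [Finset.mem_filter, Finset.mem_univ, true_and, Prod.fst_swap, Prod.snd_swap]
      exact fun h => ⟨h.1, hIs _ _ h.2⟩
    · intro p
      simp only [Finset.mem_filter, Finset.mem_univ, true_and, Prod.fst_swap, Prod.snd_swap]
      exact fun h => ⟨h.1, hIs _ _ h.2⟩
    · intro p; simp
    · intro p; simp
  rw [h1, h2, h3]; ring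

/-- the intensity -/
lemma lam_fam {L : ℕ} (hL : 6 ≤ L) (R I O : Fin L → Fin L → Prop) (hI : ∀ t, ¬ I t t)
    (hIs : ∀ s t, I s t → I t s) :
    ∑ i ∈ fam R I O, q L (fcells i).card =
      ((Finset.univ.filter (fun c : Fin L × Fin L => R c.1 c.2)).card : ℝ) / L +
      ((Finset.univ.filter (fun c : Fin L × Fin L => I c.1 c.2)).card : ℝ) *
      ((Finset.univ.filter (fun c : Fin L × Fin L => O c.1 c.2)).card : ℝ) /
        (2 * (L * (L - 1))) := by
  have h := sum_fam_q R I O (fun _ => True)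
  simp only [Finset.filter_true] at h
  have h2 : (2 : ℝ) * (famP I O).card = ((Finset.univ.filter (fun c : Fin L × Fin L => I c.1 c.2)).card : ℝ) *
      ((Finset.univ.filter (fun c : Fin L × Fin L => O c.1 c.2)).card : ℝ) := by
    exact_mod_cast card_famP I O hI hIs
  rw [h, ← h2, q_one hL, q_two hL, famR, mul_div_mul_left _ _ (by norm_num : (2:ℝ) ≠ 0)]
  ring

structure Bdd {L : ℕ} (R I O : Fin L → Fin L → Prop) (K : ℕ) : Prop where
  I0 : ∀ s, ¬ I s s
  O0 : ∀ s, ¬ O s s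
  Is : ∀ s t, I s t → I t s
  Os : ∀ s t, O s t → O t s
  R1 : ∀ s, (Finset.univ.filter (fun t => R s t)).card ≤ K
  R2 : ∀ t, (Finset.univ.filter (fun s => R s t)).card ≤ K
  I1 : ∀ s, (Finset.univ.filter (fun t => I s t)).card ≤ K
  O1 : ∀ s, (Finset.univ.filter (fun t => O s t)).card ≤ K

lemma pair_bound {L K : ℕ} {R I O : Fin L → Fin L → Prop} (hB : Bdd R I O K)
    (A : Finset (Fin L × Fin L)) :
    ((famP I O).filter (fun p => p.1 ∈ A ∨ p.2 ∈ A)).card ≤ 2 * A.card * K ^ 2 := by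
  have hc : ∀ c : Fin L × Fin L,
      (Finset.univ.filter (fun c' : Fin L × Fin L => I c.1 c'.1 ∧ O c.2 c'.2)).card ≤ K ^ 2 := by
    intro c
    have : (Finset.univ.filter (fun c' : Fin L × Fin L => I c.1 c'.1 ∧ O c.2 c'.2)) =
        (Finset.univ.filter (fun t => I c.1 t)) ×ˢ (Finset.univ.filter (fun t => O c.2 t)) := by
      ext; simp
    rw [this, Finset.card_product, sq]
    exact Nat.mul_le_mul (hB.I1 _) (hB.O1 _)
  have hsub : (famP I O).filter (fun p => p.1 ∈ A ∨ p.2 ∈ A) ⊆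
      (A.biUnion fun c => (Finset.univ.filter (fun c' : Fin L × Fin L => I c.1 c'.1 ∧ O c.2 c'.2)).image
        (fun c' => (c, c'))) ∪
      (A.biUnion fun c => (Finset.univ.filter (fun c' : Fin L × Fin L => I c.1 c'.1 ∧ O c.2 c'.2)).image
        (fun c' => (c', c))) := by
    rintro ⟨c, c'⟩ h
    simp only [famP, Finset.mem_filter, Finset.mem_univ, true_and] at h
    rw [Finset.mem_union]
    rcases h.2 with h' | h'
    · left
      simp only [Finset.mem_biUnion, Finset.mem_image, Finset.mem_filter, Finset.mem_univ, true_and]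
      exact ⟨c, h', c', h.1.2, rfl⟩
    · right
      simp only [Finset.mem_biUnion, Finset.mem_image, Finset.mem_filter, Finset.mem_univ, true_and]
      exact ⟨c', h', c, ⟨hB.Is _ _ h.1.2.1, hB.Os _ _ h.1.2.2⟩, rfl⟩
  refine (Finset.card_le_card hsub).trans ((Finset.card_union_le _ _).trans ?_)
  have b1 := Finset.card_biUnion_le_card_mul A (fun c => (Finset.univ.filter
    (fun c' : Fin L × Fin L => I c.1 c'.1 ∧ O c.2 c'.2)).image (fun c' => (c, c'))) (K ^ 2)
    (fun c _ => Finset.card_image_le.trans (hc c))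
  have b2 := Finset.card_biUnion_le_card_mul A (fun c => (Finset.univ.filter
    (fun c' : Fin L × Fin L => I c.1 c'.1 ∧ O c.2 c'.2)).image (fun c' => (c', c))) (K ^ 2)
    (fun c _ => Finset.card_image_le.trans (hc c))
  calc _ ≤ A.card * K ^ 2 + A.card * K ^ 2 := add_le_add b1 b2
    _ = _ := by ring

lemma famR_card {L K : ℕ} {R I O : Fin L → Fin L → Prop} (hB : Bdd R I O K) :
    (famR R).card ≤ L * K := by
  have hsub : famR R ⊆ Finset.univ.biUnion (fun s : Fin L =>
      (Finset.univ.filter (fun t => R s t)).image (fun t => (s, t))) := by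
    rintro ⟨s, t⟩ h
    simp only [famR, Finset.mem_filter, Finset.mem_univ, true_and] at h
    simpa using h
  refine (Finset.card_le_card hsub).trans ?_
  have := Finset.card_biUnion_le_card_mul Finset.univ (fun s : Fin L =>
      (Finset.univ.filter (fun t => R s t)).image (fun t => (s, t))) K
      (fun s _ => Finset.card_image_le.trans (hB.R1 s))
  simpa using this

lemma famP_card {L K : ℕ} {R I O : Fin L → Fin L → Prop} (hB : Bdd R I O K) :
    (famP I O).card ≤ 2 * (L * L) * K ^ 2 := by
  have := pair_bound hB Finset.univ
  simpa using this

lemma good_fam {L K : ℕ} {R I O : Fin L → Fin L → Prop} (hB : Bdd R I O K) (hL : 6 ≤ L)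
    (hK : 1 ≤ K) : Good fcells (fam R I O) (200 * (K : ℝ) ^ 4) := by
  have hKr : (1 : ℝ) ≤ K := by exact_mod_cast hK
  have hLr : (6 : ℝ) ≤ L := by exact_mod_cast hL
  have hLpos : (0 : ℝ) < L := by linarith
  have hq1 := q_one hL
  have hq2 : q L 2 ≤ 4 / (L : ℝ) ^ 2 := by
    refine (q_add (a := 1) (b := 1) hL (by norm_num) (by norm_num)).trans (le_of_eq ?_)
    rw [hq1]; ring
  have k14 : (K : ℝ) ≤ K ^ 4 := le_self_pow₀ hKr (by norm_num)
  have k24 : (K : ℝ) ^ 2 ≤ K ^ 4 := pow_le_pow_right₀ hKr (by norm_num)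
  -- line bound
  have line : ∀ (S : (Fin L × Fin L) ⊕ ((Fin L × Fin L) × (Fin L × Fin L)) → Prop) [DecidablePred S]
      (A : Finset (Fin L × Fin L)), A.card ≤ L →
      ((famR R).filter (fun c => S (Sum.inl c))).card ≤ K →
      (∀ p, S (Sum.inr p) → p.1 ∈ A ∨ p.2 ∈ A) →
      ∑ i ∈ (fam R I O).filter S, q L (fcells i).card ≤ 200 * (K : ℝ) ^ 4 / L := by
    intro S _ A hA hR hP
    rw [sum_fam_q]
    have c2 : ((famP I O).filter (fun p => S (Sum.inr p))).card ≤ 2 * L * K ^ 2 := by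
      refine (Finset.card_le_card (Finset.monotone_filter_right _ (fun p _ => hP p))).trans ?_
      refine (pair_bound hB A).trans ?_
      gcongr
    have c2' : (((famP I O).filter (fun p => S (Sum.inr p))).card : ℝ) ≤ 2 * L * K ^ 2 := by
      exact_mod_cast c2
    have c1' : (((famR R).filter (fun c => S (Sum.inl c))).card : ℝ) ≤ K := by exact_mod_cast hR
    calc _ ≤ (K : ℝ) * (1 / L) + (2 * L * K ^ 2) * (4 / (L : ℝ) ^ 2) := by
          rw [hq1]
          gcongr
          exact q_nonneg _ _
      _ = (K + 8 * K ^ 2) / L := by field_simp; ring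
      _ ≤ _ := by gcongr; linarith
  refine ⟨hL, fam_row R I O, fam_col R I O hB.O0, ?_, ?_, ?_, ?_⟩
  · intro i hi
    rcases i with c | p
    · exact Or.inl (fcells_inl_card c)
    · simp only [fam, Finset.inr_mem_disjSum] at hi
      exact Or.inr (fcells_inr_card hi)
  · have h := sum_fam_q R I O (fun _ => True)
    simp only [Finset.filter_true] at h
    rw [h]
    have c1 : ((famR R).card : ℝ) ≤ L * K := by exact_mod_cast famR_card hB
    have c2 : ((famP I O).card : ℝ) ≤ 2 * (L * L) * K ^ 2 := by exact_mod_cast famP_card hB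
    calc _ ≤ (L * K : ℝ) * (1 / L) + (2 * (L * L) * K ^ 2) * (4 / (L : ℝ) ^ 2) := by
          rw [hq1]
          gcongr
          exact q_nonneg _ _
      _ = (K + 8 * K ^ 2) := by field_simp; ring
      _ ≤ _ := by linarith
  · intro s
    refine line (fun i => ∃ c ∈ fcells i, c.1 = s) (Finset.univ.image (fun t => (s, t))) ?_ ?_ ?_
    · refine Finset.card_image_le.trans ?_; simp
    · refine le_trans (Finset.card_le_card (t := (Finset.univ.filter (fun t => R s t)).image (fun t => (s, t))) ?_)
        (Finset.card_image_le.trans (hB.R1 s))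
      rintro ⟨a, b⟩
      simp only [famR, fcells, Finset.mem_filter, Finset.mem_univ, true_and, Finset.mem_singleton,
        exists_eq_left, Finset.mem_image]
      rintro ⟨h, rfl⟩
      exact ⟨b, h, rfl⟩
    · rintro ⟨⟨a, b⟩, ⟨a', b'⟩⟩
      simp [fcells]
      exact fun h => h.imp Eq.symm Eq.symm
  · intro t
    refine line (fun i => ∃ c ∈ fcells i, c.2 = t) (Finset.univ.image (fun s => (s, t))) ?_ ?_ ?_
    · refine Finset.card_image_le.trans ?_; simp
    · refine le_trans (Finset.card_le_card (t := (Finset.univ.filter (fun s => R s t)).image (fun s => (s, t))) ?_)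
        (Finset.card_image_le.trans (hB.R2 t))
      rintro ⟨a, b⟩
      simp only [famR, fcells, Finset.mem_filter, Finset.mem_univ, true_and, Finset.mem_singleton,
        exists_eq_left, Finset.mem_image]
      rintro ⟨h, rfl⟩
      exact ⟨a, h, rfl⟩
    · rintro ⟨⟨a, b⟩, ⟨a', b'⟩⟩
      simp [fcells]
      exact fun h => h.imp Eq.symm Eq.symm

end DCM
namespace DCM

lemma clash_sum {L : ℕ} {ι : Type*} (cells : ι → Finset (Fin L × Fin L)) (T : Finset ι) (i : ι) :
    ∑ σ ∈ ext (cells i), (clash cells T i σ : ℝ) ≤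
      ∑ j ∈ T, if (j ≠ i ∧ ∃ c ∈ cells i, c ∈ cells j) then
        ((L - (cells i ∪ cells j).card).factorial : ℝ) else 0 := by
  have h1 : ∀ σ, (clash cells T i σ : ℝ) = ∑ j ∈ T,
      if (j ≠ i ∧ σ ∈ ext (cells j) ∧ ∃ c ∈ cells j, ∃ c' ∈ cells i, c.1 = c'.1) then (1 : ℝ) else 0 := by
    intro σ; rw [clash, ← Finset.sum_filter]; simp
  simp_rw [h1]
  rw [Finset.sum_comm]
  refine Finset.sum_le_sum fun j _ => ?_
  have hstep : ∀ σ ∈ ext (cells i),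
      (j ≠ i ∧ σ ∈ ext (cells j) ∧ ∃ c ∈ cells j, ∃ c' ∈ cells i, c.1 = c'.1) →
      (j ≠ i ∧ ∃ c ∈ cells i, c ∈ cells j) ∧ σ ∈ ext (cells i ∪ cells j) := by
    rintro σ hσ ⟨hne, hσ', c, hc, c', hc', e⟩
    rw [mem_ext] at hσ hσ'
    refine ⟨⟨hne, c', hc', ?_⟩, ?_⟩
    · have : c = c' := Prod.ext e (by rw [← hσ c' hc', ← hσ' c hc, e])
      rwa [← this]
    · rw [mem_ext]
      intro c hc
      rcases Finset.mem_union.1 hc with h | h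
      exacts [hσ c h, hσ' c h]
  rw [← Finset.sum_filter]
  simp only [Finset.sum_const, nsmul_eq_mul, mul_one]
  split_ifs with h
  · have : ((ext (cells i)).filter (fun σ => j ≠ i ∧ σ ∈ ext (cells j) ∧
        ∃ c ∈ cells j, ∃ c' ∈ cells i, c.1 = c'.1)).card ≤ (L - (cells i ∪ cells j).card).factorial := by
      refine le_trans (Finset.card_le_card ?_) (card_ext_le' (cells i ∪ cells j))
      intro σ hσ
      rw [Finset.mem_filter] at hσ
      exact (hstep σ hσ.1 hσ.2).2
    exact_mod_cast this
  · rw [Finset.filter_false_of_mem]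
    · simp
    · intro σ hσ h'
      exact h (hstep σ hσ h').1

lemma famP_cells_inj {L : ℕ} {I O : Fin L → Fin L → Prop} {p p'} (hp : p ∈ famP I O)
    (hp' : p' ∈ famP I O)
    (h : fcells (Sum.inr p : (Fin L × Fin L) ⊕ ((Fin L × Fin L) × (Fin L × Fin L))) = fcells (Sum.inr p')) :
    p = p' := by
  obtain ⟨a, b⟩ := p
  obtain ⟨a', b'⟩ := p'
  simp only [famP, Finset.mem_filter, Finset.mem_univ, true_and] at hp hp'
  simp only [fcells] at h
  have ha : a ∈ ({a', b'} : Finset (Fin L × Fin L)) := by rw [← h]; simp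
  have hb : b ∈ ({a', b'} : Finset (Fin L × Fin L)) := by rw [← h]; simp
  simp only [Finset.mem_insert, Finset.mem_singleton] at ha hb
  have h1 := hp.1
  have h2 := hp'.1
  rcases ha with rfl | rfl <;> rcases hb with rfl | rfl
  · exact absurd h1 (lt_irrefl _)
  · rfl
  · exact absurd h1 (not_lt.2 h2.le)
  · exact absurd h1 (lt_irrefl _)

lemma clash_inl {L K : ℕ} {R I O : Fin L → Fin L → Prop} (hB : Bdd R I O K) (c : Fin L × Fin L) :
    ∑ σ ∈ ext (fcells (Sum.inl c)), (clash fcells (fam R I O) (Sum.inl c) σ : ℝ) ≤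
      2 * K ^ 2 * (L - 2).factorial := by
  refine (clash_sum _ _ _).trans ?_
  rw [sum_fam]
  have aux : ∀ A B X : ℝ, A = 0 → B ≤ X → A + B ≤ X := by intros; linarith
  refine aux _ _ _ (Finset.sum_eq_zero fun c' _ => ?_) ?_
  · rw [if_neg]
    simp only [fcells, Finset.mem_singleton, exists_eq_left, not_and]
    intro h e
    exact h (by rw [e])
  calc _ ≤ ∑ p ∈ famP I O, if (p.1 ∈ ({c} : Finset _) ∨ p.2 ∈ ({c} : Finset _)) then ((L - 2).factorial : ℝ) else 0 := by
        refine Finset.sum_le_sum fun p hp => ?_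
        split_ifs with h1 h2 h2
        · have : fcells (Sum.inl c) ∪ fcells (Sum.inr p) = fcells (Sum.inr p) := by
            rw [Finset.union_eq_right]
            obtain ⟨x, hx, hx'⟩ := h1.2
            simp only [fcells, Finset.mem_singleton] at hx
            rw [hx] at hx'
            simpa [fcells] using hx'
          rw [this, fcells_inr_card hp]
        · exfalso
          obtain ⟨x, hx, hx'⟩ := h1.2
          simp only [fcells, Finset.mem_singleton, Finset.mem_insert] at hx hx'
          rw [hx] at hx'
          exact h2 (by simpa [eq_comm] using hx')
        · positivity
        · exact le_rfl
    _ = ((famP I O).filter (fun p => p.1 ∈ ({c} : Finset _) ∨ p.2 ∈ ({c} : Finset _))).card *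
          ((L - 2).factorial : ℝ) := by
        rw [← Finset.sum_filter]; simp only [Finset.sum_const, nsmul_eq_mul]
    _ ≤ _ := by
        gcongr
        have := pair_bound hB {c}
        simp only [Finset.card_singleton, mul_one] at this
        exact_mod_cast this

lemma clash_inr {L K : ℕ} {R I O : Fin L → Fin L → Prop} (hB : Bdd R I O K)
    {p : (Fin L × Fin L) × (Fin L × Fin L)} (hp : p ∈ famP I O) :
    ∑ σ ∈ ext (fcells (Sum.inr p)), (clash fcells (fam R I O) (Sum.inr p) σ : ℝ) ≤
      (∑ c ∈ famR R, if (p.1 ∈ ({c} : Finset _) ∨ p.2 ∈ ({c} : Finset _)) then ((L - 2).factorial : ℝ) else 0)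
      + 4 * K ^ 2 * (L - 3).factorial := by
  refine (clash_sum _ _ _).trans ?_
  rw [sum_fam]
  refine add_le_add ?_ ?_
  · refine Finset.sum_le_sum fun c _ => ?_
    split_ifs with h1 h2 h2
    · have : fcells (Sum.inr p) ∪ fcells (Sum.inl c) = fcells (Sum.inr p) := by
        rw [Finset.union_eq_left]
        obtain ⟨x, hx, hx'⟩ := h1.2
        simp only [fcells, Finset.mem_singleton] at hx'
        rw [hx'] at hx
        simpa [fcells] using hx
      rw [this, fcells_inr_card hp]
    · exfalso
      obtain ⟨x, hx, hx'⟩ := h1.2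
      simp only [fcells, Finset.mem_singleton, Finset.mem_insert] at hx hx'
      rw [hx'] at hx
      exact h2 (by simpa [eq_comm] using hx)
    · positivity
    · exact le_rfl
  · calc _ ≤ ∑ p' ∈ famP I O, if (p'.1 ∈ ({p.1, p.2} : Finset _) ∨ p'.2 ∈ ({p.1, p.2} : Finset _)) then ((L - 3).factorial : ℝ) else 0 := by
          refine Finset.sum_le_sum fun p' hp' => ?_
          split_ifs with h1 h2 h2
          · have hcard : 3 ≤ (fcells (Sum.inr p) ∪ fcells (Sum.inr p')).card := by
              by_contra hlt
              have c1 := fcells_inr_card hp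
              have c2 := fcells_inr_card hp'
              have e1 := Finset.eq_of_subset_of_card_le
                (Finset.subset_union_left (s₁ := fcells (Sum.inr p)) (s₂ := fcells (Sum.inr p'))) (by omega)
              have e2 := Finset.eq_of_subset_of_card_le
                (Finset.subset_union_right (s₁ := fcells (Sum.inr p)) (s₂ := fcells (Sum.inr p'))) (by omega)
              apply h1.1
              rw [famP_cells_inj hp' hp (e2.trans e1.symm)]
            have : (L - (fcells (Sum.inr p) ∪ fcells (Sum.inr p')).card).factorial ≤ (L - 3).factorial :=
              Nat.factorial_le (by omega)
            exact_mod_cast this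
          · exfalso
            obtain ⟨x, hx, hx'⟩ := h1.2
            simp only [fcells] at hx hx'
            rw [Finset.mem_insert, Finset.mem_singleton] at hx'
            rcases hx' with rfl | rfl
            · exact h2 (Or.inl hx)
            · exact h2 (Or.inr hx)
          · positivity
          · exact le_rfl
      _ = ((famP I O).filter (fun p' => p'.1 ∈ ({p.1, p.2} : Finset _) ∨ p'.2 ∈ ({p.1, p.2} : Finset _))).card *
            ((L - 3).factorial : ℝ) := by
          rw [← Finset.sum_filter]; simp only [Finset.sum_const, nsmul_eq_mul]
      _ ≤ _ := by
          gcongr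
          have := pair_bound hB {p.1, p.2}
          have h2 := Finset.card_le_two (a := p.1) (b := p.2)
          have h3 : 2 * ({p.1, p.2} : Finset (Fin L × Fin L)).card * K ^ 2 ≤ 4 * K ^ 2 :=
            Nat.mul_le_mul_right _ (by omega)
          exact_mod_cast this.trans h3

lemma clash_fam {L K : ℕ} {R I O : Fin L → Fin L → Prop} (hB : Bdd R I O K) (hL : 6 ≤ L)
    (hK : 1 ≤ K) :
    ∑ i ∈ fam R I O, ∑ σ ∈ ext (fcells i), (clash fcells (fam R I O) i σ : ℝ) ≤
      L.factorial * (200 * (K : ℝ) ^ 4 / L) := by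
  have hKr : (1 : ℝ) ≤ K := by exact_mod_cast hK
  have hLr : (6 : ℝ) ≤ L := by exact_mod_cast hL
  have hLpos : (0 : ℝ) < L := by linarith
  have hfac : (0 : ℝ) < L.factorial := by positivity
  have hq1 := q_one hL
  have hq2 : q L 2 ≤ 4 / (L : ℝ) ^ 2 := by
    refine (q_add (a := 1) (b := 1) hL (by norm_num) (by norm_num)).trans (le_of_eq ?_)
    rw [hq1]; ring
  have hq3 : q L 3 ≤ 16 / (L : ℝ) ^ 3 := by
    refine (q_add (a := 1) (b := 2) hL (by norm_num) (by norm_num)).trans ?_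
    rw [hq1]
    calc 4 * (1 / (L : ℝ)) * q L 2 ≤ 4 * (1 / (L : ℝ)) * (4 / (L : ℝ) ^ 2) := by gcongr
      _ = _ := by field_simp; norm_num
  have f2 : ((L - 2).factorial : ℝ) ≤ L.factorial * (4 / (L : ℝ) ^ 2) := by
    have : ((L - 2).factorial : ℝ) = L.factorial * q L 2 := by unfold q; field_simp
    rw [this]; gcongr
  have f3 : ((L - 3).factorial : ℝ) ≤ L.factorial * (16 / (L : ℝ) ^ 3) := by
    have : ((L - 3).factorial : ℝ) = L.factorial * q L 3 := by unfold q; field_simp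
    rw [this]; gcongr
  have c1 : ((famR R).card : ℝ) ≤ L * K := by exact_mod_cast famR_card hB
  have c2 : ((famP I O).card : ℝ) ≤ 2 * (L * L) * K ^ 2 := by exact_mod_cast famP_card hB
  rw [sum_fam]
  have s1 : ∑ c ∈ famR R, ∑ σ ∈ ext (fcells (Sum.inl c)), (clash fcells (fam R I O) (Sum.inl c) σ : ℝ)
      ≤ (L * K) * (2 * K ^ 2 * (L - 2).factorial) := by
    refine (Finset.sum_le_sum fun c _ => clash_inl hB c).trans ?_
    rw [Finset.sum_const, nsmul_eq_mul]
    gcongr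
  have s2 : ∑ p ∈ famP I O, ∑ σ ∈ ext (fcells (Sum.inr p)), (clash fcells (fam R I O) (Sum.inr p) σ : ℝ)
      ≤ (L * K) * (2 * K ^ 2 * (L - 2).factorial) +
        (2 * (L * L) * K ^ 2) * (4 * K ^ 2 * (L - 3).factorial) := by
    refine (Finset.sum_le_sum fun p hp => clash_inr hB hp).trans ?_
    rw [Finset.sum_add_distrib]
    refine add_le_add ?_ ?_
    · rw [Finset.sum_comm]
      calc _ ≤ ∑ c ∈ famR R, (2 * K ^ 2 * (L - 2).factorial : ℝ) := by
            refine Finset.sum_le_sum fun c _ => ?_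
            rw [← Finset.sum_filter]
            simp only [Finset.sum_const, nsmul_eq_mul]
            gcongr
            have := pair_bound hB {c}
            simp only [Finset.card_singleton, mul_one] at this
            exact_mod_cast this
        _ ≤ _ := by
            rw [Finset.sum_const, nsmul_eq_mul]
            gcongr
    · rw [Finset.sum_const, nsmul_eq_mul]
      gcongr
  have k34 : (K : ℝ) ^ 3 ≤ K ^ 4 := pow_le_pow_right₀ hKr (by norm_num)
  have k4 : (0 : ℝ) ≤ (K : ℝ) ^ 4 := by positivity
  calc _ ≤ _ := add_le_add s1 s2
    _ ≤ (L * K) * (2 * K ^ 2 * (L.factorial * (4 / (L : ℝ) ^ 2))) + ((L * K) * (2 * K ^ 2 * (L.factorial * (4 / (L : ℝ) ^ 2))) +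
        (2 * (L * L) * K ^ 2) * (4 * K ^ 2 * (L.factorial * (16 / (L : ℝ) ^ 3)))) := by
        gcongr
    _ = L.factorial * ((16 * K ^ 3 + 128 * K ^ 4) / L) := by field_simp; ring
    _ ≤ _ := by gcongr; linarith

/-- quantitative Poisson approximation for bounded relations -/
theorem poisson_fam {L K : ℕ} {R I O : Fin L → Fin L → Prop} (hB : Bdd R I O K) (hL : 6 ≤ L)
    (hK : 1 ≤ K) :
    |((Finset.univ.filter (fun σ => cnt fcells (fam R I O) σ = 0)).card : ℝ) / L.factorial
      - Real.exp (-(∑ i ∈ fam R I O, q L (fcells i).card))| ≤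
      (200 * (K : ℝ) ^ 4 + 42 * (200 * (K : ℝ) ^ 4) ^ 2) / L :=
  poisson_abs (good_fam hB hL hK) (clash_fam hB hL hK)

lemma cnt_fam_zero {L : ℕ} (R I O : Fin L → Fin L → Prop) (σ : Equiv.Perm (Fin L)) :
    cnt fcells (fam R I O) σ = 0 ↔
      (∀ s, ¬ R s (σ s)) ∧ (∀ s s', s < s' → I s s' → ¬ O (σ s) (σ s')) := by
  unfold cnt
  rw [Finset.card_eq_zero, Finset.filter_eq_empty_iff]
  constructor
  · intro h
    constructor
    · intro s hs
      refine h (x := Sum.inl (s, σ s)) ?_ ?_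
      · simpa [fam, famR] using hs
      · simp [mem_ext, fcells]
    · intro s s' hlt hI hO
      refine h (x := Sum.inr ((s, σ s), (s', σ s'))) ?_ ?_
      · simp [fam, famP]; exact ⟨hlt, hI, hO⟩
      · simp [mem_ext, fcells]
  · rintro ⟨h1, h2⟩ i hi
    rcases i with ⟨s, t⟩ | ⟨⟨s, t⟩, ⟨s', t'⟩⟩
    · simp only [fam, famR, Finset.inl_mem_disjSum, Finset.mem_filter, Finset.mem_univ, true_and] at hi
      simp only [mem_ext, fcells, Finset.mem_singleton, forall_eq]
      rintro rfl
      exact h1 s hi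
    · simp only [fam, famP, Finset.inr_mem_disjSum, Finset.mem_filter, Finset.mem_univ, true_and] at hi
      simp only [mem_ext, fcells, Finset.mem_insert, Finset.mem_singleton, forall_eq_or_imp, forall_eq]
      rintro ⟨rfl, rfl⟩
      exact h2 s s' hi.1 hi.2.1 hi.2.2

lemma fam_mono {L : ℕ} {R I O R' I' O' : Fin L → Fin L → Prop} (hR : ∀ s t, R s t → R' s t)
    (hI : ∀ s t, I s t → I' s t) (hO : ∀ s t, O s t → O' s t) : fam R I O ⊆ fam R' I' O' := by
  apply Finset.disjSum_mono
  · intro c; simp only [famR, Finset.mem_filter]; exact fun h => ⟨h.1, hR _ _ h.2⟩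
  · intro c; simp only [famP, Finset.mem_filter]
    exact fun h => ⟨h.1, h.2.1, hI _ _ h.2.2.1, hO _ _ h.2.2.2⟩

/-- comparison of two families -/
lemma fam_compare {L : ℕ} {R I O R' I' O' : Fin L → Fin L → Prop} (hR : ∀ s t, R s t → R' s t)
    (hI : ∀ s t, I s t → I' s t) (hO : ∀ s t, O s t → O' s t) (hO0 : ∀ s, ¬ O' s s) :
    |((Finset.univ.filter (fun σ => cnt fcells (fam R' I' O') σ = 0)).card : ℝ) / L.factorial
      - ((Finset.univ.filter (fun σ => cnt fcells (fam R I O) σ = 0)).card : ℝ) / L.factorial| ≤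
      ∑ i ∈ fam R' I' O', q L (fcells i).card - ∑ i ∈ fam R I O, q L (fcells i).card := by
  have hsub := fam_mono hR hI hO
  have hfac : (0 : ℝ) < L.factorial := by positivity
  have e1 := sum_cnt_univ fcells (fam R' I' O') (fam_row _ _ _) (fam_col _ _ _ hO0)
  have e2 := sum_cnt_univ fcells (fam R I O) (fam_row _ _ _)
    (fam_col _ _ _ (fun s h => hO0 s (hO _ _ h)))
  rw [← sub_div, abs_div, abs_of_pos hfac, div_le_iff₀ hfac, sub_mul, mul_comm _ (L.factorial : ℝ),
    mul_comm _ (L.factorial : ℝ), ← e1, ← e2, Finset.card_filter, Finset.card_filter]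
  push_cast
  rw [← Finset.sum_sub_distrib, ← Finset.sum_sub_distrib]
  refine (Finset.abs_sum_le_sum_abs _ _).trans (Finset.sum_le_sum fun σ _ => ?_)
  have hle : cnt fcells (fam R I O) σ ≤ cnt fcells (fam R' I' O') σ :=
    Finset.card_le_card (Finset.filter_subset_filter _ hsub)
  generalize cnt fcells (fam R I O) σ = x at *
  generalize cnt fcells (fam R' I' O') σ = y at *
  have hle' : (x : ℝ) ≤ y := by exact_mod_cast hle
  split_ifs with h1 h2 h2
  · simp [hle']
  · omega
  · subst h2
    have : (1 : ℝ) ≤ y := by exact_mod_cast Nat.one_le_iff_ne_zero.2 h1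
    simpa using this
  · simp [hle']

end DCM
namespace DCM

def RR {n L : ℕ} (a b : Fin L → Fin n) (low : Fin n → Prop) (s t : Fin L) : Prop :=
  a s = b t ∧ low (a s)

def II {n L : ℕ} (a : Fin L → Fin n) (low : Fin n → Prop) (s t : Fin L) : Prop :=
  s ≠ t ∧ a s = a t ∧ low (a s)

lemma sum_fib {n L : ℕ} (a : Fin L → Fin n) (m : Fin n → ℕ)
    (ha : ∀ v, (Finset.univ.filter (fun s => a s = v)).card = m v) (g : Fin n → ℝ) :
    ∑ s, g (a s) = ∑ v, (m v : ℝ) * g v := by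
  rw [← Finset.sum_fiberwise Finset.univ a (fun s => g (a s))]
  refine Finset.sum_congr rfl fun v _ => ?_
  rw [Finset.sum_congr rfl (g := fun _ => g v)]
  · rw [Finset.sum_const, nsmul_eq_mul, ← ha v]
  · intro s hs
    rw [(Finset.mem_filter.1 hs).2]

lemma card_prod {L : ℕ} (R : Fin L → Fin L → Prop) :
    ((Finset.univ.filter (fun c : Fin L × Fin L => R c.1 c.2)).card : ℝ) =
      ∑ s, ((Finset.univ.filter (fun t => R s t)).card : ℝ) := by
  rw [Finset.card_filter]
  push_cast
  rw [Fintype.sum_prod_type]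
  refine Finset.sum_congr rfl fun s _ => ?_
  rw [Finset.card_filter]
  push_cast
  rfl

lemma RR_row {n L : ℕ} (a b : Fin L → Fin n) (d : Fin n → ℕ) (low : Fin n → Prop)
    (hb : ∀ v, (Finset.univ.filter (fun s => b s = v)).card = d v) (s : Fin L) :
    (Finset.univ.filter (fun t => RR a b low s t)).card = if low (a s) then d (a s) else 0 := by
  split_ifs with h
  · rw [← hb]
    congr 1
    ext t
    simp [RR, h, eq_comm]
  · rw [Finset.card_eq_zero, Finset.filter_eq_empty_iff]
    intro t _ ht
    exact h ht.2

lemma RR_col {n L : ℕ} (a b : Fin L → Fin n) (m : Fin n → ℕ) (low : Fin n → Prop)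
    (ha : ∀ v, (Finset.univ.filter (fun s => a s = v)).card = m v) (t : Fin L) :
    (Finset.univ.filter (fun s => RR a b low s t)).card = if low (b t) then m (b t) else 0 := by
  split_ifs with h
  · rw [← ha]
    congr 1
    ext s
    simp only [Finset.mem_filter, Finset.mem_univ, true_and]
    exact ⟨fun h => h.1, fun e => ⟨e, e ▸ h⟩⟩
  · rw [Finset.card_eq_zero, Finset.filter_eq_empty_iff]
    intro s _ ht
    exact h (ht.1 ▸ ht.2)

lemma II_row {n L : ℕ} (a : Fin L → Fin n) (m : Fin n → ℕ) (low : Fin n → Prop)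
    (ha : ∀ v, (Finset.univ.filter (fun s => a s = v)).card = m v) (s : Fin L) :
    (Finset.univ.filter (fun t => II a low s t)).card = if low (a s) then m (a s) - 1 else 0 := by
  split_ifs with h
  · rw [← ha, ← Finset.card_erase_of_mem (a := s) (by simp)]
    congr 1
    ext t
    simp only [Finset.mem_filter, Finset.mem_univ, true_and, Finset.mem_erase]
    exact ⟨fun h => ⟨h.1.symm, h.2.1.symm⟩, fun e => ⟨e.1.symm, e.2.symm, h⟩⟩
  · rw [Finset.card_eq_zero, Finset.filter_eq_empty_iff]
    intro t _ ht
    exact h ht.2.2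

lemma RR_card {n L : ℕ} (a b : Fin L → Fin n) (m d : Fin n → ℕ) (low : Fin n → Prop)
    (ha : ∀ v, (Finset.univ.filter (fun s => a s = v)).card = m v)
    (hb : ∀ v, (Finset.univ.filter (fun s => b s = v)).card = d v) :
    ((Finset.univ.filter (fun c : Fin L × Fin L => RR a b low c.1 c.2)).card : ℝ) =
      ∑ v, if low v then (m v : ℝ) * d v else 0 := by
  rw [card_prod]
  simp_rw [RR_row a b d low hb]
  rw [sum_fib a m ha (fun v => (((if low v then d v else 0 : ℕ)) : ℝ))]
  refine Finset.sum_congr rfl fun v _ => ?_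
  split_ifs <;> simp

lemma II_card {n L : ℕ} (a : Fin L → Fin n) (m : Fin n → ℕ) (low : Fin n → Prop)
    (ha : ∀ v, (Finset.univ.filter (fun s => a s = v)).card = m v) :
    ((Finset.univ.filter (fun c : Fin L × Fin L => II a low c.1 c.2)).card : ℝ) =
      ∑ v, if low v then (m v : ℝ) * ((m v : ℝ) - 1) else 0 := by
  rw [card_prod]
  simp_rw [II_row a m low ha]
  rw [sum_fib a m ha (fun v => (((if low v then m v - 1 else 0 : ℕ)) : ℝ))]
  refine Finset.sum_congr rfl fun v _ => ?_
  split_ifs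
  · rcases Nat.eq_zero_or_pos (m v) with h | h
    · simp [h]
    · rw [Nat.cast_sub h]; simp
  · simp

lemma bdd_low {n L K : ℕ} (a b : Fin L → Fin n) (m d : Fin n → ℕ) (low : Fin n → Prop)
    (ha : ∀ v, (Finset.univ.filter (fun s => a s = v)).card = m v)
    (hb : ∀ v, (Finset.univ.filter (fun s => b s = v)).card = d v)
    (hlow : ∀ v, low v → m v ≤ K ∧ d v ≤ K) :
    Bdd (RR a b low) (II a low) (II b low) K where
  I0 := fun s h => h.1 rfl
  O0 := fun s h => h.1 rfl
  Is := fun s t h => ⟨h.1.symm, h.2.1.symm, h.2.1 ▸ h.2.2⟩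
  Os := fun s t h => ⟨h.1.symm, h.2.1.symm, h.2.1 ▸ h.2.2⟩
  R1 := fun s => by
    rw [RR_row a b d low hb]
    split_ifs with h
    exacts [(hlow _ h).2, Nat.zero_le _]
  R2 := fun s => by
    rw [RR_col a b m low ha]
    split_ifs with h
    exacts [(hlow _ h).1, Nat.zero_le _]
  I1 := fun s => by
    rw [II_row a m low ha]
    split_ifs with h
    exacts [(Nat.sub_le _ _).trans (hlow _ h).1, Nat.zero_le _]
  O1 := fun s => by
    rw [II_row b d low hb]
    split_ifs with h
    exacts [(Nat.sub_le _ _).trans (hlow _ h).2, Nat.zero_le _]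

noncomputable def lamb {n : ℕ} (L : ℕ) (m d : Fin n → ℕ) (low : Fin n → Prop) : ℝ :=
  (∑ v, if low v then (m v : ℝ) * d v else 0) / L +
    (∑ v, if low v then (m v : ℝ) * ((m v : ℝ) - 1) else 0) *
    (∑ v, if low v then (d v : ℝ) * ((d v : ℝ) - 1) else 0) / (2 * (L * (L - 1)))

lemma lam_eq {n L : ℕ} (hL : 6 ≤ L) (a b : Fin L → Fin n) (m d : Fin n → ℕ) (low : Fin n → Prop)
    (ha : ∀ v, (Finset.univ.filter (fun s => a s = v)).card = m v)
    (hb : ∀ v, (Finset.univ.filter (fun s => b s = v)).card = d v) :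
    ∑ i ∈ fam (RR a b low) (II a low) (II b low), q L (fcells i).card = lamb L m d low := by
  rw [lam_fam hL _ _ _ (fun s h => h.1 rfl) (fun s t h => ⟨h.1.symm, h.2.1.symm, h.2.1 ▸ h.2.2⟩),
    RR_card a b m d low ha hb, II_card a m low ha, II_card b d low hb, lamb]

lemma simple_iff {n L : ℕ} (a b : Fin L → Fin n) (σ : Equiv.Perm (Fin L)) :
    (selfLoops n L a b σ = 0 ∧ multiEdges n L a b σ = 0) ↔
      cnt fcells (fam (RR a b fun _ => True) (II a fun _ => True) (II b fun _ => True)) σ = 0 := by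
  rw [cnt_fam_zero]
  have h1 : selfLoops n L a b σ = 0 ↔ ∀ s, ¬ RR a b (fun _ => True) s (σ s) := by
    rw [selfLoops, Finset.card_eq_zero, Finset.filter_eq_empty_iff]
    simp [RR]
  rw [h1]
  refine and_congr_right fun hl => ?_
  have hl' : ∀ s, a s ≠ b (σ s) := fun s h => hl s ⟨h, trivial⟩
  unfold multiEdges
  simp only [Finset.sum_eq_zero_iff, Finset.mem_univ, true_imp_iff]
  constructor
  · intro h s s' hlt hI hO
    have := h (b (σ s)) (a s)
    rw [if_pos (hl' s).symm] at this
    have hc : 1 < edgeCount n L a b σ (b (σ s)) (a s) := by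
      rw [edgeCount, Finset.one_lt_card]
      refine ⟨s, by simp, s', ?_, hlt.ne⟩
      simp only [Finset.mem_filter, Finset.mem_univ, true_and]
      exact ⟨hO.2.1.symm, hI.2.1.symm⟩
    omega
  · intro h u v
    split_ifs with huv
    · have hc : edgeCount n L a b σ u v ≤ 1 := by
        rw [edgeCount, Finset.card_le_one]
        intro s hs s' hs'
        simp only [Finset.mem_filter, Finset.mem_univ, true_and] at hs hs'
        by_contra hne
        rcases lt_or_gt_of_ne hne with hlt | hlt
        · exact h s s' hlt ⟨hne, hs.2.trans hs'.2.symm, trivial⟩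
            ⟨fun e => hne (σ.injective e), hs.1.trans hs'.1.symm, trivial⟩
        · exact h s' s hlt ⟨fun e => hne e.symm, hs'.2.trans hs.2.symm, trivial⟩
            ⟨fun e => hne (σ.injective e).symm, hs'.1.trans hs.1.symm, trivial⟩
      omega
    · rfl

theorem main_n {n L K : ℕ} (hL : 6 ≤ L) (hK : 1 ≤ K) (a b : Fin L → Fin n) (m d : Fin n → ℕ)
    (low : Fin n → Prop)
    (ha : ∀ v, (Finset.univ.filter (fun s => a s = v)).card = m v)
    (hb : ∀ v, (Finset.univ.filter (fun s => b s = v)).card = d v)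
    (hlow : ∀ v, low v → m v ≤ K ∧ d v ≤ K) :
    |probUnif L (Finset.univ.filter (fun σ : Equiv.Perm (Fin L) =>
            selfLoops n L a b σ = 0 ∧ multiEdges n L a b σ = 0)) -
      Real.exp (-(lamb L m d low))| ≤ (lamb L m d (fun _ => True) - lamb L m d low) +
        (200 * (K : ℝ) ^ 4 + 42 * (200 * (K : ℝ) ^ 4) ^ 2) / L := by
  have e := poisson_fam (bdd_low (K := K) a b m d low ha hb hlow) hL hK
  have c := fam_compare (R := RR a b low) (I := II a low) (O := II b low)
    (R' := RR a b fun _ => True) (I' := II a fun _ => True) (O' := II b fun _ => True)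
    (fun s t h => ⟨h.1, trivial⟩) (fun s t h => ⟨h.1, h.2.1, trivial⟩)
    (fun s t h => ⟨h.1, h.2.1, trivial⟩) (fun s h => h.1 rfl)
  rw [lam_eq hL a b m d _ ha hb] at e
  rw [lam_eq hL a b m d _ ha hb, lam_eq hL a b m d _ ha hb] at c
  have hp : probUnif L (Finset.univ.filter (fun σ : Equiv.Perm (Fin L) =>
            selfLoops n L a b σ = 0 ∧ multiEdges n L a b σ = 0)) =
      ((Finset.univ.filter (fun σ => cnt fcells (fam (RR a b fun _ => True) (II a fun _ => True)
        (II b fun _ => True)) σ = 0)).card : ℝ) / L.factorial := by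
    unfold probUnif
    congr 3
    ext σ
    simp only [Finset.mem_filter, Finset.mem_univ, true_and]
    exact simple_iff a b σ
  rw [hp]
  exact (abs_sub_le _ _ _).trans (add_le_add c e)

end DCM
namespace DCM

lemma ite_sum (K x y : ℕ) (g : ℕ → ℕ → ℝ) :
    (if x ≤ K ∧ y ≤ K then g x y else 0) =
      ∑ i ∈ Finset.range (K + 1), ∑ j ∈ Finset.range (K + 1), if x = i ∧ y = j then g i j else 0 := by
  have h1 : ∀ i ∈ Finset.range (K + 1), (∑ j ∈ Finset.range (K + 1), if x = i ∧ y = j then g i j else 0)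
      = if x = i then (if y ≤ K then g x y else 0) else 0 := by
    intro i _
    split_ifs with h h2
    · subst h
      simp only [true_and, Finset.sum_ite_eq, Finset.mem_range]
      rw [if_pos (by omega)]
    · subst h
      simp only [true_and, Finset.sum_ite_eq, Finset.mem_range]
      rw [if_neg (by omega)]
    · simp [h]
  rw [Finset.sum_congr rfl h1, Finset.sum_ite_eq]
  simp only [Finset.mem_range, Nat.lt_succ_iff]
  by_cases hx : x ≤ K <;> by_cases hy : y ≤ K <;> simp [hx, hy]

lemma tend_low {Ω : Type*} [MeasurableSpace Ω] (P : Measure Ω) [IsProbabilityMeasure P]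
    (γ ξ : Ω → ℕ) (hγ : Measurable γ) (hξ : Measurable ξ)
    (m d : (n : ℕ) → Fin n → ℕ)
    (hjoint : ∀ i j : ℕ,
      Tendsto (fun n => ((Finset.univ.filter (fun k : Fin n => m n k = i ∧ d n k = j)).card : ℝ) / n)
        atTop (nhds (P {ω | γ ω = i ∧ ξ ω = j}).toReal)) (K : ℕ) (g : ℕ → ℕ → ℝ) :
    Tendsto (fun n => (∑ v, if m n v ≤ K ∧ d n v ≤ K then g (m n v) (d n v) else 0) / (n : ℝ)) atTop
      (nhds (∫ ω, (if γ ω ≤ K ∧ ξ ω ≤ K then g (γ ω) (ξ ω) else 0) ∂P)) := by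
  have hms : ∀ i j : ℕ, MeasurableSet {ω | γ ω = i ∧ ξ ω = j} := fun i j =>
    (hγ (measurableSet_singleton i)).inter (hξ (measurableSet_singleton j))
  have hind : ∀ i j : ℕ, (fun ω => if γ ω = i ∧ ξ ω = j then g i j else 0) =
      Set.indicator {ω | γ ω = i ∧ ξ ω = j} (fun _ => g i j) := by
    intro i j; funext ω; simp [Set.indicator]
  have hint : ∀ i j : ℕ, Integrable (fun ω => if γ ω = i ∧ ξ ω = j then g i j else 0) P := by
    intro i j
    rw [hind]
    exact (integrable_const _).indicator (hms i j)
  have hI : (∫ ω, (if γ ω ≤ K ∧ ξ ω ≤ K then g (γ ω) (ξ ω) else 0) ∂P) =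
      ∑ i ∈ Finset.range (K + 1), ∑ j ∈ Finset.range (K + 1),
        (P {ω | γ ω = i ∧ ξ ω = j}).toReal * g i j := by
    simp_rw [ite_sum]
    rw [integral_finsetSum _ (fun i _ => integrable_finsetSum _ (fun j _ => hint i j))]
    refine Finset.sum_congr rfl fun i _ => ?_
    rw [integral_finsetSum _ (fun j _ => hint i j)]
    refine Finset.sum_congr rfl fun j _ => ?_
    rw [hind, integral_indicator_const _ (hms i j)]
    rfl
  have hS : (fun n => (∑ v, if m n v ≤ K ∧ d n v ≤ K then g (m n v) (d n v) else 0) / (n : ℝ)) =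
      fun n : ℕ => ∑ i ∈ Finset.range (K + 1), ∑ j ∈ Finset.range (K + 1),
        ((Finset.univ.filter (fun k : Fin n => m n k = i ∧ d n k = j)).card : ℝ) / n * g i j := by
    funext n
    simp_rw [ite_sum]
    rw [Finset.sum_comm, Finset.sum_div]
    refine Finset.sum_congr rfl fun i _ => ?_
    rw [Finset.sum_comm, Finset.sum_div]
    refine Finset.sum_congr rfl fun j _ => ?_
    rw [← Finset.sum_filter, Finset.sum_const, nsmul_eq_mul]
    ring
  rw [hI, hS]
  exact tendsto_finsetSum _ fun i _ => tendsto_finsetSum _ fun j _ => (hjoint i j).mul_const _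

lemma tend_K {Ω : Type*} [MeasurableSpace Ω] (P : Measure Ω)
    (γ ξ : Ω → ℕ) (hγ : Measurable γ) (hξ : Measurable ξ) (g : ℕ → ℕ → ℝ)
    (hg : Integrable (fun ω => g (γ ω) (ξ ω)) P) :
    Tendsto (fun K : ℕ => ∫ ω, (if γ ω ≤ K ∧ ξ ω ≤ K then g (γ ω) (ξ ω) else 0) ∂P) atTop
      (nhds (∫ ω, g (γ ω) (ξ ω) ∂P)) := by
  refine tendsto_integral_of_dominated_convergence (fun ω => ‖g (γ ω) (ξ ω)‖) ?_ hg.norm ?_ ?_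
  · intro K
    have : Measurable (fun p : ℕ × ℕ => if p.1 ≤ K ∧ p.2 ≤ K then g p.1 p.2 else 0) :=
      measurable_of_countable _
    exact (this.comp (hγ.prodMk hξ)).aestronglyMeasurable
  · intro K
    refine Eventually.of_forall fun ω => ?_
    split_ifs
    · exact le_rfl
    · simp
  · refine Eventually.of_forall fun ω => ?_
    refine tendsto_const_nhds.congr' ?_
    filter_upwards [eventually_ge_atTop (max (γ ω) (ξ ω))] with K hK
    rw [if_pos ⟨(le_max_left _ _).trans hK, (le_max_right _ _).trans hK⟩]

lemma tend_lamb (m d : (n : ℕ) → Fin n → ℕ) (l : ℕ → ℕ) (μ : ℝ) (hμ : 0 < μ)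
    (hl : Tendsto (fun n => (l n : ℝ) / n) atTop (nhds μ))
    (hlinf : Tendsto (fun n => (l n : ℝ)) atTop atTop)
    (low : (n : ℕ) → Fin n → Prop) (A B C : ℝ)
    (hA : Tendsto (fun n => (∑ v, if low n v then (m n v : ℝ) * d n v else 0) / (n : ℝ)) atTop (nhds A))
    (hB : Tendsto (fun n => (∑ v, if low n v then (m n v : ℝ) * ((m n v : ℝ) - 1) else 0) / (n : ℝ))
      atTop (nhds B))
    (hC : Tendsto (fun n => (∑ v, if low n v then (d n v : ℝ) * ((d n v : ℝ) - 1) else 0) / (n : ℝ))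
      atTop (nhds C)) :
    Tendsto (fun n => lamb (l n) (m n) (d n) (low n)) atTop (nhds (A / μ + B * C / (2 * μ ^ 2))) := by
  have hl1 : Tendsto (fun n => ((l n : ℝ) - 1) / n) atTop (nhds μ) := by
    have h0 : Tendsto (fun n : ℕ => (1 : ℝ) / n) atTop (nhds 0) := tendsto_one_div_atTop_nhds_zero_nat
    have := hl.sub h0
    simp only [sub_zero] at this
    exact this.congr fun n => by rw [sub_div]
  have h := (hA.div hl hμ.ne').add ((hB.mul hC).div ((hl.mul hl1).const_mul 2)
    (by positivity : (2 : ℝ) * (μ * μ) ≠ 0))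
  rw [show A / μ + B * C / (2 * μ ^ 2) = A / μ + B * C / (2 * (μ * μ)) by ring]
  refine h.congr' ?_
  filter_upwards [eventually_gt_atTop 0, hlinf.eventually_gt_atTop 1] with n hn hln
  have hn' : (n : ℝ) ≠ 0 := by positivity
  have h1 : (l n : ℝ) ≠ 0 := by positivity
  have h2 : (l n : ℝ) - 1 ≠ 0 := by linarith [hln] |> fun (h : (0 : ℝ) < l n - 1) => h.ne'
  simp only [Pi.div_apply, Pi.mul_apply, lamb]
  congr 1
  · field_simp
  · field_simp

end DCM
namespace DCM

lemma eps_arg (p lf : ℕ → ℝ) (lk : ℕ → ℕ → ℝ) (L : ℝ) (LK : ℕ → ℝ) (e : ℕ → ℕ → ℝ)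
    (hlf : Tendsto lf atTop (nhds L)) (hlk : ∀ K, Tendsto (lk K) atTop (nhds (LK K)))
    (hLK : Tendsto LK atTop (nhds L)) (he : ∀ K, Tendsto (e K) atTop (nhds 0))
    (hb : ∀ K, 1 ≤ K → ∀ᶠ n in atTop, |p n - Real.exp (-(lk K n))| ≤ (lf n - lk K n) + e K n) :
    Tendsto p atTop (nhds (Real.exp (-L))) := by
  rw [Metric.tendsto_nhds]
  intro ε hε
  have h1 : Tendsto (fun K => (L - LK K) + |Real.exp (-(LK K)) - Real.exp (-L)|) atTop (nhds 0) := by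
    have hexp : Tendsto (fun K => Real.exp (-(LK K))) atTop (nhds (Real.exp (-L))) :=
      (Real.continuous_exp.tendsto _).comp hLK.neg
    have := (hLK.const_sub L).add (hexp.sub_const (Real.exp (-L))).abs
    simpa using this
  obtain ⟨K, hK, hK1⟩ := ((h1.eventually_lt_const hε).and (eventually_ge_atTop 1)).exists
  have h2 : Tendsto (fun n => (lf n - lk K n) + e K n + |Real.exp (-(lk K n)) - Real.exp (-L)|) atTop
      (nhds ((L - LK K) + 0 + |Real.exp (-(LK K)) - Real.exp (-L)|)) := by
    have hexp : Tendsto (fun n => Real.exp (-(lk K n))) atTop (nhds (Real.exp (-(LK K)))) :=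
      (Real.continuous_exp.tendsto _).comp (hlk K).neg
    exact ((hlf.sub (hlk K)).add (he K)).add (hexp.sub_const _).abs
  rw [add_zero] at h2
  filter_upwards [h2.eventually_lt_const hK, hb K hK1] with n hn hbn
  rw [Real.dist_eq]
  have := abs_sub_le (p n) (Real.exp (-(lk K n))) (Real.exp (-L))
  linarith

end DCM

/-- Under the regularity conditions (weak convergence of the empirical in/out-degree
distribution to `(γ, ξ)` with `E[γ] = E[ξ] = μ > 0`, and convergence of first moments,
covariance and second moments), the probability that the directed configuration model
produces a simple graph converges to `e^{-λ₁-λ₂} > 0`, where `λ₁ = E[γξ]/μ` and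
`λ₂ = E[γ(γ-1)]E[ξ(ξ-1)]/(2μ²)`. -/
theorem stmt12
    {Ω : Type*} [MeasurableSpace Ω] (P : Measure Ω) [IsProbabilityMeasure P]
    (γ ξ : Ω → ℕ) (hγ : Measurable γ) (hξ : Measurable ξ)
    (μ : ℝ) (hμ : 0 < μ)
    (hintγ : Integrable (fun ω => (γ ω : ℝ)) P)
    (hintξ : Integrable (fun ω => (ξ ω : ℝ)) P)
    (hintγ2 : Integrable (fun ω => (γ ω : ℝ) ^ 2) P)
    (hintξ2 : Integrable (fun ω => (ξ ω : ℝ) ^ 2) P)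
    (hintprod : Integrable (fun ω => (γ ω : ℝ) * (ξ ω : ℝ)) P)
    (hEγ : ∫ ω, (γ ω : ℝ) ∂P = μ) (hEξ : ∫ ω, (ξ ω : ℝ) ∂P = μ)
    (m d : (n : ℕ) → Fin n → ℕ) (l : ℕ → ℕ)
    (hm : ∀ n, ∑ i, m n i = l n) (hd : ∀ n, ∑ i, d n i = l n)
    (vIn vOut : (n : ℕ) → Fin (l n) → Fin n)
    (hvIn : ∀ n (v : Fin n), (Finset.univ.filter (fun s => vIn n s = v)).card = m n v)
    (hvOut : ∀ n (v : Fin n), (Finset.univ.filter (fun s => vOut n s = v)).card = d n v)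
    (hjoint : ∀ i j : ℕ,
      Tendsto (fun n => ((Finset.univ.filter (fun k : Fin n => m n k = i ∧ d n k = j)).card : ℝ) / n)
        atTop (nhds (P {ω | γ ω = i ∧ ξ ω = j}).toReal))
    (hm1 : Tendsto (fun n => (∑ k, (m n k : ℝ)) / n) atTop (nhds μ))
    (hd1 : Tendsto (fun n => (∑ k, (d n k : ℝ)) / n) atTop (nhds μ))
    (hcov : Tendsto (fun n => (∑ k, (m n k : ℝ) * (d n k : ℝ)) / n) atTop
      (nhds (∫ ω, (γ ω : ℝ) * (ξ ω : ℝ) ∂P)))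
    (hm2 : Tendsto (fun n => (∑ k, (m n k : ℝ) ^ 2) / n) atTop
      (nhds (∫ ω, (γ ω : ℝ) ^ 2 ∂P)))
    (hd2 : Tendsto (fun n => (∑ k, (d n k : ℝ) ^ 2) / n) atTop
      (nhds (∫ ω, (ξ ω : ℝ) ^ 2 ∂P))) :
    Tendsto
      (fun n =>
        probUnif (l n)
          (Finset.univ.filter (fun σ : Equiv.Perm (Fin (l n)) =>
            selfLoops n (l n) (vIn n) (vOut n) σ = 0
              ∧ multiEdges n (l n) (vIn n) (vOut n) σ = 0)))
      atTop
      (nhds (Real.exp (-((∫ ω, (γ ω : ℝ) * (ξ ω : ℝ) ∂P) / μ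
        + (∫ ω, (γ ω : ℝ) * ((γ ω : ℝ) - 1) ∂P)
          * (∫ ω, (ξ ω : ℝ) * ((ξ ω : ℝ) - 1) ∂P) / (2 * μ ^ 2)))))
    ∧ 0 < Real.exp (-((∫ ω, (γ ω : ℝ) * (ξ ω : ℝ) ∂P) / μ
        + (∫ ω, (γ ω : ℝ) * ((γ ω : ℝ) - 1) ∂P)
          * (∫ ω, (ξ ω : ℝ) * ((ξ ω : ℝ) - 1) ∂P) / (2 * μ ^ 2))) := by
  refine ⟨?_, Real.exp_pos _⟩
  have hln : ∀ n, (l n : ℝ) = ∑ k, (m n k : ℝ) := fun n => by rw [← hm n]; push_cast; rfl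
  have hl : Tendsto (fun n => (l n : ℝ) / n) atTop (nhds μ) := by
    simp_rw [hln]; exact hm1
  have hlinf : Tendsto (fun n => (l n : ℝ)) atTop atTop := by
    have h := hl.pos_mul_atTop hμ (tendsto_natCast_atTop_atTop (R := ℝ))
    refine h.congr' ?_
    filter_upwards [eventually_gt_atTop 0] with n hn
    have hn' : (n : ℝ) ≠ 0 := by positivity
    field_simp
  have hgg : Integrable (fun ω => (γ ω : ℝ) * ((γ ω : ℝ) - 1)) P := by
    refine (hintγ2.sub hintγ).congr (Eventually.of_forall fun ω => ?_)
    simp only [Pi.sub_apply]; ring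
  have hxx : Integrable (fun ω => (ξ ω : ℝ) * ((ξ ω : ℝ) - 1)) P := by
    refine (hintξ2.sub hintξ).congr (Eventually.of_forall fun ω => ?_)
    simp only [Pi.sub_apply]; ring
  have egg : ∫ ω, (γ ω : ℝ) * ((γ ω : ℝ) - 1) ∂P = (∫ ω, (γ ω : ℝ) ^ 2 ∂P) - μ := by
    rw [← hEγ, ← integral_sub hintγ2 hintγ]
    congr 1; funext ω; ring
  have exx : ∫ ω, (ξ ω : ℝ) * ((ξ ω : ℝ) - 1) ∂P = (∫ ω, (ξ ω : ℝ) ^ 2 ∂P) - μ := by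
    rw [← hEξ, ← integral_sub hintξ2 hintξ]
    congr 1; funext ω; ring
  have hfull := DCM.tend_lamb m d l μ hμ hl hlinf (fun _ _ => True)
    (∫ ω, (γ ω : ℝ) * (ξ ω : ℝ) ∂P) (∫ ω, (γ ω : ℝ) * ((γ ω : ℝ) - 1) ∂P)
    (∫ ω, (ξ ω : ℝ) * ((ξ ω : ℝ) - 1) ∂P)
    (by simpa using hcov)
    (by
      rw [egg]
      refine (hm2.sub hm1).congr fun n => ?_
      rw [← sub_div, ← Finset.sum_sub_distrib]
      congr 1
      refine Finset.sum_congr rfl fun v _ => ?_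
      rw [if_pos trivial]; ring)
    (by
      rw [exx]
      refine (hd2.sub hd1).congr fun n => ?_
      rw [← sub_div, ← Finset.sum_sub_distrib]
      congr 1
      refine Finset.sum_congr rfl fun v _ => ?_
      rw [if_pos trivial]; ring)
  have hlow := fun K : ℕ => DCM.tend_lamb m d l μ hμ hl hlinf (fun n v => m n v ≤ K ∧ d n v ≤ K)
    (∫ ω, (if γ ω ≤ K ∧ ξ ω ≤ K then (γ ω : ℝ) * (ξ ω : ℝ) else 0) ∂P)
    (∫ ω, (if γ ω ≤ K ∧ ξ ω ≤ K then (γ ω : ℝ) * ((γ ω : ℝ) - 1) else 0) ∂P)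
    (∫ ω, (if γ ω ≤ K ∧ ξ ω ≤ K then (ξ ω : ℝ) * ((ξ ω : ℝ) - 1) else 0) ∂P)
    ((DCM.tend_low P γ ξ hγ hξ m d hjoint K (fun i j => (i : ℝ) * j)).congr fun n => by
      congr 1
      refine Finset.sum_congr rfl fun v _ => ?_
      split_ifs <;> rfl)
    ((DCM.tend_low P γ ξ hγ hξ m d hjoint K (fun i j => (i : ℝ) * ((i : ℝ) - 1))).congr fun n => by
      congr 1
      refine Finset.sum_congr rfl fun v _ => ?_
      split_ifs <;> rfl)
    ((DCM.tend_low P γ ξ hγ hξ m d hjoint K (fun i j => (j : ℝ) * ((j : ℝ) - 1))).congr fun n => by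
      congr 1
      refine Finset.sum_congr rfl fun v _ => ?_
      split_ifs <;> rfl)
  have hLK := ((DCM.tend_K P γ ξ hγ hξ (fun i j => (i : ℝ) * j) hintprod).div_const μ).add
    (((DCM.tend_K P γ ξ hγ hξ (fun i j => (i : ℝ) * ((i : ℝ) - 1)) hgg).mul
      (DCM.tend_K P γ ξ hγ hξ (fun i j => (j : ℝ) * ((j : ℝ) - 1)) hxx)).div_const (2 * μ ^ 2))
  refine DCM.eps_arg _ _ _ _ _
    (fun K n => (200 * (K : ℝ) ^ 4 + 42 * (200 * (K : ℝ) ^ 4) ^ 2) / (l n : ℝ)) hfull hlow hLK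
    (fun K => hlinf.const_div_atTop _) ?_
  intro K hK
  filter_upwards [hlinf.eventually_ge_atTop 6] with n hn
  have hn' : 6 ≤ l n := by exact_mod_cast hn
  exact DCM.main_n hn' hK (vIn n) (vOut n) (m n) (d n) (fun v => m n v ≤ K ∧ d n v ≤ K)
    (hvIn n) (hvOut n) (fun v h => h)
end
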